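/- There exists a group G with a finite generating set such that (i) G is not virtually free, i.e. G has no free subgroup of finite index, and (ii) for every finite generating set S of G, both the strong directed snake problem and the strong directed infinite snake problem for (G,S) are decidable: the set of encoded directed tilesets over (G,S) that admit a strong directed snake, and the set of those that admit a strong directed infinite snake, are each computable predicates. -/

import Mathlib

/-!
STATEMENT 0: There exists a group `G` with a finite generating set such that
(i) `G` is not virtually free, and (ii) for every finite generating set `S` of `G`,
the strong directed snake problem and the strong directed infinite snake problem
for `(G, S)` are decidable (computable predicates on encoded directed tilesets).

Encoding: the generating set `S` is identified with `Fin m` via an injective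
enumeration `e : Fin m → G` whose range is `S`.  A directed tileset is encoded as
a pair `(k, D)` where colours are pairs `(a, b) ∈ Fin k × Fin m` (coded as pairs of
naturals with the bounds required explicitly) and `D` is a finite list of dominoes
`(c, s, c') ∈ C × S × C` (with `s` coded as a natural `< m`).
-/

/-- An encoded directed tileset: a number of base colours `k`, together with a list of
dominoes `((a,b), s, (a',b'))`; colours are pairs `(a, b)` with `a < k` and `b < m`,
dominoes carry a direction `s < m` in the middle. -/
abbrev EncDirTileset : Type := ℕ × List ((ℕ × ℕ) × ℕ × ℕ × ℕ)

/-- `StrongDirSnake e T n` holds if the Cayley graph of `G` with generators enumerated by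
`e : Fin m → G` admits a strong directed snake `ω : ℤ/nℤ → G` (with the convention
`ZMod 0 = ℤ`, so `n = 0` is the infinite snake and `n ≥ 1` an ouroboros) for the encoded
directed tileset `T = (k, D)`:
* `ω` is injective;
* every index carries a colour `x i = (a, b)` with `a < k` and `b < m` (i.e. a colour in
  `Fin k × Fin m`, the direction component living in `S ≃ Fin m`);
* the snake follows the directions: `ω (i+1) = ω i * e ⟨(x i).2⟩` (in particular every
  step `ω i⁻¹ * ω (i+1)` lies in `S`);
* the colouring is strong: whenever `g = ω i` and `g * s = ω j` both lie on the snake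
  (for some generator `s = e s̄`), the corresponding domino lies in `D`.
Since `ω` is injective, the colouring `x` on indices is the same as a colouring of the
image of `ω`. -/
def StrongDirSnake {G : Type} [Group G] {m : ℕ} (e : Fin m → G)
    (T : EncDirTileset) (n : ℕ) : Prop :=
  ∃ (ω : ZMod n → G) (x : ZMod n → ℕ × ℕ),
    Function.Injective ω ∧
    (∀ i, (x i).1 < T.1 ∧ (x i).2 < m) ∧
    (∀ i, ∃ h : (x i).2 < m, ω (i + 1) = ω i * e ⟨(x i).2, h⟩) ∧
    (∀ i j : ZMod n, ∀ s : Fin m, ω j = ω i * e s →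
      (x i, ((s : ℕ), x j)) ∈ T.2)

/-! ### Normal forms in HNN extensions -/

namespace HNNExtension

open NormalWord

section NormalForm

variable {V : Type*} [Group V] {A B : Subgroup V} {φ : A ≃* B}

/-- The head of the normal form. -/
noncomputable def hd (d : TransversalPair V A B) (z : HNNExtension V A B φ) : V :=
  (z • (empty : NormalWord d)).head

/-- The tail of the normal form. -/
noncomputable def ls (d : TransversalPair V A B) (z : HNNExtension V A B φ) : List (ℤˣ × V) :=
  (z • (empty : NormalWord d)).toList

/-- The element represented by a list of syllables. -/
def lprod (L : List (ℤˣ × V)) : HNNExtension V A B φ :=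
  (L.map (fun x => t ^ (x.1 : ℤ) * of x.2)).prod

/-- Lists which are tails of normal words. -/
def Nrm (d : TransversalPair V A B) (L : List (ℤˣ × V)) : Prop :=
  L.IsChain (fun a b => a.2 ∈ toSubgroup A B a.1 → a.1 = b.1) ∧
    ∀ (u : ℤˣ) (g : V), (u, g) ∈ L → g ∈ d.set u

variable (d : TransversalPair V A B)

theorem nrm_ls (z : HNNExtension V A B φ) : Nrm d (ls d z) :=
  ⟨(z • (empty : NormalWord d)).chain, (z • (empty : NormalWord d)).mem_set⟩

theorem hd_mul_lprod (z : HNNExtension V A B φ) : of (hd d z) * lprod (ls d z) = z :=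
  by
    have := prod_smul (φ := φ) (d := d) z empty
    simpa [hd, ls, lprod, ReducedWord.prod] using this

theorem hd_ls_of_nrm (g : V) {L : List (ℤˣ × V)} (h : Nrm d L) :
    hd d (of g * lprod L : HNNExtension V A B φ) = g ∧
      ls d (of g * lprod L : HNNExtension V A B φ) = L := by
  have := prod_smul_empty φ (d := d) ⟨⟨g, L, h.1⟩, h.2⟩
  simp only [ReducedWord.prod] at this
  unfold hd ls lprod
  rw [this]
  exact ⟨rfl, rfl⟩

theorem ext_hd_ls {x y : HNNExtension V A B φ} (h1 : hd d x = hd d y) (h2 : ls d x = ls d y) :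
    x = y := by
  rw [← hd_mul_lprod d x, ← hd_mul_lprod d y, h1, h2]

@[simp] theorem hd_of_mul (a : V) (z : HNNExtension V A B φ) : hd d (of a * z) = a * hd d z := by
  simp [hd, mul_smul, of_smul_eq_smul]

@[simp] theorem ls_of_mul (a : V) (z : HNNExtension V A B φ) : ls d (of a * z) = ls d z := by
  simp [ls, mul_smul, of_smul_eq_smul]

@[simp] theorem ls_one : ls d (1 : HNNExtension V A B φ) = [] := by simp [ls]

theorem t_step (z : HNNExtension V A B φ) :
    (∃ (b : A) (g : V), hd d z = b * g ∧ hd d (t * z) = φ b ∧ ls d (t * z) = (1, g) :: ls d z) ∨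
    (∃ (b : A) (g : V), hd d z = b ∧ ls d z = (-1, g) :: ls d (t * z) ∧
      hd d (t * z) = φ b * g) := by
  have key : (t * z) • (empty : NormalWord d) = unitsSMul φ 1 (z • (empty : NormalWord d)) := by
    rw [mul_smul, t_smul_eq_unitsSMul]
  unfold hd ls
  rw [key]
  generalize z • (empty : NormalWord d) = w
  by_cases hc : Cancels 1 w
  · right
    simp only [unitsSMul, dif_pos hc]
    induction w using consRecOn with
    | ofGroup => simp [Cancels] at hc
    | cons g u w h1 h2 _ =>
      have hu : u = -1 := by simpa [Cancels] using hc.2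
      subst hu
      refine ⟨⟨g, hc.1⟩, w.head, rfl, ?_, ?_⟩ <;> (simp [unitsSMulWithCancel]; try rfl)
  · left
    simp only [unitsSMul, dif_neg hc]
    refine ⟨((d.compl 1).equiv w.head).1, ((d.compl 1).equiv w.head).2, ?_, ?_, ?_⟩
    · exact ((d.compl 1).equiv_fst_mul_equiv_snd w.head).symm
    · simp [unitsSMulGroup]
      rfl
    · simp [unitsSMulGroup]

@[simp] theorem lprod_nil : (lprod [] : HNNExtension V A B φ) = 1 := rfl

@[simp] theorem lprod_cons (x : ℤˣ × V) (L : List (ℤˣ × V)) :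
    (lprod (x :: L) : HNNExtension V A B φ) = t ^ (x.1 : ℤ) * of x.2 * lprod L := by
  simp [lprod]

theorem lprod_append (L L' : List (ℤˣ × V)) :
    (lprod (L ++ L') : HNNExtension V A B φ) = lprod L * lprod L' := by
  simp [lprod]

variable {d}

theorem Nrm.tail {x : ℤˣ × V} {L : List (ℤˣ × V)} (h : Nrm (A := A) (B := B) d (x :: L)) :
    Nrm d L :=
  ⟨h.1.tail, fun u g hg => h.2 u g (List.mem_cons_of_mem _ hg)⟩

theorem Nrm.suffix {L L' : List (ℤˣ × V)} (h : Nrm (A := A) (B := B) d L) (hs : L' <:+ L) :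
    Nrm d L' :=
  ⟨h.1.suffix hs, fun u g hg => h.2 u g (hs.subset hg)⟩

theorem Nrm.hd_lprod {L : List (ℤˣ × V)} (h : Nrm (A := A) (B := B) d L) :
    hd d (lprod L : HNNExtension V A B φ) = 1 := by
  simpa using (hd_ls_of_nrm (φ := φ) d 1 h).1

theorem Nrm.ls_lprod {L : List (ℤˣ × V)} (h : Nrm (A := A) (B := B) d L) :
    ls d (lprod L : HNNExtension V A B φ) = L := by
  simpa using (hd_ls_of_nrm (φ := φ) d 1 h).2

variable (d)

theorem length_ls_t (z : HNNExtension V A B φ) :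
    (ls d (t * z)).length ≤ (ls d z).length + 1 ∧ (ls d z).length ≤ (ls d (t * z)).length + 1 := by
  rcases t_step d z with ⟨b, g, -, -, h⟩ | ⟨b, g, -, h, -⟩
  · simp [h]
    lia
  · simp [h]
    lia

theorem length_ls_zpow (k : ℤ) (z : HNNExtension V A B φ) :
    (ls d (t ^ k * z)).length ≤ (ls d z).length + k.natAbs := by
  have key : ∀ (n : ℕ) (z : HNNExtension V A B φ),
      (ls d (t ^ n * z)).length ≤ (ls d z).length + n ∧
      (ls d z).length ≤ (ls d (t ^ n * z)).length + n := by
    intro n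
    induction n with
    | zero => simp
    | succ n ih =>
      intro z
      have h1 := ih z
      have h2 := length_ls_t d (t ^ n * z)
      rw [← mul_assoc, ← pow_succ'] at h2
      lia
  obtain ⟨n, rfl | rfl⟩ := k.eq_nat_or_neg
  · simpa using (key n z).1
  · have := (key n (t ^ (-(n : ℤ)) * z)).2
    rw [← mul_assoc (t ^ n), zpow_neg, zpow_natCast, mul_inv_cancel, one_mul] at this
    simpa using this

open Classical in
/-- The indicator of the subtree above the node `M`. -/
noncomputable def ind (M : List (ℤˣ × V)) (z : HNNExtension V A B φ) : ℤ :=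
  if M <:+ ls d z then 1 else 0

@[simp] theorem ind_of_mul (M : List (ℤˣ × V)) (a : V) (z : HNNExtension V A B φ) :
    ind d M (of a * z) = ind d M z := by
  unfold ind
  rw [ls_of_mul]

/-- Elements whose edge crosses the boundary of a subtree with first sign `u`. -/
def crossing (u : ℤˣ) : Set (HNNExtension V A B φ) :=
  if u = 1 then {z | ∃ b : A, t * z = of (φ b : V)} else {z | ∃ b : A, z = of (b : V)}

open Classical in
theorem ind_t {u : ℤˣ} {g : V} {L : List (ℤˣ × V)} (h : Nrm (A := A) (B := B) d ((u, g) :: L))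
    (z : HNNExtension V A B φ) :
    ind d ((u, g) :: L) (t * (z * lprod ((u, g) :: L))) - ind d ((u, g) :: L)
      (z * lprod ((u, g) :: L)) = if z ∈ crossing u then (u : ℤ) else 0 := by
  set M := (u, g) :: L with hM
  set v : HNNExtension V A B φ := lprod M with hv
  have hvh : hd d v = 1 := h.hd_lprod
  have hvl : ls d v = M := h.ls_lprod
  have hlen : ∀ (x : HNNExtension V A B φ) (a : V), x = of a * v → ls d x = M := by
    rintro x a rfl
    simp [hvl]
  have hlen' : ∀ (x : HNNExtension V A B φ) (a : V), x = of a * (of g * lprod L) →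
      ls d x = L := by
    rintro x a rfl
    simp [h.tail.ls_lprod]
  have hchar : ∀ (x : HNNExtension V A B φ) (a : V), hd d x = a → ls d x = M → x = of a * v := by
    intro x a h1 h2
    apply ext_hd_ls d <;> simp [h1, h2, hvh, hvl]
  have hML : M.length = L.length + 1 := by simp [hM]
  rcases Int.units_eq_one_or u with hu | hu
  · have hcr : (z ∈ (crossing u : Set (HNNExtension V A B φ))) ↔
        ∃ b : A, t * z = of (φ b : V) := by simp [crossing, hu]
    have hvt : v = t * (of g * lprod L) := by simp [hv, hM, hu, mul_assoc]
    rw [hcr]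
    rcases t_step d (z * v) with ⟨b, g', h1, h2, h3⟩ | ⟨b, g', h1, h2, h3⟩
    · have : (∃ b : A, t * z = of (φ b : V)) ↔ M = (1, g') :: ls d (z * v) := by
        rw [← h3]
        constructor
        · rintro ⟨b, hb⟩
          rw [hlen _ (φ b : V)]
          rw [← mul_assoc, hb]
        · intro hh
          refine ⟨b, ?_⟩
          have := hchar _ _ h2 hh.symm
          rw [← mul_assoc] at this
          exact mul_right_cancel this
      simp only [ind, h3, List.suffix_cons_iff, this]
      by_cases hh : M = (1, g') :: ls d (z * v)
      · have : ¬ M <:+ ls d (z * v) := by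
          intro hs
          have := hs.length_le
          rw [hh] at this
          simp at this
        simp [hh, hu]
        simpa [← hh] using this
      · simp [hh]
    · have : ¬ ∃ b : A, t * z = of (φ b : V) := by
        rintro ⟨b', hb'⟩
        have e1 := hlen (t * (z * v)) (φ b' : V) (by rw [← mul_assoc, hb'])
        have e2 := hlen' (z * v) b' (by
          rw [hvt]
          have : z = of (b' : V) * t⁻¹ := by
            rw [← mul_right_inj t, hb', equiv_eq_conj, mul_assoc]
          rw [this]
          group)
        rw [e1, e2] at h2
        have := congrArg List.length h2
        simp at this
        lia
      have h4 : M ≠ (-1, g') :: ls d (t * (z * v)) := by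
        intro hh
        rw [hM, hu] at hh
        simp at hh
      simp [ind, h2, List.suffix_cons_iff, this, h4]
  · have hcr : (z ∈ (crossing u : Set (HNNExtension V A B φ))) ↔
        ∃ b : A, z = of (b : V) := by simp [crossing, hu]
    have hvt : v = t⁻¹ * (of g * lprod L) := by simp [hv, hM, hu, mul_assoc]
    rw [hcr]
    rcases t_step d (z * v) with ⟨b, g', h1, h2, h3⟩ | ⟨b, g', h1, h2, h3⟩
    · have : ¬ ∃ b : A, z = of (b : V) := by
        rintro ⟨b', hb'⟩
        have e1 := hlen (z * v) (b' : V) (by rw [hb'])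
        have e2 := hlen' (t * (z * v)) (φ b') (by
          rw [hvt, hb', ← mul_assoc, t_mul_of]
          group)
        rw [e1, e2] at h3
        have := congrArg List.length h3
        simp at this
        lia
      have h4 : M ≠ (1, g') :: ls d (z * v) := by
        intro hh
        rw [hM, hu] at hh
        simp at hh
      simp [ind, h3, List.suffix_cons_iff, this, h4]
    · have : (∃ b : A, z = of (b : V)) ↔ M = (-1, g') :: ls d (t * (z * v)) := by
        rw [← h2]
        constructor
        · rintro ⟨b, hb⟩
          rw [hlen _ (b : V)]
          rw [hb]
        · intro hh
          exact ⟨b, mul_right_cancel (hchar _ _ h1 hh.symm)⟩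
      simp only [ind, h2, List.suffix_cons_iff, this]
      by_cases hh : M = (-1, g') :: ls d (t * (z * v))
      · have : ¬ M <:+ ls d (t * (z * v)) := by
          intro hs
          have := hs.length_le
          rw [hh] at this
          simp at this
        simp [hh, hu]
        simpa [← hh] using this
      · simp [hh]

theorem ind_mul_lprod_eq {u : ℤˣ} {g g' : V} {L L' : List (ℤˣ × V)}
    (h : Nrm (A := A) (B := B) d ((u, g) :: L)) (h' : Nrm (A := A) (B := B) d ((u, g') :: L'))
    (z : HNNExtension V A B φ) :
    ind d ((u, g) :: L) (z * lprod ((u, g) :: L)) =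
      ind d ((u, g') :: L') (z * lprod ((u, g') :: L')) := by
  suffices H : ∀ w : HNNExtension V A B φ, ∀ z : HNNExtension V A B φ,
      ind d ((u, g) :: L) (w * z * lprod ((u, g) :: L)) -
        ind d ((u, g) :: L) (z * lprod ((u, g) :: L)) =
      ind d ((u, g') :: L') (w * z * lprod ((u, g') :: L')) -
        ind d ((u, g') :: L') (z * lprod ((u, g') :: L')) by
    have := H z 1
    have e1 : ind d ((u, g) :: L) (lprod ((u, g) :: L) : HNNExtension V A B φ) = 1 := by
      simp only [ind, h.ls_lprod, List.suffix_rfl, if_true]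
    have e2 : ind d ((u, g') :: L') (lprod ((u, g') :: L') : HNNExtension V A B φ) = 1 := by
      simp only [ind, h'.ls_lprod, List.suffix_rfl, if_true]
    rw [mul_one, one_mul, one_mul, e1, e2] at this
    linarith
  intro w
  induction w using HNNExtension.induction_on with
  | of a => intro z; simp [mul_assoc]
  | t =>
    intro z
    rw [mul_assoc, ind_t d h, mul_assoc, ind_t d h']
  | mul x y hx hy =>
    intro z
    have h1 := hx (y * z)
    have h2 := hy z
    rw [← mul_assoc] at h1
    linarith
  | inv x hx =>
    intro z
    have := hx (x⁻¹ * z)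
    rw [← mul_assoc, mul_inv_cancel, one_mul] at this
    linarith

theorem exists_of_ind_zpow_ne {u : ℤˣ} {g : V} {L : List (ℤˣ × V)}
    (h : Nrm (A := A) (B := B) d ((u, g) :: L)) (k : ℤ) (z : HNNExtension V A B φ)
    (hne : ind d ((u, g) :: L) (t ^ k * z * lprod ((u, g) :: L)) ≠
      ind d ((u, g) :: L) (z * lprod ((u, g) :: L))) :
    ∃ (i : ℤ) (a : V), |i| ≤ |k| ∧ z = t ^ i * of a := by
  classical
  have key : ∀ (n : ℕ) (z : HNNExtension V A B φ),
      ind d ((u, g) :: L) (t ^ n * z * lprod ((u, g) :: L)) ≠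
      ind d ((u, g) :: L) (z * lprod ((u, g) :: L)) →
      ∃ (i : ℤ) (a : V), -n ≤ i ∧ i ≤ 0 ∧ z = t ^ i * of a := by
    intro n
    induction n with
    | zero => simp
    | succ n ih =>
      intro z hz
      by_cases h0 : ind d ((u, g) :: L) (t ^ n * z * lprod ((u, g) :: L)) =
        ind d ((u, g) :: L) (z * lprod ((u, g) :: L))
      · rw [← h0, pow_succ', mul_assoc, mul_assoc, ← mul_assoc (t ^ n), ← sub_ne_zero,
          ind_t d h] at hz
        have hz' : t ^ n * z ∈ (crossing u : Set (HNNExtension V A B φ)) := by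
          by_contra hcon
          simp [hcon] at hz
        rcases Int.units_eq_one_or u with hu | hu
        · simp only [crossing, hu, if_true] at hz'
          obtain ⟨b, hb⟩ := hz'
          refine ⟨-(n + 1 : ℕ), (φ b : V), by lia, by lia, ?_⟩
          rw [← hb, ← mul_assoc t, ← pow_succ', zpow_neg, zpow_natCast, inv_mul_cancel_left]
        · have : ((-1 : ℤˣ) = 1) = False := by decide
          simp only [crossing, hu, this, if_false] at hz'
          obtain ⟨b, hb⟩ := hz'
          refine ⟨-(n : ℕ), (b : V), by lia, by lia, ?_⟩
          rw [← hb, zpow_neg, zpow_natCast, inv_mul_cancel_left]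
      · obtain ⟨i, a, h1, h2, h3⟩ := ih z h0
        exact ⟨i, a, by lia, h2, h3⟩
  obtain ⟨n, rfl | rfl⟩ := k.eq_nat_or_neg
  · obtain ⟨i, a, h1, h2, h3⟩ := key n z (by simpa using hne)
    exact ⟨i, a, by rw [abs_of_nonpos h2, abs_of_nonneg (by lia)]; lia, h3⟩
  · obtain ⟨i, a, h1, h2, h3⟩ := key n (t ^ (-(n : ℤ)) * z) (by
      rw [← mul_assoc, zpow_neg, zpow_natCast, mul_inv_cancel, one_mul]
      simpa using hne.symm)
    refine ⟨n + i, a, ?_, ?_⟩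
    · rw [abs_of_nonneg (by lia), abs_neg, abs_of_nonneg (by lia)]; lia
    · rw [zpow_add, mul_assoc, ← h3, ← mul_assoc, ← zpow_add]
      simp

end NormalForm

end HNNExtension

/-! ### Combinatorial lemmas -/

open Finset in
/-- A long walk of large gain contains a short closed walk of positive gain. -/
theorem exists_closed_walk {S : Type*} [Fintype S] {St : S → S → Prop} {w : S → ℤ} {K : ℕ}
    (hK : Fintype.card S ≤ K) (hw : ∀ s, w s ≤ 1) (N : ℕ) (s : ℕ → S)
    (hs : ∀ i < N, St (s i) (s (i + 1))) (hg : (K : ℤ) < ∑ i ∈ range N, w (s (i + 1))) :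
    ∃ (l : ℕ) (s : ℕ → S), 0 < l ∧ l ≤ K ∧ s l = s 0 ∧ (∀ i < l, St (s i) (s (i + 1))) ∧
      0 < ∑ i ∈ range l, w (s (i + 1)) := by
  induction N using Nat.strong_induction_on generalizing s with
  | _ N ih =>
    have hle : ∑ i ∈ range N, w (s (i + 1)) ≤ N := by
      calc _ ≤ ∑ i ∈ range N, (1 : ℤ) := sum_le_sum fun i _ => hw _
        _ = N := by simp
    have hN : K < N := by exact_mod_cast hg.trans_le hle
    obtain ⟨a, b, hab, hsab⟩ : ∃ a b : Fin (K + 1), a < b ∧ s a = s b := by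
      obtain ⟨a, b, hne, h⟩ := Fintype.exists_ne_map_eq_of_card_lt
        (fun i : Fin (K + 1) => s i) (by simp; lia)
      rcases lt_or_gt_of_ne hne with h' | h'
      · exact ⟨a, b, h', h⟩
      · exact ⟨b, a, h', h.symm⟩
    obtain ⟨a, ha⟩ := a
    obtain ⟨b, hb⟩ := b
    simp only [Fin.mk_lt_mk] at hab hsab
    obtain ⟨l, rfl⟩ : ∃ l, b = a + l := ⟨b - a, by lia⟩
    obtain ⟨N, rfl⟩ : ∃ n, N = n + l := ⟨N - l, by lia⟩
    by_cases hpos : 0 < ∑ i ∈ range l, w (s (a + (i + 1)))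
    · refine ⟨l, fun i => s (a + i), by lia, by lia, by simpa using hsab.symm, ?_, hpos⟩
      intro i hi
      exact hs (a + i) (by lia)
    · refine ih N (by lia) (fun n => if n ≤ a then s n else s (n + l)) ?_ ?_
      · intro i hi
        rcases lt_trichotomy i a with h | h | h
        · rw [if_pos (by lia), if_pos (by lia)]
          exact hs i (by lia)
        · subst h
          rw [if_pos le_rfl, if_neg (by lia), hsab]
          have := hs (i + l) (by lia)
          rwa [show i + 1 + l = i + l + 1 by ring]
        · rw [if_neg (by lia), if_neg (by lia), show i + 1 + l = i + l + 1 by ring]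
          exact hs (i + l) (by lia)
      · obtain ⟨e, rfl⟩ : ∃ e, N = a + e := ⟨N - a, by lia⟩
        have e1 : ∑ i ∈ range (a + e + l), w (s (i + 1)) =
            ∑ i ∈ range a, w (s (i + 1)) + ∑ i ∈ range l, w (s (a + (i + 1))) +
              ∑ i ∈ range e, w (s (a + i + 1 + l)) := by
          rw [show a + e + l = a + l + e by ring, sum_range_add, sum_range_add]
          congr 1
          refine sum_congr rfl fun i _ => ?_
          congr 2
          ring
        rw [e1] at hg
        have e2 : ∑ i ∈ range (a + e), w (if i + 1 ≤ a then s (i + 1) else s (i + 1 + l)) =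
            ∑ i ∈ range a, w (s (i + 1)) + ∑ i ∈ range e, w (s (a + i + 1 + l)) := by
          rw [sum_range_add]
          congr 1
          · refine sum_congr rfl fun i hi => ?_
            rw [mem_range] at hi
            rw [if_pos (by lia)]
          · refine sum_congr rfl fun i _ => ?_
            rw [if_neg (by lia)]
        rw [e2]
        lia

open Finset in
/-- A long walk of large gain yields an infinite walk of linearly growing gain. -/
theorem exists_infinite_walk {S : Type*} [Fintype S] {St : S → S → Prop} {w : S → ℤ} {K : ℕ}
    (hK : Fintype.card S ≤ K) (hw : ∀ s, |w s| ≤ 1) (N : ℕ) (s : ℕ → S)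
    (hs : ∀ i < N, St (s i) (s (i + 1))) (hg : (K : ℤ) < ∑ i ∈ range N, w (s (i + 1))) :
    ∃ s : ℕ → S, (∀ i, St (s i) (s (i + 1))) ∧ ∀ i j : ℕ, i ≤ j →
      (j : ℤ) - i ≤ K * (∑ n ∈ range j, w (s (n + 1)) - ∑ n ∈ range i, w (s (n + 1)) + K) := by
  obtain ⟨l, s, hl, hlK, hper, hst, hpos⟩ :=
    exists_closed_walk hK (fun s => (abs_le.1 (hw s)).2) N s hs hg
  have hsucc : ∀ n, s ((n + 1) % l) = s (n % l + 1) := by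
    intro n
    have h1 := Nat.mod_lt n hl
    rcases Nat.lt_or_ge (n % l + 1) l with h | h
    · rw [Nat.add_mod, Nat.mod_eq_of_lt (show 1 < l by lia), Nat.mod_eq_of_lt h]
    · have h2 : n % l + 1 = l := by lia
      rw [h2, hper, Nat.add_mod, ← Nat.add_mod_mod, Nat.mod_mod]
      rcases Nat.lt_or_ge 1 l with h3 | h3
      · simp [Nat.mod_eq_of_lt h3, h2]
      · obtain rfl : l = 1 := by lia
        simp [Nat.mod_one]
  refine ⟨fun n => s (n % l), fun n => ?_, ?_⟩
  · simp only [hsucc]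
    exact hst _ (Nat.mod_lt n hl)
  set G : ℕ → ℤ := fun j => ∑ n ∈ range j, w (s ((n + 1) % l)) with hG
  have hGl : 0 < G l := by
    refine hpos.trans_eq (sum_congr rfl fun i hi => ?_)
    rw [hsucc, Nat.mod_eq_of_lt (mem_range.1 hi)]
  have hGper : ∀ n, G (n + l) = G n + G l := by
    intro n
    simp only [hG]
    rw [add_comm n l, sum_range_add, add_comm]
    congr 1
    refine sum_congr rfl fun i _ => ?_
    rw [add_assoc, Nat.add_mod_left]
  have hGq : ∀ q n, G (n + q * l) = G n + q * G l := by
    intro q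
    induction q with
    | zero => simp
    | succ q ih =>
      intro n
      rw [show n + (q + 1) * l = n + q * l + l by ring, hGper, ih]
      push_cast
      ring
  have hlip : ∀ r n, G n - r ≤ G (n + r) := by
    intro r
    induction r with
    | zero => simp
    | succ r ih =>
      intro n
      have h1 := ih n
      have h2 : G (n + (r + 1)) = G (n + r) + w (s ((n + r + 1) % l)) := by
        simp only [hG]
        rw [← add_assoc, sum_range_succ]
      have h3 := (abs_le.1 (hw (s ((n + r + 1) % l)))).1
      push_cast
      lia
  intro i j hij
  show (j : ℤ) - i ≤ K * (G j - G i + K)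
  obtain ⟨e, rfl⟩ : ∃ e, j = i + e := ⟨j - i, by lia⟩
  have h1 := Nat.div_add_mod e l
  have h2 := Nat.mod_lt e hl
  have h3 : G (i + e) = G (i + e % l) + (e / l : ℕ) * G l := by
    rw [← hGq]
    congr 1
    nlinarith
  have h4 := hlip (e % l) i
  set q := e / l
  set r := e % l
  have h5 : (q : ℤ) ≤ q * G l := by nlinarith [Int.natCast_nonneg q]
  have h6 : (q : ℤ) - r ≤ G (i + e) - G i := by lia
  have h7 : (e : ℤ) = l * q + r := by exact_mod_cast h1.symm
  have h8 : (r : ℤ) + 1 ≤ l := by exact_mod_cast h2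
  have h9 : (l : ℤ) ≤ K := by exact_mod_cast hlK
  have h10 : (e : ℤ) ≤ l * (G (i + e) - G i + l) := by
    have : (0 : ℤ) ≤ r := Int.natCast_nonneg r
    nlinarith
  have h11 : 0 ≤ G (i + e) - G i + l := by
    by_contra hcon
    push Not at hcon
    have : (0 : ℤ) ≤ e := Int.natCast_nonneg e
    nlinarith
  push_cast
  nlinarith

/-- An increasing sequence of sets obtained by iterating an operator stabilises within the
cardinality of the type. -/
theorem iterate_stable {S : Type*} [Fintype S] (f : ℕ → Set S)
    (hmono : ∀ n, f n ⊆ f (n + 1)) (hstep : ∀ n, f n = f (n + 1) → f (n + 1) = f (n + 2))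
    {K : ℕ} (hK : Fintype.card S ≤ K) (n : ℕ) : f n ⊆ f K := by
  classical
  have hm : Monotone f := monotone_nat_of_le_succ hmono
  by_cases h : ∃ i ≤ K, f i = f (i + 1)
  · obtain ⟨i, hi, he⟩ := h
    have hc : ∀ j, f (i + j) = f (i + j + 1) := by
      intro j
      induction j with
      | zero => exact he
      | succ j ih => exact hstep _ ih
    have hc' : ∀ j, f (i + j) = f i := by
      intro j
      induction j with
      | zero => rfl
      | succ j ih => rw [← ih, hc j]; rfl
    rcases le_total n K with h | h
    · exact hm h
    · obtain ⟨a, rfl⟩ : ∃ a, n = i + a := ⟨n - i, by lia⟩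
      rw [hc']
      exact hm hi
  · push Not at h
    exfalso
    have hcard : ∀ j, j ≤ K + 1 → j ≤ (f j).toFinset.card := by
      intro j
      induction j with
      | zero => simp
      | succ j ih =>
        intro hj
        have h1 := ih (by lia)
        have h2 : (f j).toFinset ⊂ (f (j + 1)).toFinset := by
          rw [Set.toFinset_ssubset_toFinset]
          exact (hmono j).ssubset_of_ne (h j (by lia))
        have := Finset.card_lt_card h2
        lia
    have h1 := hcard (K + 1) le_rfl
    have h2 := Finset.card_le_univ (f (K + 1)).toFinset
    lia

open Finset in
/-- If a partially defined injective dynamics carries a positive amount of flow across a cut, then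
some orbit leads from one side to the other. -/
theorem exists_orbit_of_flow_pos {X : Type*} (F : Finset X) (f : X → X) (Lf Rt : Set X)
    (r : X → ℤ) (hr : ∀ x, r x = 0 ∨ r x = 1)
    (h1 : ∀ x ∈ F, x ∉ Lf → x ∉ Rt → f x ∈ F)
    (h2 : ∀ x ∈ F, x ∉ Lf → x ∉ Rt → ∀ y ∈ F, y ∉ Lf → y ∉ Rt → f x = f y → x = y)
    (h3 : ∀ y ∈ F, y ∉ Lf → y ∉ Rt → ∃ x ∈ F, f x = y)
    (hL : ∀ x ∈ F, x ∈ Lf → r x = 0 ∧ r (f x) = 0)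
    (hR : ∀ x ∈ F, x ∈ Rt → r x = 1 ∧ r (f x) = 1)
    (hpos : 0 < ∑ x ∈ F, (r (f x) - r x)) :
    ∃ x ∈ F, x ∈ Lf ∧ ∃ n, (∀ i ≤ n, f^[i] x ∈ F) ∧ f^[n] x ∈ Rt := by
  classical
  by_contra hcon
  push Not at hcon
  let X₁ := F.filter fun y => ∃ x ∈ F, x ∈ Lf ∧ ∃ n, (∀ i ≤ n, f^[i] x ∈ F) ∧ f^[n] x = y
  let X₂ := F.filter fun y => ¬ ∃ x ∈ F, x ∈ Lf ∧ ∃ n, (∀ i ≤ n, f^[i] x ∈ F) ∧ f^[n] x = y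
  have hX₁ : ∀ x, x ∈ X₁ ↔ x ∈ F ∧ ∃ z ∈ F, z ∈ Lf ∧ ∃ n, (∀ i ≤ n, f^[i] z ∈ F) ∧ f^[n] z = x :=
    fun x => mem_filter
  have hX₂ : ∀ x, x ∈ X₂ ↔ x ∈ F ∧ x ∉ X₁ := by
    intro x
    rw [hX₁]
    simp only [X₂, mem_filter]
    exact ⟨fun h => ⟨h.1, fun h' => h.2 h'.2⟩, fun h => ⟨h.1, fun h' => h.2 ⟨h.1, h'⟩⟩⟩
  have hsplit : ∑ x ∈ X₁, (r (f x) - r x) + ∑ x ∈ X₂, (r (f x) - r x) =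
      ∑ x ∈ F, (r (f x) - r x) := sum_filter_add_sum_filter_not _ _ _
  clear_value X₁ X₂
  have hLX : ∀ x ∈ F, x ∈ Lf → x ∈ X₁ := fun x hx hl =>
    (hX₁ x).2 ⟨hx, x, hx, hl, 0, by simpa using hx, rfl⟩
  have hRX : ∀ x ∈ X₁, x ∉ Rt := by
    intro x hx hxr
    obtain ⟨-, z, hz, hzl, n, hn, rfl⟩ := (hX₁ x).1 hx
    exact hcon z hz hzl n hn hxr
  have hclosed : ∀ x ∈ X₁, f x ∈ F → f x ∈ X₁ := by
    intro x hx hfx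
    obtain ⟨-, z, hz, hzl, n, hn, rfl⟩ := (hX₁ x).1 hx
    rw [← Function.iterate_succ_apply' f n z] at hfx ⊢
    refine (hX₁ _).2 ⟨hfx, z, hz, hzl, n + 1, ?_, rfl⟩
    intro i hi
    rcases Nat.lt_or_ge n i with h | h
    · obtain rfl : i = n + 1 := by lia
      exact hfx
    · exact hn i h
  have hr0 : ∀ x, 0 ≤ r x := fun x => by rcases hr x with h | h <;> lia
  have hr1 : ∀ x, r x ≤ 1 := fun x => by rcases hr x with h | h <;> lia
  have b1 : ∑ x ∈ X₁, (r (f x) - r x) ≤ 0 := by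
    have e1 : ∑ x ∈ X₁, (r (f x) - r x) = ∑ x ∈ X₁ with x ∉ Lf, (r (f x) - r x) := by
      rw [sum_filter]
      refine sum_congr rfl fun x hx => ?_
      by_cases h : x ∈ Lf
      · have := hL x ((hX₁ x).1 hx).1 h
        simp [h]
        lia
      · simp [h]
    have e2 : ∑ x ∈ X₁, r x = ∑ x ∈ X₁ with x ∉ Lf, r x := by
      rw [sum_filter]
      refine sum_congr rfl fun x hx => ?_
      by_cases h : x ∈ Lf
      · simpa [h] using (hL x ((hX₁ x).1 hx).1 h).1
      · simp [h]
    rw [e1, sum_sub_distrib, ← e2, sub_nonpos]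
    have hinj : Set.InjOn f (X₁.filter fun x => x ∉ Lf : Finset X) := by
      intro x hx y hy hxy
      simp only [coe_filter, Set.mem_ofPred_eq] at hx hy
      exact h2 x ((hX₁ x).1 hx.1).1 hx.2 (hRX x hx.1) y ((hX₁ y).1 hy.1).1 hy.2 (hRX y hy.1) hxy
    rw [← sum_image (f := r) hinj]
    refine sum_le_sum_of_subset_of_nonneg ?_ fun x _ _ => hr0 x
    intro y hy
    obtain ⟨x, hx, rfl⟩ := mem_image.1 hy
    rw [mem_filter] at hx
    exact hclosed x hx.1 (h1 x ((hX₁ x).1 hx.1).1 hx.2 (hRX x hx.1))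
  have b2 : ∑ x ∈ X₂, (r (f x) - r x) ≤ 0 := by
    have hX₂L : ∀ x ∈ X₂, x ∉ Lf := fun x hx hl =>
      ((hX₂ x).1 hx).2 (hLX x ((hX₂ x).1 hx).1 hl)
    have e1 : ∑ x ∈ X₂, (r (f x) - r x) = ∑ x ∈ X₂ with x ∉ Rt, ((1 - r x) - (1 - r (f x))) := by
      rw [sum_filter]
      refine sum_congr rfl fun x hx => ?_
      by_cases h : x ∈ Rt
      · have := hR x ((hX₂ x).1 hx).1 h
        simp [h]
        lia
      · simp [h]
    rw [e1, sum_sub_distrib, sub_nonpos]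
    choose! p hpF hp using h3
    have hpX : ∀ y ∈ X₂, y ∉ Rt → p y ∈ X₂ := by
      intro y hy hyr
      have hyF := ((hX₂ y).1 hy).1
      rw [hX₂]
      refine ⟨hpF y hyF (hX₂L y hy) hyr, fun hcon' => ((hX₂ y).1 hy).2 ?_⟩
      rw [← hp y hyF (hX₂L y hy) hyr]
      apply hclosed _ hcon'
      rw [hp y hyF (hX₂L y hy) hyr]
      exact hyF
    set Y := X₂.filter fun x => x ∉ Rt
    have hY : ∀ y, y ∈ Y ↔ y ∈ X₂ ∧ y ∉ Rt := fun y => mem_filter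
    clear_value Y
    have hpf : ∀ y ∈ Y, f (p y) = y := fun y hy =>
      hp y ((hX₂ y).1 ((hY y).1 hy).1).1 (hX₂L y ((hY y).1 hy).1) ((hY y).1 hy).2
    have hinj : Set.InjOn p (Y.filter fun y => r y = 0 : Finset X) := by
      intro x hx y hy hxy
      simp only [coe_filter, Set.mem_ofPred_eq] at hx hy
      rw [← hpf x hx.1, ← hpf y hy.1, hxy]
    calc ∑ y ∈ Y, (1 - r y) = ∑ y ∈ Y with r y = 0, (1 - r y) := by
          rw [sum_filter]
          refine sum_congr rfl fun x _ => ?_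
          rcases hr x with h | h <;> simp [h]
      _ = ∑ y ∈ Y with r y = 0, (1 - r (f (p y))) := by
          refine sum_congr rfl fun y hy => ?_
          rw [hpf y (mem_filter.1 hy).1]
      _ = ∑ x ∈ (Y.filter fun y => r y = 0).image p, (1 - r (f x)) := (sum_image (f := fun x => 1 - r (f x)) hinj).symm
      _ ≤ ∑ x ∈ Y, (1 - r (f x)) := by
          refine sum_le_sum_of_subset_of_nonneg ?_ fun x _ _ => by linarith [hr1 (f x)]
          intro x hx
          obtain ⟨y, hy, rfl⟩ := mem_image.1 hx
          rw [mem_filter, hY] at hy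
          rw [hY]
          refine ⟨hpX y hy.1.1 hy.1.2, fun hxr => ?_⟩
          have h5 := (hR (p y) ((hX₂ _).1 (hpX y hy.1.1 hy.1.2)).1 hxr).2
          rw [hpf y ((hY y).2 hy.1)] at h5
          lia
  lia

/-! ### Configurations and labels on HNN extensions -/

namespace HNNExtension

open NormalWord

section Labels

variable {V : Type*} [Group V] {A B : Subgroup V} {φ : A ≃* B}
variable {C : Type*} {m : ℕ} (c : ℕ)

/-- The window of exponents. -/
abbrev Win (c : ℕ) : Type := {i : ℤ // i ∈ Finset.Icc (-(c : ℤ)) c}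

/-- Local views of configurations. -/
abbrev Lab (V C : Type*) (m c : ℕ) : Type _ := Win c × V → Option (C × Fin m)

/-- The centre of the window. -/
def winZero (c : ℕ) : Win c := ⟨0, by simp⟩

/-- The local view of a configuration at a group element. -/
def view (χ : HNNExtension V A B φ → Option (C × Fin m)) (x : HNNExtension V A B φ) :
    Lab V C m c := fun ia => χ (t ^ (ia.1 : ℤ) * of ia.2 * x)

variable {c}

/-- Translation of local views by the base group. -/
def act (a : V) (p : Lab V C m c) : Lab V C m c := fun ib => p (ib.1, ib.2 * a)

/-- The blank label. -/
def blank : Lab V C m c := fun _ => none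

@[simp] theorem act_one (p : Lab V C m c) : act 1 p = p := by
  funext ib
  simp [act]

theorem act_mul (a b : V) (p : Lab V C m c) : act (a * b) p = act a (act b p) := by
  funext ib
  simp [act, mul_assoc]

theorem view_of_mul (χ : HNNExtension V A B φ → Option (C × Fin m)) (a : V)
    (x : HNNExtension V A B φ) : view c χ (of a * x) = act a (view c χ x) := by
  funext ib
  simp [act, view, mul_assoc]

variable (φ) in
/-- Compatibility of local views at `z` and `t * z`. -/
def EE (p q : Lab V C m c) : Prop :=
  ∀ i j : Win c, (j : ℤ) = i + 1 → ∀ b : A, q (i, (φ b : V)) = p (j, (b : V))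

theorem ee_view (χ : HNNExtension V A B φ → Option (C × Fin m)) (x : HNNExtension V A B φ) :
    EE φ (view c χ x) (view c χ (t * x)) := by
  intro i j hij b
  simp only [view]
  congr 1
  rw [hij, zpow_add, zpow_one]
  simp only [mul_assoc]
  rw [← mul_assoc t, t_mul_of, mul_assoc]

theorem EE.act {p q : Lab V C m c} (h : EE φ p q) (b : A) :
    EE φ (act (b : V) p) (act (φ b : V) q) := by
  intro i j hij b'
  have := h i j hij (b' * b)
  simpa [HNNExtension.act] using this

theorem ee_blank : EE φ (blank : Lab V C m c) blank := fun _ _ _ _ => rfl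

variable (φ) in
/-- Compatibility along an edge of the tree with sign `u`. -/
def Ed (u : ℤˣ) (p q : Lab V C m c) : Prop := if u = 1 then EE φ p q else EE φ q p

theorem ed_blank (u : ℤˣ) : Ed φ u (blank : Lab V C m c) blank := by
  unfold Ed
  split_ifs <;> exact ee_blank

theorem ed_view (χ : HNNExtension V A B φ → Option (C × Fin m)) (u : ℤˣ) (g : V)
    (x : HNNExtension V A B φ) :
    Ed φ u (act g (view c χ x)) (view c χ (t ^ (u : ℤ) * of g * x)) := by
  rw [← view_of_mul, mul_assoc]
  generalize of g * x = y
  rcases Int.units_eq_one_or u with rfl | rfl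
  · simpa [Ed] using ee_view χ y
  · have : ((-1 : ℤˣ) = 1) = False := by decide
    have h := ee_view (c := c) χ (t⁻¹ * y)
    simpa [Ed, this] using h

variable (A B) in
/-- `(u', g)` may be put in front of a reduced list starting with sign `u`. -/
def Red (d : TransversalPair V A B) (u u' : ℤˣ) (g : V) : Prop :=
  g ∈ d.set u' ∧ (g ∈ toSubgroup A B u' → u' = u)

theorem nrm_cons_cons {d : TransversalPair V A B} {u u' : ℤˣ} {g g' : V} {L : List (ℤˣ × V)} :
    Nrm d ((u', g') :: (u, g) :: L) ↔ Red A B d u u' g' ∧ Nrm d ((u, g) :: L) := by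
  simp only [Nrm, Red, List.isChain_cons_cons, List.mem_cons, Prod.mk.injEq]
  constructor
  · rintro ⟨⟨h1, h2⟩, h3⟩
    exact ⟨⟨h3 u' g' (Or.inl ⟨rfl, rfl⟩), h1⟩, h2, fun u₁ g₁ h => h3 _ _ (Or.inr h)⟩
  · rintro ⟨⟨h1, h2⟩, h3, h4⟩
    refine ⟨⟨h2, h3⟩, ?_⟩
    rintro u₁ g₁ (⟨rfl, rfl⟩ | h)
    · exact h1
    · exact h4 _ _ h

/-- The data of a directed tileset over generators whose inverses are `t ^ κ s * of (α s)`. -/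
structure Rule (V C : Type*) (m c : ℕ) where
  /-- The direction carried by a colour. -/
  dir : C → Fin m
  /-- The allowed dominoes. -/
  Dm : C → Fin m → C → Prop
  /-- The exponents of the inverse generators. -/
  κ : Fin m → ℤ
  /-- The base group components of the inverse generators. -/
  α : Fin m → V
  hκ : ∀ s, κ s ∈ Finset.Icc (-(c : ℤ)) c

variable (ρ : Rule V C m c)

variable (φ) in
/-- The inverse of a generator. -/
def Rule.step (s : Fin m) : HNNExtension V A B φ := t ^ ρ.κ s * of (ρ.α s)

/-- The local rule between a cell and its neighbour in direction `s`. -/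
def RR (s : Fin m) (x y : Option (C × Fin m)) : Prop :=
  (∀ p q, x = some p → y = some q → ρ.Dm p.1 s q.1) ∧
  (∀ p, x = some p → ρ.dir p.1 = s → ∃ a, y = some (a, s)) ∧
  (∀ a, y = some (a, s) → ∃ p, x = some p ∧ ρ.dir p.1 = s)

theorem rr_none (s : Fin m) : RR ρ s none none := by simp [RR]

/-- The set of rules at a label. -/
def Valid (p : Lab V C m c) : Prop :=
  ∀ a : V, ∀ s, RR ρ s (p (winZero c, a)) (p (⟨ρ.κ s, ρ.hκ s⟩, ρ.α s * a))

theorem valid_blank : Valid ρ (blank : Lab V C m c) := fun _ s => rr_none ρ s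

theorem valid_view (χ : HNNExtension V A B φ → Option (C × Fin m)) (x : HNNExtension V A B φ) :
    Valid ρ (view c χ x) ↔
      ∀ a s, RR ρ s (χ (of a * x)) (χ (ρ.step φ s * (of a * x))) := by
  simp [Valid, view, winZero, mul_assoc, Rule.step]

theorem Valid.act {p : Lab V C m c} (h : Valid ρ p) (a : V) :
    Valid ρ (act a p) := by
  intro b s
  have := h (b * a) s
  simpa [HNNExtension.act, mul_assoc] using this

variable (φ) (d : TransversalPair V A B)

/-- Labels (with the sign of the node carrying them) that can be extended to a finitely supported
labelling of depth `n` of the subtree above. -/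
def fill : ℕ → Set (Lab V C m c × ℤˣ)
  | 0 => {x | x.1 = blank}
  | n + 1 => {x | Valid ρ x.1 ∧ ∀ u' g, Red A B d x.2 u' g →
      ∃ q, Ed φ u' (act g x.1) q ∧ (q, u') ∈ fill n}

theorem fill_succ (n : ℕ) : fill φ ρ d n ⊆ fill φ ρ d (n + 1) := by
  induction n with
  | zero =>
    rintro ⟨p, u⟩ hp
    obtain rfl : p = blank := hp
    exact ⟨valid_blank ρ, fun u' g _ => ⟨blank, ed_blank u', rfl⟩⟩
  | succ n ih =>
    rintro ⟨p, u⟩ hp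
    refine ⟨hp.1, fun u' g hr => ?_⟩
    obtain ⟨q, h1, h2⟩ := hp.2 u' g hr
    exact ⟨q, h1, ih h2⟩

theorem fill_mono : Monotone (fill φ ρ d) := 
  monotone_nat_of_le_succ (fill_succ φ ρ d)

theorem fill_subset [Finite V] [Finite C] {K : ℕ}
    (hK : Nat.card (Lab V C m c × ℤˣ) ≤ K) (n : ℕ) :
    fill φ ρ d n ⊆ fill φ ρ d K := by
  classical
  have := Fintype.ofFinite V
  have := Fintype.ofFinite C
  refine iterate_stable _ (fill_succ φ ρ d) ?_ (by simpa using hK) n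
  intro n hn
  have e : ∀ n, fill φ ρ d (n + 1) = {x | Valid ρ x.1 ∧ ∀ u' g, Red A B d x.2 u' g →
      ∃ q, Ed φ u' (act g x.1) q ∧ (q, u') ∈ fill φ ρ d n} := fun _ => rfl
  rw [e (n + 1), ← hn]
  exact hn

end Labels

end HNNExtension

/-! ### Height and flow -/

namespace HNNExtension

open NormalWord

section Flow

variable {V : Type*} [Group V] {A B : Subgroup V} {φ : A ≃* B}

/-- The height homomorphism (with an orientation `σ`), as an integer valued function. -/
noncomputable def ht (σ : ℤˣ) (x : HNNExtension V A B φ) : ℤ :=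
  Multiplicative.toAdd (lift (1 : V →* Multiplicative ℤ) (Multiplicative.ofAdd (σ : ℤ))
    (by simp) x)

variable (σ : ℤˣ)

@[simp] theorem ht_mul (x y : HNNExtension V A B φ) : ht σ (x * y) = ht σ x + ht σ y := by
  simp [ht]

@[simp] theorem ht_one : ht σ (1 : HNNExtension V A B φ) = 0 := by simp [ht]

@[simp] theorem ht_inv (x : HNNExtension V A B φ) : ht σ x⁻¹ = - ht σ x := by simp [ht]

@[simp] theorem ht_of (a : V) : ht σ (of a : HNNExtension V A B φ) = 0 := by simp [ht]

@[simp] theorem ht_t_zpow (k : ℤ) : ht σ (t ^ k : HNNExtension V A B φ) = k * σ := by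
  simp [ht]

@[simp] theorem ht_t : ht σ (t : HNNExtension V A B φ) = σ := by
  simpa using ht_t_zpow (φ := φ) σ 1

theorem abs_units (k : ℤ) : |k * (σ : ℤ)| = |k| := by
  rcases Int.units_eq_one_or σ with rfl | rfl <;> simp

theorem abs_ht_lprod_le (L : List (ℤˣ × V)) :
    |ht σ (lprod L : HNNExtension V A B φ)| ≤ L.length := by
  induction L with
  | nil => simp
  | cons x L ih =>
    rw [lprod_cons, ht_mul, ht_mul, ht_of, ht_t_zpow, List.length_cons]
    have : |((x.1 : ℤ) * (σ : ℤ))| = 1 := by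
      rw [abs_units]
      rcases Int.units_eq_one_or x.1 with h | h <;> simp [h]
    have h2 := abs_add_le ((x.1 : ℤ) * (σ : ℤ) + 0) (ht σ (lprod L : HNNExtension V A B φ))
    rw [add_zero, this] at h2
    rw [add_zero]
    push_cast
    linarith

theorem ht_lprod_ls (d : TransversalPair V A B) (z : HNNExtension V A B φ) :
    ht σ (lprod (ls d z) : HNNExtension V A B φ) = ht σ z := by
  conv_rhs => rw [← hd_mul_lprod d z]
  simp

theorem zpow_mul_of_injective :
    Function.Injective fun ia : ℤ × V => (t ^ ia.1 * of ia.2 : HNNExtension V A B φ) := by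
  rintro ⟨i, a⟩ ⟨j, b⟩ h
  have h1 : i = j := by simpa using congrArg (ht 1) h
  subst h1
  simpa [(of_injective φ).eq_iff] using h

variable {C : Type*} {m c : ℕ} (ρ : Rule V C m c) (d : TransversalPair V A B)

theorem abs_kappa_le (s : Fin m) : |ρ.κ s| ≤ c := by
  have := Finset.mem_Icc.1 (ρ.hκ s)
  exact abs_le.2 this

theorem abs_ht_step_le (s : Fin m) : |ht σ (ρ.step φ s)| ≤ c := by
  rw [Rule.step, ht_mul, ht_of, add_zero, ht_t_zpow, abs_units]
  exact abs_kappa_le ρ s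

/-- The next cell. -/
def nxt (χ : HNNExtension V A B φ → Option (C × Fin m)) (x : HNNExtension V A B φ) :
    HNNExtension V A B φ :=
  match χ x with
  | none => x
  | some (cl, _) => ρ.step φ (ρ.dir cl) * x

variable {ρ} in
theorem nxt_none {χ : HNNExtension V A B φ → Option (C × Fin m)} {x : HNNExtension V A B φ}
    (h : χ x = none) : nxt ρ χ x = x := by
  unfold nxt
  rw [h]

variable {ρ} in
theorem nxt_some {χ : HNNExtension V A B φ → Option (C × Fin m)} {x : HNNExtension V A B φ}
    {cl : C} {a : Fin m} (h : χ x = some (cl, a)) : nxt ρ χ x = ρ.step φ (ρ.dir cl) * x := by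
  unfold nxt
  rw [h]

/-- The indicator of the subtree above a standard node of sign `u`. -/
noncomputable def rI (u : ℤˣ) (z : HNNExtension V A B φ) : ℤ :=
  ind d [(u, ((d.compl u).equiv 1).2)] (z * lprod [(u, (((d.compl u).equiv 1).2 : V))])

theorem rI_eq {u : ℤˣ} {g : V} {L : List (ℤˣ × V)}
    (h : Nrm (A := A) (B := B) d ((u, g) :: L)) (z : HNNExtension V A B φ) :
    ind d ((u, g) :: L) z = rI d u (z * (lprod ((u, g) :: L))⁻¹) := by
  have h0 : Nrm (A := A) (B := B) d [(u, (((d.compl u).equiv 1).2 : V))] := by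
    refine ⟨by simp, ?_⟩
    intro u' g' hm
    simp only [List.mem_singleton, Prod.mk.injEq] at hm
    rw [hm.1, hm.2]
    exact ((d.compl u).equiv 1).2.2
  have := ind_mul_lprod_eq d h h0 (z * (lprod ((u, g) :: L))⁻¹)
  rw [inv_mul_cancel_right] at this
  rw [this, rI]

variable (φ) in
/-- The flow through an edge of sign `u`, read off from the local view. -/
noncomputable def flowAt (p : Lab V C m c) (u : ℤˣ) : ℤ :=
  ∑ᶠ ia : Win c × V, (p ia).elim 0 fun x =>
    rI d u (ρ.step φ (ρ.dir x.1) * (t ^ (ia.1 : ℤ) * of ia.2)) -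
      rI (φ := φ) d u (t ^ (ia.1 : ℤ) * of ia.2)

theorem sum_ind_eq_flowAt (α' : Fin m → V) (hα' : ∀ s, ρ.step φ s = of (α' s) * t ^ ρ.κ s)
    {u : ℤˣ} {g : V} {L : List (ℤˣ × V)} (h : Nrm (A := A) (B := B) d ((u, g) :: L))
    (χ : HNNExtension V A B φ → Option (C × Fin m)) (F : Finset (HNNExtension V A B φ))
    (hF : ∀ x, χ x ≠ none → x ∈ F) :
    ∑ x ∈ F, (ind d ((u, g) :: L) (nxt ρ χ x) - ind d ((u, g) :: L) x) =
      flowAt φ ρ d (view c χ (lprod ((u, g) :: L))) u := by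
  set v : HNNExtension V A B φ := lprod ((u, g) :: L) with hv
  let f : HNNExtension V A B φ → ℤ := fun x =>
    ind d ((u, g) :: L) (nxt ρ χ x) - ind d ((u, g) :: L) x
  have hf0 : ∀ x, χ x = none → f x = 0 := fun x hx => by
    simp only [f, nxt_none hx, sub_self]
  have hsupp : Function.support f ⊆ F := fun x hx => hF x fun hn => hx (hf0 x hn)
  rw [← finsum_eq_sum_of_support_subset f hsupp]
  let ι : Win c × V → HNNExtension V A B φ := fun ia => t ^ (ia.1 : ℤ) * of ia.2 * v
  have hι : Function.Injective ι := by
    rintro ⟨i, a⟩ ⟨j, b⟩ hij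
    have := zpow_mul_of_injective (φ := φ) (a₁ := ((i : ℤ), a)) (a₂ := ((j : ℤ), b))
      (mul_right_cancel hij)
    rw [Prod.mk.injEq] at this
    exact Prod.ext (Subtype.ext this.1) this.2
  have hr : Function.support f ⊆ Set.range ι := by
    intro x hx
    obtain ⟨⟨cl, a0⟩, hcl⟩ : ∃ y, χ x = some y := Option.ne_none_iff_exists'.1 fun hn => hx (hf0 x hn)
    have hx' : ind d ((u, g) :: L) (t ^ ρ.κ (ρ.dir cl) * (x * v⁻¹) * lprod ((u, g) :: L)) ≠
        ind d ((u, g) :: L) (x * v⁻¹ * lprod ((u, g) :: L)) := by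
      intro he
      apply hx
      rw [← hv, inv_mul_cancel_right, mul_assoc, inv_mul_cancel_right] at he
      simp only [f, nxt_some hcl, hα', mul_assoc, ind_of_mul, he, sub_self]
    obtain ⟨i, a, hi, hz⟩ := exists_of_ind_zpow_ne d h _ _ hx'
    have hi' := abs_le.1 (hi.trans (abs_kappa_le ρ _))
    refine ⟨(⟨i, Finset.mem_Icc.2 hi'⟩, a), ?_⟩
    simp only [ι]
    rw [← hz, inv_mul_cancel_right]
  have hsum : ∑ᶠ x, f x = ∑ᶠ ia, f (ι ia) := by
    rw [← finsum_mem_range hι, ← finsum_mem_univ]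
    exact finsum_mem_inter_support_eq' f _ _ fun x hx => by simpa using hr hx
  refine hsum.trans ?_
  unfold flowAt
  refine finsum_congr fun ia => ?_
  simp only [view]
  rcases hx : χ (t ^ (ia.1 : ℤ) * of ia.2 * v) with _ | ⟨cl, a0⟩
  · exact hf0 _ hx
  · simp only [f, ι, nxt_some hx, Option.elim, rI_eq d h, ← hv]
    congr 2 <;> group

end Flow

end HNNExtension

/-! ### The axis of a tall walk -/

namespace HNNExtension

open NormalWord

section Axis

variable {V : Type*} [Group V] {A B : Subgroup V} {φ : A ≃* B}
variable {C : Type*} {m c : ℕ} {ρ : Rule V C m c} (d : TransversalPair V A B)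

variable (φ ρ) in
/-- A step along the axis. -/
def AxisStep (K : ℕ) (p : Lab V C m c) (u : ℤˣ) (p' : Lab V C m c) (u' : ℤˣ) (g : V) : Prop :=
  Valid ρ p ∧ flowAt φ ρ d p u = 1 ∧ Red A B d u u' g ∧ Ed φ u' (act g p) p' ∧
    ∀ u'' g'', Red A B d u u'' g'' → ¬ (u'' = u' ∧ g'' = g) →
      ∃ q, Ed φ u'' (act g'' p) q ∧ (q, u'') ∈ fill φ ρ d K

variable (φ ρ) in
/-- A walk in the group following the directions of its colours and satisfying the strong
adjacency rule. -/
structure IsWalk (w : ℕ → C) (N : ℕ) (y : ℕ → HNNExtension V A B φ) : Prop where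
  zero : y 0 = 1
  succ : ∀ i, y (i + 1) = ρ.step φ (ρ.dir (w i)) * y i
  inj : ∀ i ≤ N, ∀ j ≤ N, y i = y j → i = j
  rule : ∀ i ≤ N, ∀ j ≤ N, ∀ s, y j = ρ.step φ s * y i → ρ.Dm (w i) s (w j)

variable {w : ℕ → C} {N : ℕ} {y : ℕ → HNNExtension V A B φ}

/-- `χ` is the configuration of the walk. -/
structure IsConf (ρ : Rule V C m c) (w : ℕ → C) (N : ℕ) (y : ℕ → HNNExtension V A B φ)
    (χ : HNNExtension V A B φ → Option (C × Fin m)) : Prop where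
  app : ∀ i ≤ N, χ (y i) = some (w i, ρ.dir (w (i - 1)))
  supp : ∀ x, χ x ≠ none → ∃ i ≤ N, y i = x

theorem IsWalk.exists_isConf (h : IsWalk φ ρ w N y) : ∃ χ, IsConf ρ w N y χ := by
  classical
  refine ⟨fun x => if h : ∃ i ≤ N, y i = x then
    some (w h.choose, ρ.dir (w (h.choose - 1))) else none, ?_, ?_⟩
  · intro i hi
    have hex : ∃ j ≤ N, y j = y i := ⟨i, hi, rfl⟩
    have := h.inj _ hex.choose_spec.1 _ hi hex.choose_spec.2
    simp only [dif_pos hex, this]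
  · intro x hx
    by_contra hcon
    exact hx (dif_neg hcon)

variable {χ : HNNExtension V A B φ → Option (C × Fin m)}

theorem IsConf.rr (hχ : IsConf ρ w N y χ) (h : IsWalk φ ρ w N y) (x : HNNExtension V A B φ)
    (s : Fin m) (h1 : x ≠ y N) (h2 : ρ.step φ s * x ≠ 1) : RR ρ s (χ x) (χ (ρ.step φ s * x)) := by
  refine ⟨?_, ?_, ?_⟩
  · intro p q hp hq
    obtain ⟨i, hi, rfl⟩ := hχ.supp x (by simp [hp])
    obtain ⟨j, hj, hj'⟩ := hχ.supp _ (show χ (ρ.step φ s * y i) ≠ none by simp [hq])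
    rw [← hj', hχ.app j hj] at hq
    rw [hχ.app i hi] at hp
    cases hp
    cases hq
    exact h.rule i hi j hj s hj'
  · intro p hp hs
    obtain ⟨i, hi, rfl⟩ := hχ.supp x (by simp [hp])
    rw [hχ.app i hi] at hp
    cases hp
    have hiN : i < N := lt_of_le_of_ne hi fun e => h1 (by rw [e])
    rw [← hs, ← h.succ, hχ.app _ hiN]
    exact ⟨_, rfl⟩
  · intro a ha
    obtain ⟨j, hj, hj'⟩ := hχ.supp _ (show χ (ρ.step φ s * x) ≠ none by simp [ha])
    rw [← hj', hχ.app j hj] at ha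
    obtain ⟨j, rfl⟩ : ∃ k, j = k + 1 := by
      refine Nat.exists_eq_succ_of_ne_zero fun e => h2 ?_
      rw [← hj', e, h.zero]
    have hs : ρ.dir (w j) = s := by
      rw [Option.some_inj, Prod.mk.injEq] at ha
      simpa using ha.2
    rw [h.succ, hs] at hj'
    have hx := mul_left_cancel hj'
    refine ⟨(w j, ρ.dir (w (j - 1))), ?_, ?_⟩
    · rw [← hx, hχ.app j (by lia)]
    · exact hs

theorem IsConf.valid (hχ : IsConf ρ w N y χ) (h : IsWalk φ ρ w N y) (x : HNNExtension V A B φ)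
    (h1 : ls d x ≠ ls d (y N)) (h2 : c < (ls d x).length) : Valid ρ (view c χ x) := by
  rw [valid_view]
  intro a s
  refine hχ.rr h _ s ?_ ?_
  · intro e
    rw [← e, ls_of_mul] at h1
    exact h1 rfl
  · intro e
    have h3 : t ^ (-ρ.κ s) * (ρ.step φ s * (of a * x)) = of (ρ.α s * a) * x := by
      simp [Rule.step, mul_assoc]
    have h4 := length_ls_zpow d (-ρ.κ s) (ρ.step φ s * (of a * x))
    rw [h3, ls_of_mul, e, ls_one, Int.natAbs_neg] at h4
    have h5 := abs_kappa_le ρ s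
    rw [List.length_nil] at h4
    rw [Int.abs_eq_natAbs] at h5
    lia

theorem IsConf.mem_fill (hχ : IsConf ρ w N y χ) (h : IsWalk φ ρ w N y) {D : ℕ}
    (hD : ∀ i ≤ N, (ls d (y i)).length ≤ D) (n : ℕ) (u : ℤˣ) (g : V) (L : List (ℤˣ × V))
    (hL : Nrm (A := A) (B := B) d ((u, g) :: L)) (hlen : c ≤ L.length)
    (hn : D + c ≤ n + L.length) (hs : ¬ ((u, g) :: L) <:+ ls d (y N)) :
    (view c χ (lprod ((u, g) :: L)), u) ∈ fill φ ρ d n := by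
  induction n generalizing u g L with
  | zero =>
    funext ⟨i, a⟩
    by_contra hne
    obtain ⟨k, hk, hk'⟩ := hχ.supp _ hne
    have h4 := length_ls_zpow d (-(i : ℤ)) (y k)
    have h5 : t ^ (-(i : ℤ)) * y k = of a * lprod ((u, g) :: L) := by
      rw [hk']
      simp only [← mul_assoc]
      rw [zpow_neg, inv_mul_cancel, one_mul]
    rw [h5, ls_of_mul, hL.ls_lprod, List.length_cons] at h4
    have := hD k hk
    have := Finset.mem_Icc.1 i.2
    lia
  | succ n ih =>
    refine ⟨hχ.valid d h _ ?_ ?_, ?_⟩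
    · rw [hL.ls_lprod]
      exact fun e => hs (by rw [e])
    · rw [hL.ls_lprod, List.length_cons]
      lia
    · intro u' g' hr
      refine ⟨_, ed_view χ u' g' _, ?_⟩
      have := ih u' g' ((u, g) :: L) (nrm_cons_cons.2 ⟨hr, hL⟩) (by simp; lia) (by simp; lia)
        fun e => hs ((List.suffix_cons _ _).trans e)
      rwa [lprod_cons] at this

theorem IsConf.flow_eq_one (hχ : IsConf ρ w N y χ) (h : IsWalk φ ρ w N y) (α' : Fin m → V)
    (hα' : ∀ s, ρ.step φ s = of (α' s) * t ^ ρ.κ s) (u : ℤˣ) (g : V) (L : List (ℤˣ × V))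
    (hs : ((u, g) :: L) <:+ ls d (y N)) (hlen : L.length + 1 + c < (ls d (y N)).length) :
    flowAt φ ρ d (view c χ (lprod ((u, g) :: L))) u = 1 := by
  classical
  have hL := (nrm_ls d (y N)).suffix hs
  rw [← sum_ind_eq_flowAt ρ d α' hα' hL χ ((Finset.range (N + 1)).image y) ?_]
  · rw [Finset.sum_image]
    · have e : ∀ i ∈ Finset.range (N + 1), ind d ((u, g) :: L) (nxt ρ χ (y i)) -
          ind d ((u, g) :: L) (y i) = ind d ((u, g) :: L) (y (i + 1)) -
          ind d ((u, g) :: L) (y i) := by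
        intro i hi
        rw [nxt_some (hχ.app i (by simpa [Nat.lt_succ_iff] using hi)), h.succ]
      rw [Finset.sum_congr rfl e, Finset.sum_range_sub (fun i => ind d ((u, g) :: L) (y i)), h.zero]
      have e0 : ind d ((u, g) :: L) (1 : HNNExtension V A B φ) = 0 := by simp [ind]
      have e1 : ind d ((u, g) :: L) (y N) = 1 := by simp [ind, hs]
      rw [e0, h.succ, sub_zero, ← e1]
      by_contra hne
      have hne' : ind d ((u, g) :: L) (t ^ ρ.κ (ρ.dir (w N)) * (y N * (lprod ((u, g) :: L))⁻¹) *
          lprod ((u, g) :: L)) ≠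
          ind d ((u, g) :: L) (y N * (lprod ((u, g) :: L))⁻¹ * lprod ((u, g) :: L)) := by
        intro he
        apply hne
        rw [inv_mul_cancel_right, mul_assoc, inv_mul_cancel_right] at he
        rw [hα', mul_assoc, ind_of_mul, he]
      obtain ⟨i, a, hi, hz⟩ := exists_of_ind_zpow_ne d hL _ _ hne'
      have hz' : y N = t ^ i * (of a * lprod ((u, g) :: L)) := by
        rw [← mul_assoc, ← hz, inv_mul_cancel_right]
      have h4 := length_ls_zpow (φ := φ) d i (of a * lprod ((u, g) :: L))
      rw [← hz', ls_of_mul, hL.ls_lprod, List.length_cons] at h4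
      have h5 := hi.trans (abs_kappa_le ρ _)
      rw [Int.abs_eq_natAbs] at h5
      lia
    · intro i hi j hj
      simp only [Finset.coe_range, Set.mem_Iio, Nat.lt_succ_iff] at hi hj
      exact h.inj i hi j hj
  · intro x hx
    obtain ⟨i, hi, rfl⟩ := hχ.supp x hx
    exact Finset.mem_image_of_mem _ (Finset.mem_range.2 (by lia))

open Finset in
theorem IsWalk.exists_axis [Finite V] [Finite C] (h : IsWalk φ ρ w N y) (α' : Fin m → V)
    (hα' : ∀ s, ρ.step φ s = of (α' s) * t ^ ρ.κ s) {K : ℕ}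
    (hK : Nat.card (Lab V C m c × ℤˣ) ≤ K) (σ : ℤˣ) (hbig : K + 2 * c + 2 < ht σ (y N)) :
    ∃ (p : ℕ → Lab V C m c) (u : ℕ → ℤˣ) (g : ℕ → V),
      (∀ n, AxisStep φ ρ d K (p n) (u n) (p (n + 1)) (u (n + 1)) (g (n + 1))) ∧
      ∀ i j : ℕ, i ≤ j → (j : ℤ) - i ≤ K * (∑ n ∈ range j, ((u (n + 1) : ℤ) * σ) -
        ∑ n ∈ range i, ((u (n + 1) : ℤ) * σ) + K) := by
  classical
  have := Fintype.ofFinite (Lab V C m c × ℤˣ)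
  obtain ⟨χ, hχ⟩ := h.exists_isConf
  obtain ⟨D, hD⟩ : ∃ D, ∀ i ≤ N, (ls d (y i)).length ≤ D :=
    ⟨∑ i ∈ range (N + 1), (ls d (y i)).length, fun i hi =>
      single_le_sum (f := fun i => (ls d (y i)).length) (fun _ _ => Nat.zero_le _)
        (mem_range.2 (by lia))⟩
  set M := ls d (y N) with hM
  have hMn : Nrm (A := A) (B := B) d M := nrm_ls d _
  set r := M.length with hr
  have hhtM : ht σ (lprod M : HNNExtension V A B φ) = ht σ (y N) := ht_lprod_ls σ d _
  have hrbig : K + 2 * c + 2 < r := by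
    have := abs_ht_lprod_le (φ := φ) σ M
    rw [hhtM] at this
    have := (le_abs_self _).trans this
    lia
  -- the syllable of index `j` counted from the end
  let e : ℕ → ℤˣ × V := fun j => M.getD (r - j) (1, 1)
  have hdrop : ∀ j, 1 ≤ j → j ≤ r → M.drop (r - j) = e j :: M.drop (r - (j - 1)) := by
    intro j h1 h2
    have hlt : r - j < M.length := by lia
    rw [List.drop_eq_getElem_cons hlt, show r - j + 1 = r - (j - 1) by lia]
    simp only [e]
    rw [List.getD_eq_getElem _ _ hlt]
  let St : Lab V C m c × ℤˣ → Lab V C m c × ℤˣ → Prop := fun s s' =>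
    ∃ g, AxisStep φ ρ d K s.1 s.2 s'.1 s'.2 g
  let s : ℕ → Lab V C m c × ℤˣ := fun i =>
    (view c χ (lprod (M.drop (r - (c + 1 + i)))), (e (c + 1 + i)).1)
  have hs : ∀ i < r - 2 * c - 2, St (s i) (s (i + 1)) := by
    intro i hi
    set j := c + 1 + i with hj
    have hd1 := hdrop j (by lia) (by lia)
    have hd2 := hdrop (j + 1) (by lia) (by lia)
    rw [Nat.add_sub_cancel] at hd2
    have hn1 : Nrm (A := A) (B := B) d (M.drop (r - j)) := hMn.suffix (List.drop_suffix _ _)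
    have hn2 : Nrm (A := A) (B := B) d (M.drop (r - (j + 1))) := hMn.suffix (List.drop_suffix _ _)
    have hsj : M.drop (r - j) <:+ M := List.drop_suffix _ _
    have hlenj : (M.drop (r - j)).length = j := by simp; lia
    have hlenj1 : (M.drop (r - (j - 1))).length = j - 1 := by simp; lia
    refine ⟨(e (j + 1)).2, ?_⟩
    simp only [s, ← hj, show c + 1 + (i + 1) = j + 1 by lia]
    refine ⟨?_, ?_, ?_, ?_, ?_⟩
    · apply hχ.valid d h
      · rw [hn1.ls_lprod, ← hM]
        intro he
        have := congrArg List.length he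
        rw [hlenj] at this
        lia
      · rw [hn1.ls_lprod, hlenj]
        lia
    · rw [hd1] at hsj ⊢
      exact hχ.flow_eq_one d h α' hα' _ _ _ hsj (by rw [← hM, hlenj1]; lia)
    · rw [hd2, hd1] at hn2
      exact (nrm_cons_cons.1 hn2).1
    · rw [hd2, lprod_cons]
      exact ed_view χ _ _ _
    · intro u'' g'' hred hne
      refine ⟨_, ed_view χ u'' g'' _, ?_⟩
      refine fill_subset φ ρ d hK (D + c) ?_
      have hn3 : Nrm (A := A) (B := B) d ((u'', g'') :: M.drop (r - j)) := by
        rw [hd1] at hn1 ⊢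
        exact nrm_cons_cons.2 ⟨hred, hn1⟩
      have := hχ.mem_fill d h hD (D + c) u'' g'' _ hn3 (by lia) (by lia) ?_
      · rwa [lprod_cons] at this
      · intro hsuf
        have h6 : M.drop (r - (j + 1)) <:+ M := List.drop_suffix _ _
        have h7 := List.suffix_of_suffix_length_le hsuf h6 (by simp; lia)
        have h8 := h7.eq_of_length (by simp; lia)
        rw [hd2, List.cons.injEq] at h8
        exact hne (by rw [← h8.1]; exact ⟨rfl, rfl⟩)
  have hht : ∀ i, c + 1 + i ≤ r →
      ht σ (lprod (M.drop (r - (c + 1 + i))) : HNNExtension V A B φ) =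
      ht σ (lprod (M.drop (r - (c + 1))) : HNNExtension V A B φ) +
        ∑ i ∈ range i, (((s (i + 1)).2 : ℤ) * σ) := by
    intro i
    induction i with
    | zero => simp
    | succ i ih =>
      intro hi
      rw [hdrop _ (by lia) hi, lprod_cons, ht_mul, ht_mul, ht_of, ht_t_zpow,
        show c + 1 + (i + 1) - 1 = c + 1 + i by lia, ih (by lia), sum_range_succ]
      ring
  have hgain : (K : ℤ) < ∑ i ∈ range (r - 2 * c - 2), (((s (i + 1)).2 : ℤ) * σ) := by
    have h1 := hht (r - 2 * c - 2) (by lia)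
    have h2 : ht σ (lprod M : HNNExtension V A B φ) =
        ht σ (lprod (M.take (r - (c + 1 + (r - 2 * c - 2)))) : HNNExtension V A B φ) +
        ht σ (lprod (M.drop (r - (c + 1 + (r - 2 * c - 2)))) : HNNExtension V A B φ) := by
      rw [← ht_mul, ← lprod_append, List.take_append_drop]
    have h3 := abs_le.1 (abs_ht_lprod_le (φ := φ) σ (M.take (r - (c + 1 + (r - 2 * c - 2)))))
    have h4 := abs_le.1 (abs_ht_lprod_le (φ := φ) σ (M.drop (r - (c + 1))))
    have h5 : (M.take (r - (c + 1 + (r - 2 * c - 2)))).length = c + 1 := by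
      simp; lia
    have h6 : (M.drop (r - (c + 1))).length = c + 1 := by simp; lia
    rw [h5] at h3
    rw [h6] at h4
    rw [hhtM] at h2
    push_cast at h3 h4
    linarith
  obtain ⟨s', hs', hprog⟩ := exists_infinite_walk (St := St)
    (w := fun x => ((x.2 : ℤ) * σ)) (by rwa [← Nat.card_eq_fintype_card])
    (fun x => by
      rw [abs_units]
      rcases Int.units_eq_one_or x.2 with h | h <;> simp [h]) _ s hs hgain
  choose g hg using hs'
  exact ⟨fun n => (s' n).1, fun n => (s' n).2, fun n => g (n - 1), fun n => hg n, hprog⟩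

end Axis

end HNNExtension

/-! ### A configuration along an infinite axis -/

namespace HNNExtension

open NormalWord

section NewConf

variable {V : Type*} [Group V] {A B : Subgroup V} (φ : A ≃* B)
variable {C : Type*} {m c : ℕ} (ρ : Rule V C m c) (d : TransversalPair V A B)

open Classical in
/-- A filling of the child of a node, of minimal depth. -/
noncomputable def child (u : ℤˣ) (g : V) (p : Lab V C m c) : Lab V C m c :=
  if h : ∃ n, ∃ q, Ed φ u (act g p) q ∧ (q, u) ∈ fill φ ρ d n then (Nat.find_spec h).choose
  else blank

variable {φ ρ d} in
theorem child_spec {u : ℤˣ} {g : V} {p : Lab V C m c} {n : ℕ}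
    (h : ∃ q, Ed φ u (act g p) q ∧ (q, u) ∈ fill φ ρ d n) :
    Ed φ u (act g p) (child φ ρ d u g p) ∧ (child φ ρ d u g p, u) ∈ fill φ ρ d n := by
  classical
  have h' : ∃ n, ∃ q, Ed φ u (act g p) q ∧ (q, u) ∈ fill φ ρ d n := ⟨n, h⟩
  have := (Nat.find_spec h').choose_spec
  rw [child, dif_pos h']
  exact ⟨this.1, fill_mono φ ρ d (Nat.find_min' h' h) this.2⟩

theorem child_mem [Finite V] [Finite C] {K : ℕ} (hK : Nat.card (Lab V C m c × ℤˣ) ≤ K)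
    (u : ℤˣ) (g : V) (p : Lab V C m c) : (child φ ρ d u g p, u) ∈ fill φ ρ d K := by
  by_cases h : ∃ n, ∃ q, Ed φ u (act g p) q ∧ (q, u) ∈ fill φ ρ d n
  · obtain ⟨n, hn⟩ := h
    exact fill_subset φ ρ d hK n (child_spec hn).2
  · rw [child, dif_neg h]
    exact fill_mono φ ρ d (Nat.zero_le K) rfl

/-- The nodes of the axis. -/
def axis (u : ℕ → ℤˣ) (g : ℕ → V) : ℕ → List (ℤˣ × V)
  | 0 => []
  | n + 1 => (u (n + 1), g (n + 1)) :: axis u g n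

variable (p : ℕ → Lab V C m c) (u : ℕ → ℤˣ) (g : ℕ → V)

@[simp] theorem length_axis (n : ℕ) : (axis u g n).length = n := by
  induction n with
  | zero => rfl
  | succ n ih => simp [axis, ih]

theorem axis_suffix {i j : ℕ} (h : i ≤ j) : axis u g i <:+ axis u g j := by
  induction j, h using Nat.le_induction with
  | base => exact List.suffix_rfl
  | succ j _ ih => exact ih.trans (List.suffix_cons _ _)

theorem ht_axis (σ : ℤˣ) (n : ℕ) : ht σ (lprod (axis u g n) : HNNExtension V A B φ) =
    ∑ i ∈ Finset.range n, ((u (i + 1) : ℤ) * σ) := by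
  induction n with
  | zero => simp [axis]
  | succ n ih =>
    rw [axis, lprod_cons, ht_mul, ht_mul, ht_of, ht_t_zpow, ih, Finset.sum_range_succ]
    ring

open Classical in
/-- The labels of the new configuration. -/
noncomputable def lab (r : ℕ) : List (ℤˣ × V) → Lab V C m c
  | [] => p 0
  | x :: L => if x :: L = axis u g (L.length + 1) ∧ L.length + 1 ≤ r then p (L.length + 1)
      else child φ ρ d x.1 x.2 (lab r L)

variable {K r : ℕ}

theorem lab_axis {j : ℕ} (hj : j ≤ r) : lab φ ρ d p u g r (axis u g j) = p j := by
  cases j with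
  | zero => rfl
  | succ j =>
    rw [axis, lab, length_axis, if_pos ⟨rfl, hj⟩]

theorem lab_cons {x : ℤˣ × V} {L : List (ℤˣ × V)}
    (h : ¬ (x :: L = axis u g (L.length + 1) ∧ L.length + 1 ≤ r)) :
    lab φ ρ d p u g r (x :: L) = child φ ρ d x.1 x.2 (lab φ ρ d p u g r L) := by
  rw [lab, if_neg h]

theorem eq_axis_or (L : List (ℤˣ × V)) : (∃ j ≤ r, L = axis u g j) ∨
    ∃ x L', L = x :: L' ∧ ¬ (x :: L' = axis u g (L'.length + 1) ∧ L'.length + 1 ≤ r) := by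
  cases L with
  | nil => exact Or.inl ⟨0, Nat.zero_le _, rfl⟩
  | cons x L' =>
    by_cases h : x :: L' = axis u g (L'.length + 1) ∧ L'.length + 1 ≤ r
    · exact Or.inl ⟨_, h.2, h.1⟩
    · exact Or.inr ⟨x, L', rfl, h⟩

variable {φ ρ d p u g}

theorem nrm_axis
    (hst : ∀ n, AxisStep φ ρ d K (p n) (u n) (p (n + 1)) (u (n + 1)) (g (n + 1))) (n : ℕ) : Nrm (A := A) (B := B) d (axis u g n) := by
  induction n with
  | zero => exact ⟨by simp [axis], by simp [axis]⟩
  | succ n ih =>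
    have h := (hst n).2.2.1
    cases n with
    | zero =>
      refine ⟨by simp [axis], ?_⟩
      intro u' g' hm
      simp only [axis, List.mem_singleton, Prod.mk.injEq] at hm
      rw [hm.1, hm.2]
      exact h.1
    | succ n => exact nrm_cons_cons.2 ⟨h, ih⟩

theorem lab_off [Finite V] [Finite C] (hK : Nat.card (Lab V C m c × ℤˣ) ≤ K) {x : ℤˣ × V}
    {L : List (ℤˣ × V)} (hL : Nrm (A := A) (B := B) d (x :: L))
    (hx : ¬ (x :: L = axis u g (L.length + 1) ∧ L.length + 1 ≤ r)) :
    ∃ j ≤ r, ∃ L', x :: L = L' ++ axis u g j ∧ L' ≠ [] ∧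
      (lab φ ρ d p u g r (x :: L), x.1) ∈ fill φ ρ d (K + 1 - L'.length) := by
  induction L generalizing x with
  | nil =>
    refine ⟨0, Nat.zero_le _, [x], rfl, by simp, ?_⟩
    rw [lab, if_neg hx]
    exact child_mem φ ρ d hK _ _ _
  | cons x' L ih =>
    rcases eq_axis_or (r := r) u g (x' :: L) with ⟨j, hj, hjL⟩ | ⟨x₁, L₁, he, hn⟩
    · refine ⟨j, hj, [x], by simp [hjL], by simp, ?_⟩
      rw [lab, if_neg hx]
      exact child_mem φ ρ d hK _ _ _
    · cases he
      obtain ⟨j, hj, L', hL', -, hf⟩ := ih hL.tail hn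
      refine ⟨j, hj, x :: L', by simp [hL'], by simp, ?_⟩
      rw [lab, if_neg hx, List.length_cons]
      refine (child_spec ?_).2
      rcases Nat.eq_zero_or_pos (K + 1 - L'.length) with h0 | h0
      · rw [h0] at hf
        have hb : lab φ ρ d p u g r (x' :: L) = blank := hf
        rw [hb]
        exact ⟨blank, ed_blank _, fill_mono φ ρ d (Nat.zero_le _) rfl⟩
      · obtain ⟨n, hn⟩ := Nat.exists_eq_succ_of_ne_zero h0.ne'
        rw [hn] at hf
        rw [show K + 1 - (L'.length + 1) = n by lia]
        exact hf.2 _ _ (nrm_cons_cons.1 hL).1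

theorem lab_ed [Finite V] [Finite C]
    (hst : ∀ n, AxisStep φ ρ d K (p n) (u n) (p (n + 1)) (u (n + 1)) (g (n + 1)))
    (hK : Nat.card (Lab V C m c × ℤˣ) ≤ K) {x : ℤˣ × V}
    {L : List (ℤˣ × V)} (hL : Nrm (A := A) (B := B) d (x :: L)) (h0 : L ≠ [])
    (hr : L ≠ axis u g r) :
    Ed φ x.1 (act x.2 (lab φ ρ d p u g r L)) (lab φ ρ d p u g r (x :: L)) := by
  rcases eq_axis_or (r := r) u g L with ⟨j, hj, rfl⟩ | ⟨x', L', rfl, hn⟩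
  · have hjr : j < r := lt_of_le_of_ne hj fun e => hr (by rw [e])
    obtain ⟨i, rfl⟩ : ∃ i, j = i + 1 := by
      refine Nat.exists_eq_succ_of_ne_zero fun e => h0 ?_
      rw [e, axis]
    rw [lab_axis φ ρ d p u g hj]
    by_cases hx : x = (u (i + 2), g (i + 2))
    · have : x :: axis u g (i + 1) = axis u g (i + 2) := by rw [hx, axis.eq_def _ _ (i + 2)]
      rw [this, lab_axis φ ρ d p u g hjr, hx]
      exact (hst (i + 1)).2.2.2.1
    · have h1 : ¬ (x :: axis u g (i + 1) = axis u g ((axis u g (i + 1)).length + 1) ∧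
          (axis u g (i + 1)).length + 1 ≤ r) := by
        rintro ⟨h2, -⟩
        rw [length_axis, axis.eq_def _ _ (i + 1 + 1), List.cons.injEq] at h2
        exact hx h2.1
      rw [lab, if_neg h1, lab_axis φ ρ d p u g hj]
      refine (child_spec ((hst (i + 1)).2.2.2.2 _ _ (nrm_cons_cons.1 hL).1 ?_)).1
      rintro ⟨h2, h3⟩
      exact hx (Prod.ext h2 h3)
  · obtain ⟨j, hj, L₁, hL₁, -, hf⟩ := lab_off (φ := φ) (ρ := ρ) (p := p) hK hL.tail hn
    have h1 : ¬ (x :: x' :: L' = axis u g ((x' :: L').length + 1) ∧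
        (x' :: L').length + 1 ≤ r) := by
      rintro ⟨h2, h3⟩
      rw [List.length_cons, axis.eq_def _ _ (L'.length + 1 + 1), List.cons.injEq] at h2
      rw [List.length_cons] at h3
      exact hn ⟨h2.2, by lia⟩
    rw [lab_cons φ ρ d p u g h1]
    rcases Nat.eq_zero_or_pos (K + 1 - L₁.length) with h0 | h0
    · rw [h0] at hf
      have hb : lab φ ρ d p u g r (x' :: L') = blank := hf
      rw [hb]
      exact (child_spec (n := 0) ⟨blank, ed_blank _, rfl⟩).1
    · obtain ⟨n, hn⟩ := Nat.exists_eq_succ_of_ne_zero h0.ne'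
      rw [hn] at hf
      exact (child_spec (hf.2 _ _ (nrm_cons_cons.1 hL).1)).1

theorem valid_lab [Finite V] [Finite C]
    (hst : ∀ n, AxisStep φ ρ d K (p n) (u n) (p (n + 1)) (u (n + 1)) (g (n + 1)))
    (hK : Nat.card (Lab V C m c × ℤˣ) ≤ K)
    {L : List (ℤˣ × V)} (hL : Nrm (A := A) (B := B) d L) : Valid ρ (lab φ ρ d p u g r L) := by
  rcases eq_axis_or (r := r) u g L with ⟨j, hj, rfl⟩ | ⟨x', L', rfl, hn⟩
  · rw [lab_axis φ ρ d p u g hj]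
    exact (hst j).1
  · obtain ⟨j, hj, L₁, hL₁, -, hf⟩ := lab_off (φ := φ) (ρ := ρ) (p := p) hK hL hn
    exact (fill_succ φ ρ d _ hf).1

theorem lab_supp [Finite V] [Finite C] (hK : Nat.card (Lab V C m c × ℤˣ) ≤ K)
    {L : List (ℤˣ × V)} (hL : Nrm (A := A) (B := B) d L)
    (hb : lab φ ρ d p u g r L ≠ blank) : ∃ j ≤ r, ∃ L', L = L' ++ axis u g j ∧ L'.length ≤ K := by
  rcases eq_axis_or (r := r) u g L with ⟨j, hj, rfl⟩ | ⟨x', L', rfl, hn⟩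
  · exact ⟨j, hj, [], rfl, Nat.zero_le _⟩
  · obtain ⟨j, hj, L₁, hL₁, -, hf⟩ := lab_off (φ := φ) (ρ := ρ) (p := p) hK hL hn
    refine ⟨j, hj, L₁, hL₁, ?_⟩
    by_contra hlt
    rw [show K + 1 - L₁.length = 0 by lia] at hf
    exact hb hf

variable (φ ρ d p u g r) in
/-- The label of the new configuration at a group element. -/
noncomputable def labAt (z : HNNExtension V A B φ) : Lab V C m c :=
  act (hd d z) (lab φ ρ d p u g r (ls d z))

variable (φ ρ d p u g r) in
/-- The new configuration. -/
noncomputable def conf (z : HNNExtension V A B φ) : Option (C × Fin m) :=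
  labAt φ ρ d p u g r z (winZero c, 1)

theorem labAt_of_mul (a : V) (z : HNNExtension V A B φ) :
    labAt φ ρ d p u g r (of a * z) = act a (labAt φ ρ d p u g r z) := by
  simp [labAt, act_mul]

theorem ee_labAt [Finite V] [Finite C]
    (hst : ∀ n, AxisStep φ ρ d K (p n) (u n) (p (n + 1)) (u (n + 1)) (g (n + 1)))
    (hK : Nat.card (Lab V C m c × ℤˣ) ≤ K)
    (z : HNNExtension V A B φ) (h1 : ls d z ≠ [] ∧ ls d z ≠ axis u g r)
    (h2 : ls d (t * z) ≠ [] ∧ ls d (t * z) ≠ axis u g r) :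
    EE φ (labAt φ ρ d p u g r z) (labAt φ ρ d p u g r (t * z)) := by
  rcases t_step d z with ⟨b, g', e1, e2, e3⟩ | ⟨b, g', e1, e2, e3⟩
  · have hn := nrm_ls d (t * z)
    rw [e3] at hn
    have := lab_ed (r := r) hst hK hn h1.1 h1.2
    simp only [Ed, if_true] at this
    have := this.act b
    rw [← act_mul] at this
    rw [labAt, labAt, e1, e2, e3]
    exact this
  · have hn := nrm_ls d z
    rw [e2] at hn
    have := lab_ed (r := r) hst hK hn h2.1 h2.2
    have h3 : ((-1 : ℤˣ) = 1) = False := by decide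
    simp only [Ed, h3, if_false] at this
    have := this.act b
    rw [← act_mul] at this
    rw [labAt, labAt, e1, e2, e3]
    exact this

theorem propagate {ψ : HNNExtension V A B φ → Lab V C m c} (z : HNNExtension V A B φ)
    (h : ∀ j : ℤ, -c ≤ j → j < c → EE φ (ψ (t ^ j * z)) (ψ (t ^ (j + 1) * z)))
    (i : Win c) : ψ (t ^ (i : ℤ) * z) (winZero c, 1) = ψ z (i, 1) := by
  have h' : ∀ j : ℤ, -c ≤ j → j < c → ∀ i i' : Win c, (i' : ℤ) = i + 1 →
      ψ (t ^ (j + 1) * z) (i, 1) = ψ (t ^ j * z) (i', 1) := by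
    intro j h1 h2 i i' hi
    simpa using h j h1 h2 i i' hi 1
  have up : ∀ n : ℕ, ∀ i i' : Win c, (i' : ℤ) = i + n → n ≤ c →
      ψ (t ^ (n : ℤ) * z) (i, 1) = ψ z (i', 1) := by
    intro n
    induction n with
    | zero =>
      intro i i' hi _
      have : i = i' := Subtype.ext (by simpa using hi.symm)
      simp [this]
    | succ n ih =>
      intro i i' hi hn
      have h1 := Finset.mem_Icc.1 i.2
      have h2 := Finset.mem_Icc.1 i'.2
      push_cast at hi
      rw [Nat.cast_succ, h' n (by lia) (by lia) i ⟨i + 1, Finset.mem_Icc.2 (by lia)⟩ rfl]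
      exact ih _ _ (by simp only; lia) (by lia)
  have down : ∀ n : ℕ, ∀ i i' : Win c, (i' : ℤ) = i - n → n ≤ c →
      ψ (t ^ (-(n : ℤ)) * z) (i, 1) = ψ z (i', 1) := by
    intro n
    induction n with
    | zero =>
      intro i i' hi _
      have : i = i' := Subtype.ext (by simpa using hi.symm)
      simp [this]
    | succ n ih =>
      intro i i' hi hn
      have h1 := Finset.mem_Icc.1 i.2
      have h2 := Finset.mem_Icc.1 i'.2
      push_cast at hi
      have := h' (-((n + 1 : ℕ) : ℤ)) (by lia) (by lia) ⟨i - 1, Finset.mem_Icc.2 (by lia)⟩ i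
        (by simp)
      rw [← this]
      rw [show -((n + 1 : ℕ) : ℤ) + 1 = -(n : ℤ) by push_cast; ring]
      exact ih _ _ (by simp only; lia) (by lia)
  have hi := Finset.mem_Icc.1 i.2
  obtain ⟨n, hn | hn⟩ := (i : ℤ).eq_nat_or_neg
  · rw [hn]
    exact up n _ _ (by simp [winZero, hn]) (by lia)
  · rw [hn]
    exact down n _ _ (by simp [winZero, hn]) (by lia)

theorem view_conf [Finite V] [Finite C]
    (hst : ∀ n, AxisStep φ ρ d K (p n) (u n) (p (n + 1)) (u (n + 1)) (g (n + 1)))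
    (hK : Nat.card (Lab V C m c × ℤˣ) ≤ K) (σ : ℤˣ)
    (x : HNNExtension V A B φ) (h1 : c < ht σ x)
    (h2 : ht σ x + c < ht σ (lprod (axis u g r) : HNNExtension V A B φ)) :
    view c (conf φ ρ d p u g r) x = labAt φ ρ d p u g r x := by
  have key : ∀ z : HNNExtension V A B φ, 0 < ht σ z →
      ht σ z < ht σ (lprod (axis u g r) : HNNExtension V A B φ) →
      ls d z ≠ [] ∧ ls d z ≠ axis u g r := by
    intro z h1 h2
    rw [← ht_lprod_ls σ d z] at h1 h2
    refine ⟨fun e => ?_, fun e => ?_⟩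
    · simp [e] at h1
    · rw [e] at h2
      exact lt_irrefl _ h2
  have hj : ∀ j : ℤ, -c ≤ j → j ≤ c → ∀ a : V, ls d (t ^ j * (of a * x)) ≠ [] ∧
      ls d (t ^ j * (of a * x)) ≠ axis u g r := by
    intro j h3 h4 a
    have h5 : |j * (σ : ℤ)| ≤ c := by rw [abs_units, abs_le]; exact ⟨h3, h4⟩
    have h6 := abs_le.1 h5
    apply key
    · rw [ht_mul, ht_mul, ht_of, ht_t_zpow]
      lia
    · rw [ht_mul, ht_mul, ht_of, ht_t_zpow]
      lia
  funext ⟨i, a⟩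
  have := propagate (ψ := labAt φ ρ d p u g r) (of a * x) (fun j h3 h4 => ?_) i
  · rw [view, mul_assoc]
    refine this.trans ?_
    rw [labAt_of_mul, act, one_mul]
  · have e : t ^ (j + 1) * (of a * x) = t * (t ^ j * (of a * x)) := by
      rw [add_comm, zpow_add, zpow_one, mul_assoc]
    have h5 := hj (j + 1) (by lia) (by lia) a
    rw [e] at h5 ⊢
    exact ee_labAt hst hK _ (hj j h3 h4.le a) h5

theorem rr_conf [Finite V] [Finite C]
    (hst : ∀ n, AxisStep φ ρ d K (p n) (u n) (p (n + 1)) (u (n + 1)) (g (n + 1)))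
    (hK : Nat.card (Lab V C m c × ℤˣ) ≤ K) (σ : ℤˣ)
    (x : HNNExtension V A B φ) (h1 : c < ht σ x)
    (h2 : ht σ x + c < ht σ (lprod (axis u g r) : HNNExtension V A B φ)) (s : Fin m) :
    RR ρ s (conf φ ρ d p u g r x) (conf φ ρ d p u g r (ρ.step φ s * x)) := by
  have h3 : Valid ρ (view c (conf φ ρ d p u g r) x) := by
    rw [view_conf hst hK σ x h1 h2]
    exact Valid.act ρ (valid_lab hst hK (nrm_ls d x)) _
  rw [valid_view] at h3
  simpa using h3 1 s

theorem conf_supp [Finite V] [Finite C] (hK : Nat.card (Lab V C m c × ℤˣ) ≤ K)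
    {x : HNNExtension V A B φ} (hx : conf φ ρ d p u g r x ≠ none) :
    ∃ j ≤ r, ∃ L, ls d x = L ++ axis u g j ∧ L.length ≤ K := by
  refine lab_supp (φ := φ) (ρ := ρ) (p := p) hK (nrm_ls d x) fun hb => hx ?_
  rw [conf, labAt, hb]
  rfl

theorem finite_conf [Finite V] [Finite C] (hK : Nat.card (Lab V C m c × ℤˣ) ≤ K) :
    {x | conf φ ρ d p u g r x ≠ none}.Finite := by
  have h1 : (Set.univ ×ˢ {L : List (ℤˣ × V) | L.length ≤ K + r} :
      Set (V × List (ℤˣ × V))).Finite :=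
    Set.finite_univ.prod (List.finite_length_le _ _)
  refine Set.Finite.of_finite_image (f := fun x => (hd d x, ls d x)) (h1.subset ?_) ?_
  · rintro _ ⟨x, hx, rfl⟩
    obtain ⟨j, hj, L, hL, hL'⟩ := conf_supp hK hx
    refine ⟨Set.mem_univ _, ?_⟩
    change (ls d x).length ≤ K + r
    rw [hL]
    simp
    lia
  · intro x _ y _ hxy
    rw [Prod.mk.injEq] at hxy
    exact ext_hd_ls d hxy.1 hxy.2

end NewConf

end HNNExtension

/-! ### The pumping theorem -/

namespace HNNExtension

open NormalWord Pointwise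

section Pump

variable {V : Type*} [Group V] {A B : Subgroup V} {φ : A ≃* B}

variable (φ) in
/-- The set of elements with at most one stable letter. -/
def ball : Set (HNNExtension V A B φ) :=
  {x | ∃ (a : V) (k : ℤ) (a' : V), |k| ≤ 1 ∧ x = of a * t ^ k * of a'}

theorem of_mem_ball (a : V) : of a ∈ ball φ := ⟨a, 0, 1, by simp, by simp⟩

theorem one_mem_ball : (1 : HNNExtension V A B φ) ∈ ball φ := by
  simpa using of_mem_ball (φ := φ) 1

theorem inv_ball : (ball φ)⁻¹ = ball φ := by
  have h : ∀ x, x ∈ ball φ → x⁻¹ ∈ ball φ := by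
    rintro _ ⟨a, k, a', hk, rfl⟩
    exact ⟨a'⁻¹, -k, a⁻¹, by simpa using hk, by simp [mul_assoc]⟩
  ext x
  exact ⟨fun hx => by simpa using h _ hx, fun hx => h _ hx⟩

theorem inv_mem_ball_pow {x : HNNExtension V A B φ} {n : ℕ} (h : x ∈ ball φ ^ n) :
    x⁻¹ ∈ ball φ ^ n := by
  rw [← Set.mem_inv, ← inv_pow, inv_ball]
  exact h

theorem mul_mem_ball_pow {x y : HNNExtension V A B φ} {n k : ℕ} (hx : x ∈ ball φ ^ n)
    (hy : y ∈ ball φ ^ k) : x * y ∈ ball φ ^ (n + k) := by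
  rw [pow_add]
  exact Set.mul_mem_mul hx hy

theorem ball_pow_mono {n k : ℕ} (h : n ≤ k) : ball φ ^ n ⊆ ball φ ^ k :=
  Set.pow_subset_pow_right one_mem_ball h

theorem lprod_mem_ball_pow (L : List (ℤˣ × V)) : lprod L ∈ ball φ ^ L.length := by
  induction L with
  | nil => simp
  | cons x L ih =>
    rw [lprod_cons, List.length_cons, add_comm]
    refine mul_mem_ball_pow ?_ ih
    rw [pow_one]
    refine ⟨1, x.1, x.2, ?_, by simp⟩
    rcases Int.units_eq_one_or x.1 with h | h <;> simp [h]

theorem zpow_mem_ball_pow (k : ℤ) : t ^ k ∈ ball φ ^ k.natAbs := by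
  have key : ∀ n : ℕ, t ^ n ∈ ball φ ^ n := by
    intro n
    exact Set.pow_mem_pow ⟨1, 1, 1, by simp, by simp⟩
  obtain ⟨n, rfl | rfl⟩ := k.eq_nat_or_neg
  · simpa using key n
  · simpa using inv_mem_ball_pow (key n)

variable {C : Type*} {m c : ℕ} {ρ : Rule V C m c} {d : TransversalPair V A B}
variable {p : ℕ → Lab V C m c} {u : ℕ → ℤˣ} {g : ℕ → V} {K r : ℕ}

theorem step_mem_ball_pow (s : Fin m) : ρ.step φ s ∈ ball φ ^ (c + 1) := by
  have h := abs_kappa_le ρ s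
  rw [Int.abs_eq_natAbs] at h
  have h1 := mul_mem_ball_pow (φ := φ) (zpow_mem_ball_pow (ρ.κ s))
    (show of (ρ.α s) ∈ ball φ ^ 1 by rw [pow_one]; exact of_mem_ball _)
  exact ball_pow_mono (by lia) h1

open Finset in
theorem eq_of_map_eq_of_conf {Q : Type*} [Group Q] (π : HNNExtension V A B φ →* Q) (σ : ℤˣ)
    [Finite V] [Finite C] (hK : Nat.card (Lab V C m c × ℤˣ) ≤ K)
    (hπht : ∀ h, π h = 1 → ht σ h = 0) {R : ℕ} (hR : K * (c + 3 * K) + 2 * K + c + 4 ≤ R)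
    (hπ : ∀ h ∈ ball φ ^ R, π h = 1 → h = 1)
    (hprog : ∀ i j : ℕ, i ≤ j → (j : ℤ) - i ≤ K * (∑ n ∈ range j, ((u (n + 1) : ℤ) * σ) -
        ∑ n ∈ range i, ((u (n + 1) : ℤ) * σ) + K))
    {x y : HNNExtension V A B φ} (hx : conf φ ρ d p u g r x ≠ none)
    (hy : conf φ ρ d p u g r y ≠ none) (z : HNNExtension V A B φ) (hz : z ∈ ball φ ^ (c + 1))
    (hzht : |ht σ z| ≤ c) (h : π y = π (z * x)) : y = z * x := by
  set θ : ℕ → ℤ := fun n => ∑ i ∈ range n, ((u (i + 1) : ℤ) * σ) with hθ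
  have h1 : π (y * (z * x)⁻¹) = 1 := by rw [map_mul, map_inv, h, mul_inv_cancel]
  have hht := hπht _ h1
  suffices hmem : y * (z * x)⁻¹ ∈ ball φ ^ R from mul_inv_eq_one.1 (hπ _ hmem h1)
  obtain ⟨i, -, L, hL, hLK⟩ := conf_supp hK hx
  obtain ⟨j, -, L', hL', hLK'⟩ := conf_supp hK hy
  have ex : x = of (hd d x) * (lprod L * lprod (axis u g i)) := by
    rw [← lprod_append, ← hL, hd_mul_lprod]
  have ey : y = of (hd d y) * (lprod L' * lprod (axis u g j)) := by
    rw [← lprod_append, ← hL', hd_mul_lprod]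
  have hx1 : ht σ x = ht σ (lprod L : HNNExtension V A B φ) + θ i := by
    rw [ex, ht_mul, ht_mul, ht_of, ht_axis, zero_add]
  have hy1 : ht σ y = ht σ (lprod L' : HNNExtension V A B φ) + θ j := by
    rw [ey, ht_mul, ht_mul, ht_of, ht_axis, zero_add]
  have hx2 := abs_le.1 (abs_ht_lprod_le (φ := φ) σ L)
  have hy2 := abs_le.1 (abs_ht_lprod_le (φ := φ) σ L')
  have hz2 := abs_le.1 hzht
  rw [ht_mul, ht_inv, ht_mul] at hht
  have hdiff : ∀ i j : ℕ, i ≤ j → θ j - θ i ≤ c + 2 * K → j - i ≤ K * (c + 3 * K) := by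
    intro i j hij hle
    have := hprog i j hij
    have h2 : (K : ℤ) * (θ j - θ i + K) ≤ K * (c + 3 * K) :=
      mul_le_mul_of_nonneg_left (by linarith) (by positivity)
    have h3 : ((j : ℤ) - i) ≤ ((K * (c + 3 * K) : ℕ) : ℤ) := by
      push_cast
      exact this.trans h2
    lia
  have haxis : ∀ i j : ℕ, i ≤ j → lprod (axis u g j) * (lprod (axis u g i))⁻¹ ∈
      ball φ ^ (j - i) := by
    intro i j hij
    obtain ⟨T, hT⟩ := axis_suffix u g hij
    have hl := congrArg List.length hT
    rw [List.length_append, length_axis, length_axis] at hl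
    rw [← hT, lprod_append, mul_inv_cancel_right, show j - i = T.length by lia]
    exact lprod_mem_ball_pow T
  have hmid : lprod (axis u g j) * (lprod (axis u g i))⁻¹ ∈ ball φ ^ (K * (c + 3 * K)) := by
    rcases le_total i j with hij | hij
    · exact ball_pow_mono (hdiff i j hij (by lia)) (haxis i j hij)
    · have := inv_mem_ball_pow (haxis j i hij)
      rw [mul_inv_rev, inv_inv] at this
      exact ball_pow_mono (hdiff j i hij (by lia)) this
  have hof : ∀ a : V, of a ∈ ball φ ^ 1 := fun a => by rw [pow_one]; exact of_mem_ball a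
  have e : y * (z * x)⁻¹ = (of (hd d y) * lprod L') *
      ((lprod (axis u g j) * (lprod (axis u g i))⁻¹) *
      ((lprod L)⁻¹ * ((of (hd d x))⁻¹ * z⁻¹))) := by
    conv_lhs => rw [ex, ey]
    group
  rw [e]
  exact ball_pow_mono (by lia) (mul_mem_ball_pow
    (mul_mem_ball_pow (hof _) (ball_pow_mono hLK' (lprod_mem_ball_pow L')))
    (mul_mem_ball_pow hmid
    (mul_mem_ball_pow (inv_mem_ball_pow (ball_pow_mono hLK (lprod_mem_ball_pow L)))
    (mul_mem_ball_pow (inv_mem_ball_pow (hof _)) (inv_mem_ball_pow hz)))))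

theorem conf_nxt [Finite V] [Finite C] (hK : Nat.card (Lab V C m c × ℤˣ) ≤ K) (σ : ℤˣ)
    (hst : ∀ n, AxisStep φ ρ d K (p n) (u n) (p (n + 1)) (u (n + 1)) (g (n + 1)))
    {x : HNNExtension V A B φ} (h1 : c < ht σ x)
    (h2 : ht σ x + c < ht σ (lprod (axis u g r) : HNNExtension V A B φ)) {cl : C} {a : Fin m}
    (hx : conf φ ρ d p u g r x = some (cl, a)) :
    ∃ b, conf φ ρ d p u g r (nxt ρ (conf φ ρ d p u g r) x) = some (b, ρ.dir cl) := by
  rw [nxt_some hx]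
  exact (rr_conf hst hK σ x h1 h2 (ρ.dir cl)).2.1 _ hx rfl

theorem abs_ht_nxt_le (σ : ℤˣ) (χ : HNNExtension V A B φ → Option (C × Fin m))
    (x : HNNExtension V A B φ) : |ht σ (nxt ρ χ x) - ht σ x| ≤ c := by
  rcases hx : χ x with _ | ⟨cl, a⟩
  · rw [nxt_none hx]
    simp
  · rw [nxt_some hx, ht_mul, add_sub_cancel_right]
    exact abs_ht_step_le σ ρ _

theorem ind_nxt {α' : Fin m → V} (hα' : ∀ s, ρ.step φ s = of (α' s) * t ^ ρ.κ s) (σ : ℤˣ)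
    (χ : HNNExtension V A B φ → Option (C × Fin m)) {u : ℤˣ} {g : V} {L : List (ℤˣ × V)}
    (hL : Nrm (A := A) (B := B) d ((u, g) :: L)) {x : HNNExtension V A B φ}
    (hx : ht σ (lprod ((u, g) :: L) : HNNExtension V A B φ) + c < ht σ x) :
    ind d ((u, g) :: L) (nxt ρ χ x) = ind d ((u, g) :: L) x := by
  rcases hcl : χ x with _ | ⟨cl, a⟩
  · rw [nxt_none hcl]
  rw [nxt_some hcl]
  by_contra hne
  have hne' : ind d ((u, g) :: L) (t ^ ρ.κ (ρ.dir cl) * (x * (lprod ((u, g) :: L))⁻¹) *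
      lprod ((u, g) :: L)) ≠
      ind d ((u, g) :: L) (x * (lprod ((u, g) :: L))⁻¹ * lprod ((u, g) :: L)) := by
    intro he
    apply hne
    rw [inv_mul_cancel_right, mul_assoc, inv_mul_cancel_right] at he
    rw [hα', mul_assoc, ind_of_mul, he]
  obtain ⟨i, b, hi, hz⟩ := exists_of_ind_zpow_ne d hL _ _ hne'
  have hz' : x = t ^ i * (of b * lprod ((u, g) :: L)) := by
    rw [← mul_assoc, ← hz, inv_mul_cancel_right]
  have h5 := hi.trans (abs_kappa_le ρ _)
  rw [← abs_units σ] at h5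
  have h6 := abs_le.1 h5
  rw [hz', ht_mul, ht_mul, ht_of, ht_t_zpow] at hx
  lia

open Finset in
/-- The flow yields an orbit crossing the good zone. -/
theorem exists_orbit [Finite V] [Finite C] {α' : Fin m → V}
    (hα' : ∀ s, ρ.step φ s = of (α' s) * t ^ ρ.κ s) (σ : ℤˣ)
    (hK : Nat.card (Lab V C m c × ℤˣ) ≤ K)
    (hst : ∀ n, AxisStep φ ρ d K (p n) (u n) (p (n + 1)) (u (n + 1)) (g (n + 1)))
    (hprog : ∀ i j : ℕ, i ≤ j → (j : ℤ) - i ≤ K * (∑ n ∈ range j, ((u (n + 1) : ℤ) * σ) -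
        ∑ n ∈ range i, ((u (n + 1) : ℤ) * σ) + K)) (T : ℕ) :
    ∃ r, (T : ℤ) < ht σ (lprod (axis u g r) : HNNExtension V A B φ) ∧
      ∃ x, ht σ x ≤ 2 * c ∧ ∃ n, (∀ i ≤ n, conf φ ρ d p u g r
        ((nxt ρ (conf φ ρ d p u g r))^[i] x) ≠ none) ∧
        ht σ (lprod (axis u g r) : HNNExtension V A B φ) ≤
          ht σ ((nxt ρ (conf φ ρ d p u g r))^[n] x) + 2 * c := by
  set θ : ℕ → ℤ := fun n => ∑ i ∈ range n, ((u (i + 1) : ℤ) * σ) with hθ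
  have hθax : ∀ n, ht σ (lprod (axis u g n) : HNNExtension V A B φ) = θ n := ht_axis φ u g σ
  have hθle : ∀ n, θ n ≤ n := by
    intro n
    have := abs_ht_lprod_le (φ := φ) σ (axis u g n)
    rw [hθax, length_axis] at this
    exact (le_abs_self _).trans this
  have hKpos : (0 : ℤ) < K := by
    by_contra hcon
    have h1 := hprog 0 1 (by lia)
    have h2 : (K : ℤ) = 0 := by lia
    rw [h2] at h1
    simp at h1
  have hbig : ∀ (S : ℤ) (j : ℕ), (K : ℤ) * (S + K) ≤ j → S ≤ θ j := by
    intro S j hj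
    have h1 := hprog 0 j (by lia)
    have h2 : (K : ℤ) * (S + K) ≤ K * (θ j + K) := by
      refine hj.trans ?_
      simpa [hθ] using h1
    have := le_of_mul_le_mul_left h2 hKpos
    linarith
  obtain ⟨j₀, hj₀⟩ : ∃ j₀ : ℕ, K * (2 * c + K + 1 + K) + c + K = j₀ := ⟨_, rfl⟩
  obtain ⟨T', hT'⟩ : ∃ T' : ℕ, T + j₀ + 5 * c + 3 * K + 5 = T' := ⟨_, rfl⟩
  obtain ⟨r, hr⟩ : ∃ r : ℕ, K * (T' + K) = r := ⟨_, rfl⟩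
  have hj₀' : (K : ℤ) * (2 * c + K + 1 + K) + c + K = j₀ := by exact_mod_cast hj₀
  have hθr : (T' : ℤ) ≤ θ r := hbig T' r (by exact_mod_cast hr.le)
  have hθj : ∀ j : ℕ, (j₀ : ℤ) ≤ j + c + K → 2 * c + K + 1 ≤ θ j := fun j hj =>
    hbig _ _ (by lia)
  have hj₀pos : 0 < j₀ := by
    have : (0 : ℤ) ≤ K * (2 * c + K + 1 + K) := by positivity
    lia
  have hj₀r : j₀ ≤ r := by have := hθle r; lia
  refine ⟨r, by rw [hθax]; lia, ?_⟩
  set χ := conf φ ρ d p u g r with hχ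
  set F := (finite_conf (φ := φ) (ρ := ρ) (d := d) (p := p) (u := u) (g := g) (r := r)
    hK).toFinset with hF
  have hmem : ∀ x, x ∈ F ↔ χ x ≠ none := fun x => by simp [hF, hχ]
  obtain ⟨i₀, rfl⟩ : ∃ i, j₀ = i + 1 := Nat.exists_eq_succ_of_ne_zero hj₀pos.ne'
  have hnrm : Nrm (A := A) (B := B) d (axis u g (i₀ + 1)) := nrm_axis hst _
  have hpred : ∀ x cl a, χ x = some (cl, a) → 2 * c < ht σ x → ht σ x + 2 * c < θ r →
      ∃ b, χ ((ρ.step φ a)⁻¹ * x) = some b ∧ ρ.dir b.1 = a := by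
    intro x cl a hx h1 h2
    have h3 := abs_le.1 (abs_ht_step_le (φ := φ) σ ρ a)
    have := rr_conf (r := r) hst hK σ ((ρ.step φ a)⁻¹ * x) (by rw [ht_mul, ht_inv]; lia)
      (by rw [ht_mul, ht_inv, hθax]; lia) a
    rw [mul_inv_cancel_left] at this
    exact this.2.2 _ hx
  suffices key : ∃ x ∈ F, x ∈ {x | ht σ x ≤ 2 * (c : ℤ)} ∧ ∃ n, (∀ i ≤ n, (nxt ρ χ)^[i] x ∈ F) ∧
      (nxt ρ χ)^[n] x ∈ {x | θ r ≤ ht σ x + 2 * c} by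
    obtain ⟨x, hxF, hxL, n, hn1, hn2⟩ := key
    refine ⟨x, hxL, n, fun i hi => (hmem _).1 (hn1 i hi), ?_⟩
    rw [hθax]
    exact hn2
  refine exists_orbit_of_flow_pos F (nxt ρ χ)
    {x | ht σ x ≤ 2 * c} {x | θ r ≤ ht σ x + 2 * c} (ind d (axis u g (i₀ + 1)))
    (fun x => by unfold ind; split_ifs <;> simp) ?_ ?_ ?_ ?_ ?_ ?_
  · intro x hx hxL hxR
    rw [Set.mem_ofPred_eq, not_le] at hxL hxR
    obtain ⟨⟨cl, a⟩, hcl⟩ : ∃ y, χ x = some y := Option.ne_none_iff_exists'.1 ((hmem x).1 hx)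
    obtain ⟨b, hb⟩ := conf_nxt hK σ hst (by lia) (by rw [hθax]; lia) hcl
    rw [hmem, hχ, hb]
    simp
  · intro x hx hxL hxR y hy hyL hyR hxy
    rw [Set.mem_ofPred_eq, not_le] at hxL hxR hyL hyR
    obtain ⟨⟨cl, a⟩, hcl⟩ : ∃ y, χ x = some y := Option.ne_none_iff_exists'.1 ((hmem x).1 hx)
    obtain ⟨⟨cl', a'⟩, hcl'⟩ : ∃ z, χ y = some z := Option.ne_none_iff_exists'.1 ((hmem y).1 hy)
    obtain ⟨b, hb⟩ := conf_nxt hK σ hst (by lia) (by rw [hθax]; lia) hcl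
    obtain ⟨b', hb'⟩ := conf_nxt hK σ hst (by lia) (by rw [hθax]; lia) hcl'
    have e : ρ.dir cl = ρ.dir cl' := by
      rw [← hχ, hxy] at hb
      rw [← hχ, hb] at hb'
      simpa using (congrArg Prod.snd (Option.some_inj.1 hb'))
    rw [nxt_some hcl, nxt_some hcl', e] at hxy
    exact mul_left_cancel hxy
  · intro y hy hyL hyR
    rw [Set.mem_ofPred_eq, not_le] at hyL hyR
    obtain ⟨⟨cl, a⟩, hcl⟩ : ∃ z, χ y = some z := Option.ne_none_iff_exists'.1 ((hmem y).1 hy)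
    obtain ⟨⟨cl', a'⟩, hb, hb'⟩ := hpred y cl a hcl hyL hyR
    refine ⟨_, (hmem _).2 (by rw [hb]; simp), ?_⟩
    rw [nxt_some hb, hb', mul_inv_cancel_left]
  · intro x hx hxL
    rw [Set.mem_ofPred_eq] at hxL
    have hxn := (hmem x).1 hx
    obtain ⟨j, -, L, hL, hLK⟩ := conf_supp hK hxn
    have hshort : (ls d x).length + c < i₀ + 1 := by
      by_contra hcon
      rw [hL, List.length_append, length_axis] at hcon
      have h1 := hθj j (by lia)
      have h2 : ht σ x = ht σ (lprod L : HNNExtension V A B φ) + θ j := by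
        rw [← ht_lprod_ls σ d, hL, lprod_append, ht_mul, hθax]
      have h3 := abs_le.1 (abs_ht_lprod_le (φ := φ) σ L)
      lia
    obtain ⟨⟨cl, a⟩, hcl⟩ : ∃ z, χ x = some z := Option.ne_none_iff_exists'.1 hxn
    have hz : ∀ z : HNNExtension V A B φ, (ls d z).length < i₀ + 1 →
        ind d (axis u g (i₀ + 1)) z = 0 := by
      intro z hz
      unfold ind
      rw [if_neg]
      intro hs
      have := hs.length_le
      rw [length_axis] at this
      lia
    refine ⟨hz _ (by lia), hz _ ?_⟩
    rw [nxt_some hcl, hα', mul_assoc, ls_of_mul]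
    have h4 := length_ls_zpow d (ρ.κ (ρ.dir cl)) x
    have h5 := abs_kappa_le ρ (ρ.dir cl)
    rw [Int.abs_eq_natAbs] at h5
    lia
  · intro x hx hxR
    rw [Set.mem_ofPred_eq] at hxR
    have hxn := (hmem x).1 hx
    obtain ⟨j, -, L, hL, hLK⟩ := conf_supp hK hxn
    have h2 : ht σ x = ht σ (lprod L : HNNExtension V A B φ) + θ j := by
      rw [← ht_lprod_ls σ d, hL, lprod_append, ht_mul, hθax]
    have h3 := abs_le.1 (abs_ht_lprod_le (φ := φ) σ L)
    have h4 := hθle j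
    have e1 : ind d (axis u g (i₀ + 1)) x = 1 := by
      unfold ind
      rw [if_pos]
      rw [hL]
      exact (axis_suffix u g (by lia)).trans (List.suffix_append _ _)
    refine ⟨e1, ?_⟩
    rw [← e1]
    refine ind_nxt hα' σ χ hnrm ?_
    have := hθax (i₀ + 1)
    rw [axis] at this
    rw [this]
    have := hθle (i₀ + 1)
    lia
  · have h1 := sum_ind_eq_flowAt ρ d α' hα' hnrm χ F (fun x hx => (hmem x).2 hx)
    have h2 : view c χ (lprod (axis u g (i₀ + 1))) = p (i₀ + 1) := by
      have := hθj (i₀ + 1) (by lia)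
      have := hθle (i₀ + 1)
      rw [hχ, view_conf hst hK σ _ (by rw [hθax]; lia) (by rw [hθax, hθax]; lia), labAt,
        hnrm.hd_lprod, hnrm.ls_lprod, act_one, lab_axis φ ρ d p u g hj₀r]
    have h3 : flowAt φ ρ d (view c χ (lprod (axis u g (i₀ + 1)))) (u (i₀ + 1)) = 1 := by
      rw [h2]
      exact (hst _).2.1
    have h4 := h1.trans h3
    exact h4.symm ▸ one_pos

end Pump

end HNNExtension

/-! ### Long snakes from the pumped configuration -/

theorem exists_orbit_segment {X : Type*} (f : X → X) (h : X → ℤ) (c N : ℕ) (θ : ℤ)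
    (hf : ∀ x, |h (f x) - h x| ≤ c) (hθ : 4 * c + c * N < θ) {x : X} (hx : h x ≤ 2 * c) {n : ℕ}
    (hn : θ ≤ h (f^[n] x) + 2 * c) :
    ∃ k, ∀ i < N, k + i ≤ n ∧ 2 * c < h (f^[k + i] x) ∧ h (f^[k + i] x) + 2 * c < θ ∧
      ∀ j < N, f^[k + i] x = f^[k + j] x → i = j := by
  classical
  have hex : ∃ n, θ ≤ h (f^[n] x) + 2 * c := ⟨n, hn⟩
  obtain ⟨n₀, hn₀, hmin, hle⟩ : ∃ n₀, θ ≤ h (f^[n₀] x) + 2 * c ∧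
      (∀ i < n₀, ¬ θ ≤ h (f^[i] x) + 2 * c) ∧ n₀ ≤ n :=
    ⟨Nat.find hex, Nat.find_spec hex, fun i hi => Nat.find_min hex hi, Nat.find_min' hex hn⟩
  obtain ⟨m, hm, hmle, hmax⟩ : ∃ m, h (f^[m] x) ≤ 2 * c ∧ m ≤ n₀ ∧
      ∀ i, m < i → i ≤ n₀ → ¬ h (f^[i] x) ≤ 2 * c :=
    ⟨Nat.findGreatest (fun i => h (f^[i] x) ≤ 2 * c) n₀,
      Nat.findGreatest_spec (P := fun i => h (f^[i] x) ≤ 2 * c) (Nat.zero_le n₀) (by simpa using hx),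
      Nat.findGreatest_le _, fun i h1 h2 => Nat.findGreatest_is_greatest h1 h2⟩
  have hup : ∀ j : ℕ, h (f^[m + j] x) ≤ 2 * c + c * j := by
    intro j
    induction j with
    | zero => simpa using hm
    | succ j ih =>
      have := abs_le.1 (hf (f^[m + j] x))
      rw [← add_assoc, Function.iterate_succ_apply']
      push_cast
      linarith [this.2]
  have hcN : ∀ i : ℕ, i ≤ N → (c : ℤ) * i ≤ c * N := fun i hi =>
    mul_le_mul_of_nonneg_left (by exact_mod_cast hi) (by positivity)
  have hin : ∀ i < N, m + 1 + i ≤ n₀ := by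
    intro i hi
    by_contra hcon
    have h1 := hup (n₀ - m)
    have h2 := hcN (n₀ - m) (by lia)
    rw [Nat.add_sub_cancel' hmle] at h1
    lia
  have hinj : ∀ a b, a < b → b ≤ n₀ → f^[a] x ≠ f^[b] x := by
    intro a b hab hb he
    refine hmin (n₀ - b + a) (by lia) ?_
    rw [Function.iterate_add_apply, he, ← Function.iterate_add_apply, Nat.sub_add_cancel hb]
    exact hn₀
  refine ⟨m + 1, fun i hi => ⟨(hin i hi).trans hle, ?_, ?_, ?_⟩⟩
  · exact not_le.1 (hmax _ (by lia) (hin i hi))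
  · have h1 := hup (1 + i)
    have h2 := hcN (1 + i) (by lia)
    rw [← add_assoc] at h1
    lia
  · intro j hj he
    rcases lt_trichotomy i j with hij | hij | hij
    · exact absurd he (hinj _ _ (by lia) (hin j hj))
    · exact hij
    · exact absurd he.symm (hinj _ _ (by lia) (hin i hi))

namespace HNNExtension

open NormalWord Pointwise

section Pump

variable {V : Type*} [Group V] {A B : Subgroup V} {φ : A ≃* B}
variable {C : Type*} {m c : ℕ} {ρ : Rule V C m c} {d : TransversalPair V A B}
variable {K : ℕ}

open Finset in
theorem exists_long_snake {Q : Type*} [Group Q] (π : HNNExtension V A B φ →* Q) (σ : ℤˣ)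
    [Finite V] [Finite C] (hK : Nat.card (Lab V C m c × ℤˣ) ≤ K)
    (hπht : ∀ h, π h = 1 → ht σ h = 0) {R : ℕ} (hR : K * (c + 3 * K) + 2 * K + c + 4 ≤ R)
    (hπ : ∀ h ∈ ball φ ^ R, π h = 1 → h = 1)
    {p : ℕ → Lab V C m c} {u : ℕ → ℤˣ} {g : ℕ → V} {α' : Fin m → V}
    (hα' : ∀ s, ρ.step φ s = of (α' s) * t ^ ρ.κ s)
    (hst : ∀ n, AxisStep φ ρ d K (p n) (u n) (p (n + 1)) (u (n + 1)) (g (n + 1)))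
    (hprog : ∀ i j : ℕ, i ≤ j → (j : ℤ) - i ≤ K * (∑ n ∈ range j, ((u (n + 1) : ℤ) * σ) -
        ∑ n ∈ range i, ((u (n + 1) : ℤ) * σ) + K)) (N : ℕ) :
    ∃ (w : ℕ → C) (y : ℕ → HNNExtension V A B φ),
      (∀ i < N, y (i + 1) = ρ.step φ (ρ.dir (w i)) * y i) ∧
      (∀ i < N, ∀ j < N, π (y i) = π (y j) → i = j) ∧
      ∀ i < N, ∀ j < N, ∀ s, π (y j) = π (ρ.step φ s * y i) → ρ.Dm (w i) s (w j) := by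
  obtain ⟨r, hr, x, hx, n, hn, hn'⟩ := exists_orbit hα' σ hK hst hprog (4 * c + c * N)
  obtain ⟨k, hk⟩ := exists_orbit_segment (nxt ρ (conf φ ρ d p u g r)) (ht σ) c N _
    (abs_ht_nxt_le σ _) (by exact_mod_cast hr) hx hn'
  set χ := conf φ ρ d p u g r with hχ
  have hconf : ∀ i < N, χ ((nxt ρ χ)^[k + i] x) ≠ none := fun i hi => hn _ (hk i hi).1
  have hcol : ∀ i, ∃ cl, i < N → ∃ a, χ ((nxt ρ χ)^[k + i] x) = some (cl, a) := by
    intro i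
    by_cases hi : i < N
    · obtain ⟨⟨cl, a⟩, h⟩ := Option.ne_none_iff_exists'.1 (hconf i hi)
      exact ⟨cl, fun _ => ⟨a, h⟩⟩
    · obtain ⟨⟨cl, a⟩, h⟩ := Option.ne_none_iff_exists'.1 (hn 0 (Nat.zero_le _))
      exact ⟨cl, fun h => absurd h hi⟩
  choose w hw using hcol
  refine ⟨w, fun i => (nxt ρ χ)^[k + i] x, ?_, ?_, ?_⟩
  · intro i hi
    obtain ⟨a, ha⟩ := hw i hi
    change (nxt ρ χ)^[k + (i + 1)] x = _
    rw [← add_assoc, Function.iterate_succ_apply', nxt_some ha]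
  · intro i hi j hj h
    refine (hk i hi).2.2.2 j hj ?_
    have := eq_of_map_eq_of_conf π σ hK hπht hR hπ hprog (hconf j hj) (hconf i hi) 1
      (Set.pow_subset_pow_right one_mem_ball (Nat.zero_le _) (by simp)) (by simp) (by simpa using h)
    simpa using this
  · intro i hi j hj s h
    have := eq_of_map_eq_of_conf π σ hK hπht hR hπ hprog (hconf i hi) (hconf j hj) _
      (step_mem_ball_pow s) (abs_ht_step_le σ ρ s) h
    obtain ⟨a, ha⟩ := hw i hi
    obtain ⟨a', ha'⟩ := hw j hj
    have h1 := (hk i hi).2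
    have h2 := (rr_conf (φ := φ) hst hK σ ((nxt ρ χ)^[k + i] x) (by lia) (by lia) s).1 _ _ ha
      (by rw [← this]; exact ha')
    exact h2

end Pump

end HNNExtension

/-! ### Snake words -/

section SnakeWord

variable {Q : Type*} [Group Q]

/-- The partial products of the directions of a coloured word. -/
def pprod (E : ℕ → Q) (w : ℕ → ℕ × ℕ) : ℕ → Q
  | 0 => 1
  | n + 1 => pprod E w n * E (w n).2

/-- A word of colours of length `N` describes a strong directed path. -/
def SnakeWord (E : ℕ → Q) (m : ℕ) (T : ℕ × List ((ℕ × ℕ) × ℕ × ℕ × ℕ)) (w : ℕ → ℕ × ℕ)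
    (N : ℕ) : Prop :=
  (∀ i < N, (w i).1 < T.1 ∧ (w i).2 < m) ∧
    ∀ i < N, ∀ j < N, (pprod E w i = pprod E w j → i = j) ∧
      ∀ s < m, pprod E w j = pprod E w i * E s → (w i, s, w j) ∈ T.2

theorem pprod_congr (E : ℕ → Q) {w w' : ℕ → ℕ × ℕ} {n : ℕ} (h : ∀ i < n, w i = w' i) :
    pprod E w n = pprod E w' n := by
  induction n with
  | zero => rfl
  | succ n ih =>
    rw [pprod, pprod, ih fun i hi => h i (by lia), h n (by lia)]

theorem pprod_conj (E : ℕ → Q) (g : Q) (w : ℕ → ℕ × ℕ) (n : ℕ) :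
    pprod (fun s => g * E s * g⁻¹) w n = g * pprod E w n * g⁻¹ := by
  induction n with
  | zero => simp [pprod]
  | succ n ih => rw [pprod, pprod, ih]; group

variable {E : ℕ → Q} {m : ℕ} {T : ℕ × List ((ℕ × ℕ) × ℕ × ℕ × ℕ)} {w w' : ℕ → ℕ × ℕ} {N : ℕ}

theorem SnakeWord.congr (hw : SnakeWord E m T w N) (h : ∀ i < N, w i = w' i) :
    SnakeWord E m T w' N := by
  have hp : ∀ i < N, pprod E w' i = pprod E w i := fun i hi =>
    (pprod_congr E fun j hj => h j (by lia)).symm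
  refine ⟨fun i hi => h i hi ▸ hw.1 i hi, fun i hi j hj => ?_⟩
  rw [hp i hi, hp j hj, ← h i hi, ← h j hj]
  exact hw.2 i hi j hj

theorem SnakeWord.mono (hw : SnakeWord E m T w N) {N' : ℕ} (h : N' ≤ N) : SnakeWord E m T w N' :=
  ⟨fun i hi => hw.1 i (by lia), fun i hi j hj => hw.2 i (by lia) j (by lia)⟩

theorem snakeWord_conj (g : Q) :
    SnakeWord (fun s => g * E s * g⁻¹) m T w N ↔ SnakeWord E m T w N := by
  have h (i j : ℕ) (s : ℕ) : g * pprod E w j * g⁻¹ = g * pprod E w i * g⁻¹ * (g * E s * g⁻¹) ↔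
      pprod E w j = pprod E w i * E s := by
    rw [show g * pprod E w i * g⁻¹ * (g * E s * g⁻¹) = g * (pprod E w i * E s) * g⁻¹ by group]
    simp
  simp only [SnakeWord, pprod_conj, h]
  simp

end SnakeWord

namespace HNNExtension

open NormalWord Pointwise

variable {V : Type*} [Group V] {A B : Subgroup V} {φ : A ≃* B} {m c k : ℕ}

theorem ht_eq_mul (σ : ℤˣ) (x : HNNExtension V A B φ) : ht σ x = ht 1 x * σ := by
  induction x using HNNExtension.induction_on with
  | of a => simp
  | t => simp
  | mul x y hx hy => rw [ht_mul, ht_mul, hx, hy, add_mul]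
  | inv x hx => rw [ht_inv, ht_inv, hx, neg_mul]

theorem snakeWord_pump [Finite V] (ρ : Rule V (Fin k × Fin m) m c) {Q : Type*} [Group Q]
    (π : HNNExtension V A B φ →* Q) (E : ℕ → Q) (D : List ((ℕ × ℕ) × ℕ × ℕ × ℕ))
    (hdir : ρ.dir = Prod.snd)
    (hDm : ∀ x s y, ρ.Dm x s y ↔ (((x.1 : ℕ), (x.2 : ℕ)), (s : ℕ), (y.1 : ℕ), (y.2 : ℕ)) ∈ D)
    (hE : ∀ s : Fin m, π (ρ.step φ s) = (E s)⁻¹)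
    {α' : Fin m → V} (hα' : ∀ s, ρ.step φ s = of (α' s) * t ^ ρ.κ s) (hQ : Q → ℤ)
    (hhQ : ∀ x, hQ (π x) = ht 1 x) {K R : ℕ}
    (hK : Nat.card (Lab V (Fin k × Fin m) m c × ℤˣ) ≤ K)
    (hR : K * (c + 3 * K) + 2 * K + c + 4 ≤ R) (hπ : ∀ h ∈ ball φ ^ R, π h = 1 → h = 1)
    {w : ℕ → ℕ × ℕ} {N : ℕ} (hw : SnakeWord E m (k, D) w (N + 1))
    (hbig : K + 2 * c + 2 < |hQ (pprod E w N)⁻¹|) (N' : ℕ) :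
    ∃ w', SnakeWord E m (k, D) w' N' := by
  have hk : 0 < k := (Nat.zero_le _).trans_lt (hw.1 0 (by lia)).1
  have hm : 0 < m := (Nat.zero_le _).trans_lt (hw.1 0 (by lia)).2
  obtain ⟨v, hv⟩ : ∃ v : ℕ → Fin k × Fin m, ∀ i ≤ N, ((v i).1 : ℕ) = (w i).1 ∧
      ((v i).2 : ℕ) = (w i).2 := by
    refine ⟨fun i => if h : i ≤ N then (⟨_, (hw.1 i (by lia)).1⟩, ⟨_, (hw.1 i (by lia)).2⟩)
      else (⟨0, hk⟩, ⟨0, hm⟩), fun i hi => ?_⟩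
    simp [hi]
  let y : ℕ → HNNExtension V A B φ := fun n => Nat.rec 1 (fun i x => ρ.step φ (ρ.dir (v i)) * x) n
  have hy0 : y 0 = 1 := rfl
  have hys : ∀ i, y (i + 1) = ρ.step φ (ρ.dir (v i)) * y i := fun i => rfl
  have hy : ∀ i ≤ N, π (y i) = (pprod E w i)⁻¹ := by
    intro i
    induction i with
    | zero => simp [hy0, pprod]
    | succ i ih =>
      intro hi
      rw [hys, map_mul, ih (by lia), pprod, mul_inv_rev, hE, hdir, (hv i (by lia)).2]
  have hwalk : IsWalk φ ρ v N y := by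
    refine ⟨hy0, hys, ?_, ?_⟩
    · intro i hi j hj h
      have h1 := congrArg π h
      rw [hy i hi, hy j hj, inv_inj] at h1
      exact (hw.2 i (by lia) j (by lia)).1 h1
    · intro i hi j hj s h
      have h1 := congrArg π h
      rw [map_mul, hy i hi, hy j hj, hE, ← mul_inv_rev, inv_inj] at h1
      have h2 := (hw.2 i (by lia) j (by lia)).2 s s.2 h1
      rw [hDm, (hv i hi).1, (hv i hi).2, (hv j hj).1, (hv j hj).2]
      exact h2
  obtain ⟨σ, hσ⟩ : ∃ σ : ℤˣ, K + 2 * c + 2 < ht σ (y N) := by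
    rw [← hy N le_rfl, hhQ] at hbig
    rcases le_total 0 (ht 1 (y N)) with h | h
    · refine ⟨1, ?_⟩
      rwa [abs_of_nonneg h] at hbig
    · refine ⟨-1, ?_⟩
      rw [abs_of_nonpos h] at hbig
      rw [ht_eq_mul]
      simpa using hbig
  obtain ⟨d⟩ := TransversalPair.nonempty V A B
  obtain ⟨p, u, g, hst, hprog⟩ := hwalk.exists_axis d α' hα' hK σ hσ
  obtain ⟨v', y', h1, h2, h3⟩ := exists_long_snake π σ hK
    (fun h hh => by
      have := hhQ h
      rw [hh, ← map_one π, hhQ, ht_one] at this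
      rw [ht_eq_mul, ← this, zero_mul]) hR hπ hα' hst hprog N'
  refine ⟨fun i => ((v' i).1, (v' i).2), ?_⟩
  have hp : ∀ i < N', pprod E (fun i => (((v' i).1 : ℕ), ((v' i).2 : ℕ))) i =
      π (y' 0) * (π (y' i))⁻¹ := by
    intro i
    induction i with
    | zero => simp [pprod]
    | succ i ih =>
      intro hi
      rw [pprod, ih (by lia), h1 i (by lia), map_mul, mul_inv_rev, hE, hdir, inv_inv, mul_assoc]
  refine ⟨fun i _ => ⟨(v' i).1.2, (v' i).2.2⟩, fun i hi j hj => ?_⟩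
  rw [hp i hi, hp j hj]
  refine ⟨fun h => h2 i hi j hj (by simpa using h), fun s hs h => ?_⟩
  refine (hDm _ ⟨s, hs⟩ _).1 (h3 i hi j hj ⟨s, hs⟩ ?_)
  rw [map_mul, hE, ← inv_inj, mul_inv_rev, inv_inv]
  rw [mul_assoc] at h
  exact mul_left_cancel h

end HNNExtension

/-! ### Finite quotients of HNN extensions of finite groups -/

open Equiv in
theorem exists_perm_extend {A Y : Type*} [Group A] [Finite Y] (f g : A →* Perm Y)
    (hf : ∀ a y, f a y = y → a = 1) (hg : ∀ a y, g a y = y → a = 1) (D : Set Y) (s : Y → Y)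
    (hD : ∀ a, ∀ y ∈ D, f a y ∈ D) (hs : Set.InjOn s D) (hsD : ∀ a, ∀ y ∈ D, s (f a y) = g a (s y)) :
    ∃ τ : Perm Y, (∀ a y, τ (f a y) = g a (τ y)) ∧ ∀ y ∈ D, τ y = s y := by
  classical
  induction h : Dᶜ.ncard using Nat.strong_induction_on generalizing D s with
  | _ n ih =>
    by_cases hDu : D = Set.univ
    · subst hDu
      have hb : Function.Bijective s :=
        Finite.injective_iff_bijective.1 (fun x y => hs (Set.mem_univ x) (Set.mem_univ y))
      exact ⟨Equiv.ofBijective s hb, fun a y => hsD a y (Set.mem_univ y), fun y _ => rfl⟩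
    obtain ⟨y, hy⟩ := (Set.ne_univ_iff_exists_notMem _).1 hDu
    obtain ⟨y', hy'⟩ : ∃ y', y' ∉ s '' D := by
      by_contra! hcon
      have h1 : (s '' D) = Set.univ := Set.eq_univ_iff_forall.2 hcon
      have h2 := hs.ncard_image
      rw [h1] at h2
      exact hDu (Set.eq_of_subset_of_ncard_le (Set.subset_univ _) h2.le)
    have hinj : ∀ a b, f a y = f b y → a = b := by
      intro a b hab
      have : f (b⁻¹ * a) y = y := by
        rw [map_mul, Perm.mul_apply, hab, ← Perm.mul_apply, ← map_mul]
        simp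
      exact (inv_mul_eq_one.1 (hf _ _ this)).symm
    have hinj' : ∀ a b, g a y' = g b y' → a = b := by
      intro a b hab
      have : g (b⁻¹ * a) y' = y' := by
        rw [map_mul, Perm.mul_apply, hab, ← Perm.mul_apply, ← map_mul]
        simp
      exact (inv_mul_eq_one.1 (hg _ _ this)).symm
    have hoff : ∀ a, f a y ∉ D := by
      intro a ha
      have := hD a⁻¹ _ ha
      rw [← Perm.mul_apply, ← map_mul, inv_mul_cancel, map_one] at this
      exact hy this
    have hoff' : ∀ a, ∀ z ∈ D, g a y' ≠ s z := by
      intro a z hz he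
      refine hy' ⟨f a⁻¹ z, hD _ _ hz, ?_⟩
      rw [hsD _ _ hz, ← he, ← Perm.mul_apply, ← map_mul, inv_mul_cancel, map_one]
      rfl
    let s' : Y → Y := fun z => if h : ∃ a, f a y = z then g h.choose y' else s z
    have hs'1 : ∀ a, s' (f a y) = g a y' := by
      intro a
      have h : ∃ b, f b y = f a y := ⟨a, rfl⟩
      simp only [s', dif_pos h]
      rw [hinj _ _ h.choose_spec]
    have hs'2 : ∀ z ∈ D, s' z = s z := by
      intro z hz
      simp only [s']
      rw [dif_neg]
      rintro ⟨a, rfl⟩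
      exact hoff a hz
    suffices key : ∃ τ : Perm Y, (∀ a y, τ (f a y) = g a (τ y)) ∧
        ∀ z ∈ D ∪ Set.range fun a => f a y, τ z = s' z by
      obtain ⟨τ, h1, h2⟩ := key
      exact ⟨τ, h1, fun z hz => (h2 z (Or.inl hz)).trans (hs'2 z hz)⟩
    refine ih ((D ∪ Set.range fun a => f a y)ᶜ.ncard) ?_
      (D ∪ Set.range fun a => f a y) s' ?_ ?_ ?_ rfl
    · rw [← h]
      refine Set.ncard_lt_ncard ?_
      rw [Set.ssubset_iff_of_subset (Set.compl_subset_compl.2 Set.subset_union_left)]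
      exact ⟨y, hy, fun hn => hn (Or.inr ⟨1, by simp⟩)⟩
    · rintro a z (hz | ⟨b, rfl⟩)
      · exact Or.inl (hD a z hz)
      · refine Or.inr ⟨a * b, ?_⟩
        simp
    · rintro z (hz | ⟨b, rfl⟩) z' (hz' | ⟨b', rfl⟩) he
      · rw [hs'2 z hz, hs'2 z' hz'] at he
        exact hs hz hz' he
      · simp only [hs'2 z hz, hs'1] at he
        exact absurd he.symm (hoff' _ _ hz)
      · simp only [hs'2 z' hz', hs'1] at he
        exact absurd he (hoff' _ _ hz')
      · simp only [hs'1] at he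
        rw [hinj' _ _ he]
    · rintro a z (hz | ⟨b, rfl⟩)
      · rw [hs'2 _ (hD a z hz), hs'2 z hz, hsD a z hz]
      · simp only
        rw [← Perm.mul_apply, ← map_mul, hs'1, hs'1, map_mul, Perm.mul_apply]

namespace HNNExtension

open Pointwise Equiv

variable {V : Type*} [Group V] {A B : Subgroup V} {φ : A ≃* B}

theorem of_mul_mem_ball_pow {R : ℕ} (hR : 1 ≤ R) {x : HNNExtension V A B φ} (hx : x ∈ ball φ ^ R)
    (a : V) : of a * x ∈ ball φ ^ R := by
  obtain ⟨R, rfl⟩ : ∃ R', R = R' + 1 := ⟨R - 1, by lia⟩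
  rw [pow_succ'] at hx ⊢
  obtain ⟨_, ⟨b, k, b', hk, rfl⟩, z, hz, rfl⟩ := hx
  exact ⟨of (a * b) * t ^ k * of b', ⟨_, k, _, hk, rfl⟩, z, hz, by simp [mul_assoc]⟩

theorem finite_ball [Finite V] : (ball φ).Finite ∧ (ball φ).ncard ≤ 3 * Nat.card V ^ 2 := by
  have he : ball φ = Set.range fun x : V × (Finset.Icc (-1 : ℤ) 1) × V =>
      (of x.1 * t ^ (x.2.1 : ℤ) * of x.2.2 : HNNExtension V A B φ) := by
    ext z
    constructor
    · rintro ⟨a, k, a', hk, rfl⟩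
      exact ⟨(a, ⟨k, Finset.mem_Icc.2 (abs_le.1 hk)⟩, a'), rfl⟩
    · rintro ⟨⟨a, k, a'⟩, rfl⟩
      exact ⟨a, k, a', abs_le.2 (Finset.mem_Icc.1 k.2), rfl⟩
  rw [he]
  refine ⟨Set.finite_range _, ?_⟩
  rw [← Set.image_univ]
  refine (Set.ncard_image_le Set.finite_univ).trans ?_
  rw [Set.ncard_univ, Nat.card_prod, Nat.card_prod]
  have : Nat.card (Finset.Icc (-1 : ℤ) 1) = 3 := by
    rw [Nat.card_eq_fintype_card, Fintype.card_coe]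
    rfl
  rw [this]
  exact le_of_eq (by ring)

theorem finite_ball_pow [Finite V] (R : ℕ) :
    (ball φ ^ R).Finite ∧ (ball φ ^ R).ncard ≤ (3 * Nat.card V ^ 2) ^ R := by
  induction R with
  | zero =>
    rw [pow_zero, pow_zero]
    exact ⟨Set.finite_one, (Set.ncard_singleton _).le⟩
  | succ R ih =>
    rw [pow_succ, pow_succ]
    refine ⟨ih.1.mul finite_ball.1, ?_⟩
    rw [← Set.image_mul_prod]
    refine (Set.ncard_image_le (ih.1.prod finite_ball.1)).trans ?_
    rw [Set.ncard_prod]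
    exact Nat.mul_le_mul ih.2 finite_ball.2

theorem exists_hom_perm_ball [Finite V] {R : ℕ} (hR : 1 ≤ R) :
    ∃ f : HNNExtension V A B φ →* Perm ↥(ball φ ^ R : Set (HNNExtension V A B φ)),
      ∀ h ∈ ball φ ^ R, f h = 1 → h = 1 := by
  have hfin : Finite ↥(ball φ ^ R : Set (HNNExtension V A B φ)) := (finite_ball_pow R).1
  let F : V →* Perm ↥(ball φ ^ R : Set (HNNExtension V A B φ)) := MonoidHom.toHomPerm
    { toFun := fun a x => ⟨of a * x.1, of_mul_mem_ball_pow hR x.2 a⟩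
      map_one' := by
        funext x
        exact Subtype.ext (show of 1 * x.1 = x.1 by simp)
      map_mul' := fun a b => by
        funext x
        exact Subtype.ext (show of (a * b) * x.1 = of a * (of b * x.1) by simp [mul_assoc]) }
  have hF : ∀ a x, ((F a x : ↥(ball φ ^ R : Set (HNNExtension V A B φ))) :
      HNNExtension V A B φ) = of a * x.1 := fun a x => rfl
  have hfree : ∀ a x, F a x = x → a = 1 := by
    intro a x h
    have h1 := congrArg Subtype.val h
    rw [hF, mul_eq_right] at h1
    exact of_injective φ (h1.trans (map_one of).symm)
  classical
  obtain ⟨τ, h1, h2⟩ := exists_perm_extend (F.comp A.subtype) (F.comp (B.subtype.comp φ.toMonoidHom))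
    (fun a y h => Subtype.ext (hfree _ _ h))
    (fun a y h => by
      have h3 : ((φ a : B) : V) = 1 := hfree _ _ h
      simpa using h3)
    {x | t * x.1 ∈ ball φ ^ R} (fun x => if h : t * x.1 ∈ ball φ ^ R then ⟨t * x.1, h⟩ else x)
    (by
      intro a x hx
      change t * (of (a : V) * x.1) ∈ ball φ ^ R
      rw [← mul_assoc, t_mul_of, mul_assoc]
      exact of_mul_mem_ball_pow hR hx _)
    (by
      intro x hx y hy h
      have hx' : t * x.1 ∈ ball φ ^ R := hx
      have hy' : t * y.1 ∈ ball φ ^ R := hy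
      simp only [hx', hy', dif_pos] at h
      exact Subtype.ext (mul_left_cancel (congrArg Subtype.val h)))
    (by
      intro a x hx
      have h3 : t * (of (a : V) * x.1) ∈ ball φ ^ R := by
        rw [← mul_assoc, t_mul_of, mul_assoc]
        exact of_mul_mem_ball_pow hR hx _
      have e1 : (if h : t * ((F.comp A.subtype) a x).1 ∈ ball φ ^ R then
          (⟨t * ((F.comp A.subtype) a x).1, h⟩ : ↥(ball φ ^ R : Set (HNNExtension V A B φ)))
          else (F.comp A.subtype) a x) = ⟨t * (of (a : V) * x.1), h3⟩ := dif_pos h3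
      have e2 : (if h : t * x.1 ∈ ball φ ^ R then
          (⟨t * x.1, h⟩ : ↥(ball φ ^ R : Set (HNNExtension V A B φ))) else x) =
          ⟨t * x.1, hx⟩ := dif_pos hx
      refine e1.trans (Eq.trans ?_ (congrArg _ e2.symm))
      apply Subtype.ext
      change t * (of (a : V) * x.1) = of ((φ a : B) : V) * (t * x.1)
      rw [← mul_assoc, t_mul_of, mul_assoc])
  have h2' : ∀ (x : ↥(ball φ ^ R : Set (HNNExtension V A B φ))) (h : t * x.1 ∈ ball φ ^ R),
      τ x = ⟨t * x.1, h⟩ := by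
    intro x h
    rw [h2 x h, dif_pos h]
  let f := lift F τ (fun a => by
    ext x
    exact congrArg Subtype.val (h1 a x))
  have h1mem : ∀ n, (1 : HNNExtension V A B φ) ∈ ball φ ^ n := fun n =>
    Set.pow_subset_pow_right one_mem_ball (Nat.zero_le n) (by simp)
  have key : ∀ n (hn : n ≤ R) (h : HNNExtension V A B φ) (hh : h ∈ ball φ ^ n),
      f h ⟨1, h1mem R⟩ = ⟨h, ball_pow_mono hn hh⟩ := by
    intro n
    induction n with
    | zero =>
      intro _ h hh
      obtain rfl : h = 1 := by simpa using hh
      simp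
    | succ n ih =>
      intro hn h hh
      rw [pow_succ'] at hh
      obtain ⟨_, ⟨b, k, b', hk, rfl⟩, z, hz, rfl⟩ := hh
      have hzR := ball_pow_mono (show n ≤ R by lia) hz
      have hb'z := of_mul_mem_ball_pow hR hzR b'
      have hall : of b * t ^ k * of b' * z ∈ ball φ ^ R := by
        refine ball_pow_mono hn ?_
        rw [pow_succ']
        exact ⟨_, ⟨b, k, b', hk, rfl⟩, z, hz, rfl⟩
      have htk : t ^ k * (of b' * z) ∈ ball φ ^ R := by
        have := of_mul_mem_ball_pow hR hall b⁻¹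
        simpa [mul_assoc] using this
      have hfo : ∀ b, f (of b) = F b := fun b => lift_of _ _ _ _
      have hft : f t = τ := lift_t _ _ _
      have e1 : f (of b' * z) ⟨1, h1mem R⟩ = ⟨of b' * z, hb'z⟩ := by
        rw [map_mul, Perm.mul_apply, ih (by lia) z hz, hfo]
        rfl
      have e2 : f (t ^ k * (of b' * z)) ⟨1, h1mem R⟩ = ⟨t ^ k * (of b' * z), htk⟩ := by
        rw [map_mul, Perm.mul_apply, e1, map_zpow, hft]
        have hk' : k = 0 ∨ k = 1 ∨ k = -1 := by have := abs_le.1 hk; lia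
        rcases hk' with rfl | rfl | rfl
        · simp
        · rw [zpow_one, h2' _ (by simpa using htk)]
          simp
        · rw [zpow_neg_one, Perm.inv_eq_iff_eq]
          rw [h2' ⟨t ^ (-1 : ℤ) * (of b' * z), htk⟩ (by simpa using hb'z)]
          simp
      change f (of b * t ^ k * of b' * z) ⟨1, h1mem R⟩ = ⟨of b * t ^ k * of b' * z, _⟩
      have e3 : of b * t ^ k * of b' * z = of b * (t ^ k * (of b' * z)) := by group
      have e4 : f (of b * t ^ k * of b' * z) ⟨1, h1mem R⟩ =
          ⟨of b * (t ^ k * (of b' * z)), of_mul_mem_ball_pow hR htk b⟩ := by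
        rw [e3, map_mul, Perm.mul_apply, e2, hfo]
        rfl
      rw [e4]
      exact Subtype.ext e3.symm
  refine ⟨f, fun h hh hf => ?_⟩
  have := key R le_rfl h hh
  rw [hf] at this
  exact (congrArg Subtype.val this).symm

theorem exists_hom_perm [Finite V] {R Y : ℕ} (hR : 1 ≤ R) (hY : (3 * Nat.card V ^ 2) ^ R ≤ Y) :
    ∃ f : HNNExtension V A B φ →* Perm (Fin Y), ∀ h ∈ ball φ ^ R, f h = 1 → h = 1 := by
  classical
  obtain ⟨f, hf⟩ := exists_hom_perm_ball (φ := φ) hR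
  have hfin : Finite ↥(ball φ ^ R : Set (HNNExtension V A B φ)) := (finite_ball_pow R).1
  have := Fintype.ofFinite ↥(ball φ ^ R : Set (HNNExtension V A B φ))
  have hcard : Fintype.card ↥(ball φ ^ R : Set (HNNExtension V A B φ)) ≤ Fintype.card (Fin Y) := by
    rw [Fintype.card_fin, ← Nat.card_eq_fintype_card, Nat.card_coe_set_eq]
    exact (finite_ball_pow R).2.trans hY
  obtain ⟨i⟩ := Function.Embedding.nonempty_of_card_le hcard
  refine ⟨(Perm.viaEmbeddingHom i).comp f, fun h hh h1 => hf h hh ?_⟩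
  exact Perm.viaEmbeddingHom_injective i (h1.trans (map_one _).symm)

end HNNExtension

/-! ### HNN extensions attached to finite quotients of the free group on two generators -/

section ConjEquiv

variable {F : Type*} [Group F] (τ : F) {P V : Subgroup F} (h1 : P ≤ V)
  (h2 : P.map (MulAut.conj τ).toMonoidHom ≤ V)

/-- Conjugation between subgroups of a common overgroup. -/
noncomputable def conjEquiv :
    P.subgroupOf V ≃* (P.map (MulAut.conj τ).toMonoidHom).subgroupOf V :=
  (Subgroup.subgroupOfEquivOfLe h1).trans
    (((MulAut.conj τ).subgroupMap P).trans (Subgroup.subgroupOfEquivOfLe h2).symm)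

theorem coe_conjEquiv (x : P.subgroupOf V) :
    ((conjEquiv τ h1 h2 x : V) : F) = τ * ((x : V) : F) * τ⁻¹ := rfl

end ConjEquiv

namespace SnakeGroup

open HNNExtension

/-- The free group on two generators. -/
abbrev Fr : Type := FreeGroup Bool

/-- The stable letter. -/
def gt : Fr := FreeGroup.of true

/-- The base letter. -/
def ga : Fr := FreeGroup.of false

/-- The conjugates of the base letter. -/
def aI (i : ℕ) : Fr := gt ^ i * ga * (gt ^ i)⁻¹

theorem aI_zero : aI 0 = ga := by simp [aI]

theorem aI_succ (i : ℕ) : aI (i + 1) = gt * aI i * gt⁻¹ := by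
  rw [aI, aI, pow_succ']
  group

/-- The subgroup generated by the first conjugates of the base letter. -/
def PP (n : ℕ) : Subgroup Fr := Subgroup.closure {x | ∃ i < n, aI i = x}

theorem aI_mem {i n : ℕ} (h : i < n) : aI i ∈ PP n := Subgroup.subset_closure ⟨i, h, rfl⟩

theorem PP_mono {i n : ℕ} (h : i ≤ n) : PP i ≤ PP n :=
  Subgroup.closure_mono fun _ ⟨j, hj, hx⟩ => ⟨j, hj.trans_le h, hx⟩

theorem PP_zero : PP 0 = ⊥ := by
  simp [PP]

theorem conj_mem_PP {n : ℕ} {x : Fr} (h : x ∈ PP n) : gt * x * gt⁻¹ ∈ PP (n + 1) := by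
  have : PP n ≤ (PP (n + 1)).comap (MulAut.conj gt).toMonoidHom := by
    rw [PP, Subgroup.closure_le]
    rintro _ ⟨i, hi, rfl⟩
    change gt * aI i * gt⁻¹ ∈ PP (n + 1)
    rw [← aI_succ]
    exact aI_mem (by lia)
  exact this h

variable (M : Subgroup Fr) [M.Normal] (n : ℕ)

/-- The base group. -/
abbrev VV : Subgroup (Fr ⧸ M) := (PP (n + 1)).map (QuotientGroup.mk' M)

/-- The domain of conjugation by the stable letter. -/
abbrev AA : Subgroup (Fr ⧸ M) := (PP n).map (QuotientGroup.mk' M)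

theorem AA_le : AA M n ≤ VV M n := Subgroup.map_mono (PP_mono (by lia))

theorem map_AA_le :
    (AA M n).map (MulAut.conj (gt : Fr ⧸ M)).toMonoidHom ≤ VV M n := by
  rintro _ ⟨_, ⟨x, hx, rfl⟩, rfl⟩
  exact ⟨_, conj_mem_PP hx, rfl⟩

/-- The HNN extension. -/
abbrev HH : Type := HNNExtension (VV M n) ((AA M n).subgroupOf (VV M n))
  (((AA M n).map (MulAut.conj (gt : Fr ⧸ M)).toMonoidHom).subgroupOf (VV M n))
  (conjEquiv (gt : Fr ⧸ M) (AA_le M n) (map_AA_le M n))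

variable {n} in
/-- The image of an element of the free group in the base group. -/
def toV {x : Fr} (hx : x ∈ PP (n + 1)) : VV M n :=
  ⟨QuotientGroup.mk' M x, Subgroup.mem_map_of_mem _ hx⟩

theorem toV_congr {x y : Fr} {n : ℕ} (h : x = y) (hx : x ∈ PP (n + 1)) (hy : y ∈ PP (n + 1)) :
    toV M hx = toV M hy := by
  subst h
  rfl

/-- The quotient map onto the HNN extension. -/
noncomputable def rho : Fr →* HH M n :=
  FreeGroup.lift fun b => bif b then t else of (toV M (aI_mem (Nat.succ_pos n)))

@[simp] theorem rho_gt : rho M n gt = t := FreeGroup.lift_apply_of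

theorem rho_ga : rho M n ga = of (toV M (aI_mem (Nat.succ_pos n))) :=
  FreeGroup.lift_apply_of

variable {n}

theorem t_mul_of_toV {x : Fr} (hx : x ∈ PP n) :
    (t * of (toV M (PP_mono (Nat.le_succ n) hx)) * t⁻¹ : HH M n) = of (toV M (conj_mem_PP hx)) := by
  have h := t_mul_of (φ := conjEquiv (gt : Fr ⧸ M) (AA_le M n) (map_AA_le M n))
    ⟨toV M (PP_mono (Nat.le_succ n) hx), ⟨x, hx, rfl⟩⟩
  rw [mul_inv_eq_iff_eq_mul, h]
  rfl

theorem rho_aI {i : ℕ} (hi : i < n + 1) : rho M n (aI i) = of (toV M (aI_mem hi)) := by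
  induction i with
  | zero =>
    have : rho M n (aI 0) = rho M n ga := by rw [aI_zero]
    rw [this, rho_ga]
  | succ i ih =>
    have h1 := t_mul_of_toV M (aI_mem (show i < n by lia))
    have h2 : rho M n (aI (i + 1)) = t * rho M n (aI i) * t⁻¹ := by
      rw [aI_succ, map_mul, map_mul, map_inv, rho_gt]
    rw [h2, ih (by lia), h1]
    exact congrArg of (toV_congr M (aI_succ i).symm _ _)

theorem rho_of_mem {x : Fr} (hx : x ∈ PP (n + 1)) : rho M n x = of (toV M hx) := by
  induction hx using Subgroup.closure_induction with
  | mem x hx =>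
    obtain ⟨i, hi, rfl⟩ := hx
    exact rho_aI M hi
  | one => exact (map_one _).trans (map_one of).symm
  | mul x y hx hy ihx ihy =>
    rw [map_mul, ihx, ihy, ← map_mul]
    rfl
  | inv x hx ih =>
    rw [map_inv, ih, ← map_inv]
    rfl

theorem rho_surjective : Function.Surjective (rho M n) := by
  intro z
  induction z using HNNExtension.induction_on with
  | of v =>
    obtain ⟨_, x, hx, rfl⟩ := v
    exact ⟨x, rho_of_mem M hx⟩
  | t => exact ⟨gt, rho_gt M n⟩
  | mul x y hx hy =>
    obtain ⟨a, rfl⟩ := hx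
    obtain ⟨b, rfl⟩ := hy
    exact ⟨a * b, map_mul _ _ _⟩
  | inv x hx =>
    obtain ⟨a, rfl⟩ := hx
    exact ⟨a⁻¹, map_inv _ _⟩

theorem hom_ext {K : Type*} [Group K] {f g : Fr →* K} (h1 : f ga = g ga) (h2 : f gt = g gt) :
    f = g := by
  ext b
  cases b
  · exact h1
  · exact h2

/-- The HNN extension maps back onto the finite quotient. -/
noncomputable def toF : HH M n →* Fr ⧸ M :=
  lift (VV M n).subtype (gt : Fr ⧸ M) fun a => by
    have := coe_conjEquiv (gt : Fr ⧸ M) (AA_le M n) (map_AA_le M n) a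
    simp only [Subgroup.coe_subtype]
    rw [this, inv_mul_cancel_right]

theorem toF_rho : (toF M (n := n)).comp (rho M n) = QuotientGroup.mk' M := by
  refine hom_ext ?_ ?_
  · rw [MonoidHom.comp_apply, rho_ga, toF, lift_of]
    simp [toV, aI_zero]
  · rw [MonoidHom.comp_apply, rho_gt, toF, lift_t]
    rfl

theorem ker_rho_le : (rho M n).ker ≤ M := by
  intro x hx
  have := DFunLike.congr_fun (toF_rho M (n := n)) x
  rw [MonoidHom.comp_apply, hx, map_one] at this
  exact (QuotientGroup.eq_one_iff x).1 this.symm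

theorem rho_eq_one_iff {x : Fr} (hx : x ∈ PP (n + 1)) : rho M n x = 1 ↔ x ∈ M := by
  refine ⟨fun h => ker_rho_le M h, fun h => ?_⟩
  rw [rho_of_mem M hx]
  have : toV M hx = 1 := Subtype.ext ((QuotientGroup.eq_one_iff x).2 h)
  rw [this, map_one]

/-- The universal property of the HNN extension. -/
theorem exists_lift {K : Type*} [Group K] (f : Fr →* K) (hf : ∀ x ∈ M, x ∈ PP (n + 1) → f x = 1) :
    ∃ f' : HH M n →* K, f'.comp (rho M n) = f := by
  let q : PP (n + 1) →* VV M n := (QuotientGroup.mk' M).subgroupMap (PP (n + 1))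
  have hq : Function.Surjective q := (QuotientGroup.mk' M).subgroupMap_surjective _
  have hker : q.ker ≤ (f.comp (PP (n + 1)).subtype).ker := by
    rintro ⟨x, hx⟩ h
    refine hf x ((QuotientGroup.eq_one_iff x).1 ?_) hx
    exact congrArg Subtype.val h
  let f₀ := q.liftOfSurjective hq ⟨f.comp (PP (n + 1)).subtype, hker⟩
  have hf₀ : ∀ {x} (hx : x ∈ PP (n + 1)), f₀ (toV M hx) = f x := by
    intro x hx
    exact MonoidHom.liftOfRightInverse_comp_apply q _ _ ⟨f.comp (PP (n + 1)).subtype, hker⟩ ⟨x, hx⟩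
  refine ⟨lift f₀ (f gt) ?_, hom_ext ?_ ?_⟩
  · rintro ⟨⟨_, x', hx', rfl⟩, ⟨x, hx, hxx'⟩⟩
    have e : (⟨QuotientGroup.mk' M x', x', hx', rfl⟩ : VV M n) =
        toV M (PP_mono (Nat.le_succ n) hx) := Subtype.ext hxx'.symm
    have e2 : ∀ a : (AA M n).subgroupOf (VV M n), a.1 = toV M (PP_mono (Nat.le_succ n) hx) →
        (conjEquiv (gt : Fr ⧸ M) (AA_le M n) (map_AA_le M n) a : VV M n) =
          toV M (conj_mem_PP hx) := by
      intro a ha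
      apply Subtype.ext
      rw [coe_conjEquiv, ha]
      rfl
    rw [e2 _ e]
    simp only
    rw [e, hf₀, hf₀, map_mul, map_mul, map_inv, inv_mul_cancel_right]
  · rw [MonoidHom.comp_apply, rho_ga, lift_of, hf₀, aI_zero]
  · rw [MonoidHom.comp_apply, rho_gt, lift_t]

end SnakeGroup

/-! ### Positive words -/

section PositiveWords

variable {Γ K : Type*} [Group Γ] [Group K] {M : Subgroup Γ} [M.Normal] [M.FiniteIndex]

theorem exists_short_list {b : ℕ} (hb : Nat.card (Γ ⧸ M) ≤ b) {S : Set Γ} (l : List Γ)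
    (hl : ∀ x ∈ l, x ∈ S) :
    ∃ l' : List Γ, (∀ x ∈ l', x ∈ S) ∧ l'.length ≤ b ∧ (l'.prod : Γ ⧸ M) = l.prod := by
  induction h : l.length using Nat.strong_induction_on generalizing l with
  | _ n ih =>
    rcases le_or_gt n b with hn | hn
    · exact ⟨l, hl, h ▸ hn, rfl⟩
    have := Fintype.ofFinite (Γ ⧸ M)
    obtain ⟨i, j, hij, he⟩ := Fintype.exists_ne_map_eq_of_card_lt
      (fun i : Fin (b + 1) => ((l.take i).prod : Γ ⧸ M)) (by
        rw [Fintype.card_fin, ← Nat.card_eq_fintype_card]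
        lia)
    wlog hlt : i < j generalizing i j
    · exact this j i hij.symm he.symm (lt_of_le_of_ne (not_lt.1 hlt) hij.symm)
    have hlt' : (i : ℕ) < j := hlt
    obtain ⟨l', h1, h2, h3⟩ := ih (l.take i ++ l.drop j).length (by
      rw [List.length_append, List.length_take, List.length_drop]
      lia) (l.take i ++ l.drop j) (by
        intro x hx
        rcases List.mem_append.1 hx with hx | hx
        · exact hl x (List.mem_of_mem_take hx)
        · exact hl x (List.mem_of_mem_drop hx)) rfl
    refine ⟨l', h1, h2, h3.trans ?_⟩
    have e : l.prod = (l.take j).prod * (l.drop j).prod := by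
      rw [← List.prod_append, List.take_append_drop]
    rw [List.prod_append, e, QuotientGroup.mk_mul, QuotientGroup.mk_mul]
    exact congrArg (· * _) he

theorem exists_list_inv {S : Set Γ} (l : List Γ) (hl : ∀ x ∈ l, x ∈ S) :
    ∃ (l' : List Γ) (o : ℕ), (∀ x ∈ l', x ∈ S) ∧ l'.prod = l.prod ^ o ∧ l.prod ^ (o + 1) ∈ M := by
  have ho := orderOf_pos (l.prod : Γ ⧸ M)
  refine ⟨(List.replicate (orderOf (l.prod : Γ ⧸ M) - 1) l).flatten,
    orderOf (l.prod : Γ ⧸ M) - 1, ?_, ?_, ?_⟩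
  · intro x hx
    obtain ⟨l', hl', hx⟩ := List.mem_flatten.1 hx
    rw [List.eq_of_mem_replicate hl'] at hx
    exact hl x hx
  · rw [List.prod_flatten, List.map_replicate, List.prod_replicate]
  · rw [Nat.sub_add_cancel ho, ← QuotientGroup.eq_one_iff, QuotientGroup.mk_pow]
    exact pow_orderOf_eq_one _

theorem exists_short_list_inv {b : ℕ} (hb : Nat.card (Γ ⧸ M) ≤ b) {S : Set Γ} (l : List Γ)
    (hl : ∀ x ∈ l, x ∈ S) :
    ∃ l' : List Γ, (∀ x ∈ l', x ∈ S) ∧ l'.length ≤ b ∧ l.prod * l'.prod ∈ M := by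
  obtain ⟨l₁, o, h1, h2, h3⟩ := exists_list_inv (M := M) l hl
  obtain ⟨l', h4, h5, h6⟩ := exists_short_list hb l₁ h1
  refine ⟨l', h4, h5, ?_⟩
  rw [← QuotientGroup.eq_one_iff, QuotientGroup.mk_mul, h6, ← QuotientGroup.mk_mul,
    QuotientGroup.eq_one_iff, h2, ← pow_succ']
  exact h3

/-- A homomorphism that kills the short positive relators kills all relators. -/
theorem map_eq_one_of_short {b : ℕ} (hb : Nat.card (Γ ⧸ M) ≤ b) {S : Set Γ} (f : Γ →* K)
    (hf : ∀ l : List Γ, (∀ x ∈ l, x ∈ S) → l.length ≤ 2 * b + 1 → l.prod ∈ M → f l.prod = 1)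
    {x : Γ} (hx : x ∈ M) (hxS : x ∈ Subgroup.closure S) : f x = 1 := by
  have key : ∀ l : List Γ, (∀ x ∈ l, x ∈ S) → ∀ l' : List Γ, (∀ x ∈ l', x ∈ S) → l'.length ≤ b →
      (l.prod : Γ ⧸ M) = l'.prod → f l.prod = f l'.prod := by
    intro l
    induction l using List.reverseRecOn with
    | nil =>
      intro _ l' hl' hlen he
      rw [hf l' hl' (by lia) ((QuotientGroup.eq_one_iff _).1 (by rw [← he]; simp))]
      simp
    | append_singleton l₀ s ih =>
      intro hl l' hl' hlen he
      have hl₀ : ∀ x ∈ l₀, x ∈ S := fun x hx => hl x (List.mem_append_left _ hx)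
      obtain ⟨l₀', h1, h2, h3⟩ := exists_short_list hb l₀ hl₀
      obtain ⟨r, h4, h5, h6⟩ := exists_short_list_inv hb l' hl'
      have h7 := hf (l' ++ r) (by
        intro x hx
        rcases List.mem_append.1 hx with hx | hx
        · exact hl' x hx
        · exact h4 x hx) (by rw [List.length_append]; lia) (by rwa [List.prod_append])
      have h8 := hf (l₀' ++ [s] ++ r) (by
        intro x hx
        rcases List.mem_append.1 hx with hx | hx
        · rcases List.mem_append.1 hx with hx | hx
          · exact h1 x hx
          · exact hl x (List.mem_append_right _ hx)
        · exact h4 x hx) (by simp only [List.length_append, List.length_singleton]; lia) (by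
          rw [← QuotientGroup.eq_one_iff] at h6 ⊢
          rw [← h6, List.prod_append, List.prod_append, QuotientGroup.mk_mul,
            QuotientGroup.mk_mul, QuotientGroup.mk_mul, h3, ← he, List.prod_append,
            QuotientGroup.mk_mul])
      rw [List.prod_append, map_mul] at h7 h8
      rw [List.prod_append, map_mul] at h8
      rw [List.prod_append, map_mul, ih hl₀ l₀' h1 h2 h3.symm]
      exact mul_right_cancel (h8.trans h7.symm)
  have key2 : ∀ l : List Γ, (∀ x ∈ l, x ∈ S) → l.prod ∈ M → f l.prod = 1 := by
    intro l hl hM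
    rw [key l hl [] (by simp) (by simp) (by rw [(QuotientGroup.eq_one_iff _).2 hM]; simp)]
    simp
  obtain ⟨l, hl, h1, h2⟩ : ∃ l : List Γ, (∀ x ∈ l, x ∈ S) ∧ (l.prod : Γ ⧸ M) = x ∧
      f l.prod = f x := by
    clear hx
    induction hxS using Subgroup.closure_induction with
    | mem x hx => exact ⟨[x], by simpa using hx, by simp, by simp⟩
    | one => exact ⟨[], by simp, by simp, by simp⟩
    | mul x y _ _ ihx ihy =>
      obtain ⟨l, h1, h2, h3⟩ := ihx
      obtain ⟨l', h1', h2', h3'⟩ := ihy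
      refine ⟨l ++ l', ?_, ?_, ?_⟩
      · intro x hx
        rcases List.mem_append.1 hx with hx | hx
        · exact h1 x hx
        · exact h1' x hx
      · rw [List.prod_append, QuotientGroup.mk_mul, h2, h2', QuotientGroup.mk_mul]
      · rw [List.prod_append, map_mul, h3, h3', map_mul]
    | inv x _ ih =>
      obtain ⟨l, h1, h2, h3⟩ := ih
      obtain ⟨l', o, h4, h5, h6⟩ := exists_list_inv (M := M) l h1
      refine ⟨l', h4, ?_, ?_⟩
      · rw [QuotientGroup.mk_inv, ← h2, eq_inv_iff_mul_eq_one, ← QuotientGroup.mk_mul, h5,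
          ← pow_succ, QuotientGroup.eq_one_iff]
        exact h6
      · rw [map_inv, ← h3, eq_inv_iff_mul_eq_one, ← map_mul, h5, ← pow_succ]
        have := key2 (l' ++ l) (by
          intro x hx
          rcases List.mem_append.1 hx with hx | hx
          · exact h4 x hx
          · exact h1 x hx) (by rwa [List.prod_append, h5, ← pow_succ])
        rwa [List.prod_append, h5, ← pow_succ] at this
  rw [← h2]
  exact key2 l hl ((QuotientGroup.eq_one_iff _).1 (h1.trans ((QuotientGroup.eq_one_iff _).2 hx)))

end PositiveWords

/-! ### Intersections of kernels of permutation representations -/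

namespace SnakeGroup

open Equiv

/-- The homomorphisms to a symmetric group that kill a set of relators. -/
abbrev Homs (Y : ℕ) (S : Set Fr) : Type := {f : Fr →* Perm (Fin Y) // ∀ r ∈ S, f r = 1}

/-- The product of all the homomorphisms to a symmetric group that kill a set of relators. -/
def homsProd (Y : ℕ) (S : Set Fr) : Fr →* (Homs Y S → Perm (Fin Y)) :=
  MonoidHom.pi fun f => f.1

/-- The intersection of the kernels of the homomorphisms to a symmetric group that kill a set of
relators. -/
def MM (Y : ℕ) (S : Set Fr) : Subgroup Fr := (homsProd Y S).ker

instance (Y : ℕ) (S : Set Fr) : (MM Y S).Normal := by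
  unfold MM
  infer_instance

theorem mem_MM {Y : ℕ} {S : Set Fr} {x : Fr} :
    x ∈ MM Y S ↔ ∀ f : Fr →* Perm (Fin Y), (∀ r ∈ S, f r = 1) → f x = 1 := by
  rw [MM, MonoidHom.mem_ker, funext_iff]
  exact ⟨fun h f hf => h ⟨f, hf⟩, fun h f => h f.1 f.2⟩

/-- An upper bound for the index of `MM`. -/
def bnd (Y : ℕ) : ℕ := (Y ^ Y) ^ (Y ^ Y) ^ 2

theorem natCard_homs (Y : ℕ) : Nat.card (Fr →* Perm (Fin Y)) = Y.factorial ^ 2 := by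
  rw [← Nat.card_congr (FreeGroup.lift (α := Bool) (β := Perm (Fin Y))), Nat.card_fun,
    Nat.card_perm]
  simp

instance (Y : ℕ) : Finite (Fr →* Perm (Fin Y)) :=
  Finite.of_equiv _ (FreeGroup.lift (α := Bool) (β := Perm (Fin Y)))

instance (Y : ℕ) (S : Set Fr) : (MM Y S).FiniteIndex := by
  unfold MM
  infer_instance

theorem natCard_quotient_MM {Y : ℕ} (hY : 0 < Y) (S : Set Fr) :
    Nat.card (Fr ⧸ MM Y S) ≤ bnd Y := by
  have h1 : Nat.card (Fr ⧸ MM Y S) ≤ Nat.card (Homs Y S → Perm (Fin Y)) :=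
    Nat.card_le_card_of_injective _ (QuotientGroup.kerLift_injective (homsProd Y S))
  refine h1.trans ?_
  rw [Nat.card_fun, Nat.card_perm, Nat.card_fin]
  have h2 : Nat.card (Homs Y S) ≤ (Y ^ Y) ^ 2 := by
    refine (Nat.card_le_card_of_injective (Subtype.val : Homs Y S → _)
      Subtype.val_injective).trans ?_
    rw [natCard_homs]
    exact Nat.pow_le_pow_left (Nat.factorial_le_pow _) _
  exact (Nat.pow_le_pow_left (Nat.factorial_le_pow _) _).trans
    (Nat.pow_le_pow_right (by positivity) h2)

/-! ### Deciding membership -/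

/-- The action of a letter of a word on a point, where the tables of the four letters are read off
from the digits of `q`. -/
def act (Y q : ℕ) (l : Bool × Bool) (x : ℕ) : ℕ := q / Y ^ ((2 * l.1.toNat + l.2.toNat) * Y + x) % Y

/-- The action of a word on a point. -/
def run (Y q : ℕ) (w : List (Bool × Bool)) (x : ℕ) : ℕ := w.foldr (act Y q) x

/-- The tables describe permutations. -/
def Valid (Y q : ℕ) : Prop := ∀ l : Bool × Bool, ∀ x < Y, act Y q (l.1, !l.2) (act Y q l x) = x

/-- A word acts trivially. -/
def Kills (Y q : ℕ) (w : List (Bool × Bool)) : Prop := ∀ x < Y, run Y q w x = x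

/-- The combinatorial form of membership in `MM`. -/
def MemM (Y : ℕ) (r : List (List (Bool × Bool))) (w : List (Bool × Bool)) : Prop :=
  ∀ q < Y ^ (4 * Y), Valid Y q → (∀ v ∈ r, Kills Y q v) → Kills Y q w

theorem act_lt {Y q : ℕ} (hY : 0 < Y) (l : Bool × Bool) (x : ℕ) : act Y q l x < Y :=
  Nat.mod_lt _ hY

theorem coe_lift_mk {Y q : ℕ} (f : Fr →* Perm (Fin Y))
    (hf : ∀ l x, (f (FreeGroup.mk [l]) x : ℕ) = act Y q l x) (w : List (Bool × Bool)) (x : Fin Y) :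
    (f (FreeGroup.mk w) x : ℕ) = run Y q w x := by
  induction w with
  | nil =>
    have : (FreeGroup.mk [] : Fr) = 1 := rfl
    rw [this, map_one]
    rfl
  | cons l w ih =>
    have : (FreeGroup.mk (l :: w) : Fr) = FreeGroup.mk [l] * FreeGroup.mk w := by
      rw [FreeGroup.mul_mk]
      rfl
    rw [this, map_mul, Perm.mul_apply, hf, ih]
    rfl

theorem kills_iff {Y q : ℕ} (f : Fr →* Perm (Fin Y))
    (hf : ∀ l x, (f (FreeGroup.mk [l]) x : ℕ) = act Y q l x) (w : List (Bool × Bool)) :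
    Kills Y q w ↔ f (FreeGroup.mk w) = 1 := by
  constructor
  · intro h
    ext x
    rw [coe_lift_mk f hf, h x x.2]
    rfl
  · intro h x hx
    rw [← coe_lift_mk f hf w ⟨x, hx⟩, h]
    rfl

theorem mk_not (b s : Bool) : (FreeGroup.mk [(b, !s)] : Fr) = (FreeGroup.mk [(b, s)])⁻¹ := by
  rw [FreeGroup.inv_mk]
  rfl

theorem exists_hom_of_valid {Y q : ℕ} (h : Valid Y q) :
    ∃ f : Fr →* Perm (Fin Y), ∀ l x, (f (FreeGroup.mk [l]) x : ℕ) = act Y q l x := by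
  let g (b : Bool) : Perm (Fin Y) :=
    { toFun := fun x => ⟨act Y q (b, true) x, act_lt x.pos _ _⟩
      invFun := fun x => ⟨act Y q (b, false) x, act_lt x.pos _ _⟩
      left_inv := fun x => Fin.ext (h (b, true) x x.2)
      right_inv := fun x => Fin.ext (h (b, false) x x.2) }
  refine ⟨FreeGroup.lift g, ?_⟩
  rintro ⟨b, s⟩ x
  rw [FreeGroup.lift_mk]
  cases s
  · simp only [List.map_cons, List.map_nil, List.prod_singleton, cond_false]
    rfl
  · simp only [List.map_cons, List.map_nil, List.prod_singleton, cond_true]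
    rfl

theorem exists_table {Y : ℕ} (f : Fr →* Perm (Fin Y)) :
    ∃ q < Y ^ (4 * Y), Valid Y q ∧ ∀ l x, (f (FreeGroup.mk [l]) x : ℕ) = act Y q l x := by
  let F : Fin (4 * Y) → Fin Y := fun i =>
    have hY : 0 < Y := by have := i.2; lia
    f (FreeGroup.mk [(Nat.testBit (i / Y) 1, Nat.testBit (i / Y) 0)]) ⟨i % Y, Nat.mod_lt _ hY⟩
  suffices key : ∀ l x, (f (FreeGroup.mk [l]) x : ℕ) = act Y (finFunctionFinEquiv F) l x by
    refine ⟨finFunctionFinEquiv F, (finFunctionFinEquiv F).2, ?_, key⟩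
    rintro ⟨b, s⟩ x hx
    rw [← key (b, s) ⟨x, hx⟩, ← key, mk_not, map_inv]
    exact congrArg Fin.val ((f (FreeGroup.mk [(b, s)])).symm_apply_apply ⟨x, hx⟩)
  rintro ⟨b, s⟩ x
  have hi : (2 * b.toNat + s.toNat) * Y + x < 4 * Y := by
    have := x.2
    cases b <;> cases s <;> simp only [Bool.toNat_true, Bool.toNat_false] <;> lia
  have h1 : F ⟨_, hi⟩ = f (FreeGroup.mk [(b, s)]) x := by
    have h2 : ((2 * b.toNat + s.toNat) * Y + x) / Y = 2 * b.toNat + s.toNat := by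
      rw [mul_comm, Nat.mul_add_div x.pos, Nat.div_eq_of_lt x.2, add_zero]
    have h3 : ((2 * b.toNat + s.toNat) * Y + x) % Y = x := by
      rw [mul_comm, Nat.mul_add_mod, Nat.mod_eq_of_lt x.2]
    simp only [F, h2, h3]
    cases b <;> cases s <;> rfl
  have h4 := congrFun (finFunctionFinEquiv.symm_apply_apply F) ⟨_, hi⟩
  rw [← h1, ← h4]
  rfl

theorem memM_iff {Y : ℕ} {r : List (List (Bool × Bool))} {w : List (Bool × Bool)} :
    MemM Y r w ↔ FreeGroup.mk w ∈ MM Y {x | ∃ v ∈ r, FreeGroup.mk v = x} := by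
  rw [mem_MM]
  constructor
  · intro h f hf
    obtain ⟨q, hq, hv, hqf⟩ := exists_table f
    refine (kills_iff f hqf w).1 (h q hq hv fun v hv => ?_)
    exact (kills_iff f hqf v).2 (hf _ ⟨v, hv, rfl⟩)
  · intro h q hq hv hr
    obtain ⟨f, hf⟩ := exists_hom_of_valid hv
    refine (kills_iff f hf w).2 (h f ?_)
    rintro _ ⟨v, hv, rfl⟩
    exact (kills_iff f hf v).1 (hr v hv)

end SnakeGroup

/-! ### The sequence of finite quotients -/

namespace SnakeGroup

open Equiv HNNExtension
open scoped Pointwise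

/-- The word representing `aI i`. -/
def aW (i : ℕ) : List (Bool × Bool) :=
  List.replicate i (true, true) ++ (false, true) :: List.replicate i (true, false)

/-- The word representing a product of elements of the form `aI i`. -/
def pw (l : List ℕ) : List (Bool × Bool) := l.flatMap aW

theorem mk_append (v w : List (Bool × Bool)) :
    (FreeGroup.mk (v ++ w) : Fr) = FreeGroup.mk v * FreeGroup.mk w :=
  FreeGroup.mul_mk.symm

theorem mk_replicate (i : ℕ) (l : Bool × Bool) :
    (FreeGroup.mk (List.replicate i l) : Fr) = FreeGroup.mk [l] ^ i := by
  induction i with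
  | zero => rfl
  | succ i ih => rw [List.replicate_succ', mk_append, ih, pow_succ]

theorem mk_true_false : (FreeGroup.mk [(true, false)] : Fr) = gt⁻¹ := mk_not true true

theorem mk_aW (i : ℕ) : FreeGroup.mk (aW i) = aI i := by
  rw [aW, mk_append, ← List.singleton_append, mk_append, mk_replicate, mk_replicate,
    mk_true_false, inv_pow, ← mul_assoc]
  rfl

theorem mk_pw (l : List ℕ) : FreeGroup.mk (pw l) = (l.map aI).prod := by
  induction l with
  | nil => rfl
  | cons i l ih =>
    rw [pw, List.flatMap_cons, mk_append, mk_aW, List.map_cons, List.prod_cons, ← ih]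
    rfl

/-- The list of the first `ℓ` digits of `q` in base `n + 1`. -/
def digs (n ℓ q : ℕ) : List ℕ := (List.range ℓ).map fun j => q / (n + 1) ^ j % (n + 1)

/-- The positive words of length at most `L` in the elements `aI i` with `i ≤ n`. -/
def candidates (n L : ℕ) : List (List (Bool × Bool)) :=
  (List.range (L + 1)).flatMap fun ℓ => (List.range ((n + 1) ^ ℓ)).map fun q => pw (digs n ℓ q)

theorem mem_candidates {n L : ℕ} {w : List (Bool × Bool)} :
    w ∈ candidates n L ↔ ∃ l : List ℕ, (∀ i ∈ l, i < n + 1) ∧ l.length ≤ L ∧ pw l = w := by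
  simp only [candidates, List.mem_flatMap, List.mem_range, List.mem_map]
  constructor
  · rintro ⟨ℓ, hℓ, q, hq, rfl⟩
    refine ⟨_, ?_, ?_, rfl⟩
    · simp only [digs, List.mem_map]
      rintro _ ⟨j, _, rfl⟩
      exact Nat.mod_lt _ (Nat.succ_pos n)
    · simp only [digs, List.length_map, List.length_range]
      lia
  · rintro ⟨l, hl, hL, rfl⟩
    let F : Fin l.length → Fin (n + 1) := fun i => ⟨l[i], hl _ (List.getElem_mem _)⟩
    refine ⟨l.length, by lia, finFunctionFinEquiv F, (finFunctionFinEquiv F).2, congrArg pw ?_⟩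
    refine List.ext_getElem (by simp [digs]) fun i h1 h2 => ?_
    have h4 := congrFun (finFunctionFinEquiv.symm_apply_apply F) ⟨i, h2⟩
    have h5 := congrArg Fin.val h4
    simp only [digs, List.getElem_map, List.getElem_range]
    exact h5

instance (Y q : ℕ) : Decidable (Valid Y q) := by
  unfold Valid
  infer_instance

instance (Y q : ℕ) (w : List (Bool × Bool)) : Decidable (Kills Y q w) := by
  unfold Kills
  infer_instance

instance (Y : ℕ) (r : List (List (Bool × Bool))) : DecidablePred (MemM Y r) := fun w => by
  unfold MemM
  infer_instance

/-- The number of labels that occur in the pumping argument. -/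
def KK (n Y : ℕ) : ℕ := 2 * (n ^ 3 + 1) ^ ((2 * n + 1) * bnd Y)

/-- The radius of the ball on which the next quotient is faithful. -/
def RR (n Y : ℕ) : ℕ := KK n Y * (n + 3 * KK n Y) + 2 * KK n Y + n + 4

/-- The degree of the symmetric groups and the list of relators. -/
def stage : ℕ → ℕ × List (List (Bool × Bool))
  | 0 => (2, [[(true, true)], [(false, true), (false, true)]])
  | n + 1 => ((stage n).1 + (3 * bnd (stage n).1 ^ 2) ^ RR n (stage n).1,
      (candidates n (2 * bnd (stage n).1 + 1)).filter fun w => MemM (stage n).1 (stage n).2 w)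

/-- The degree of the symmetric groups. -/
def Yv (n : ℕ) : ℕ := (stage n).1

/-- The sequence of normal subgroups. -/
def MS (n : ℕ) : Subgroup Fr := MM (Yv n) {x | ∃ v ∈ (stage n).2, FreeGroup.mk v = x}

instance (n : ℕ) : (MS n).Normal := by
  unfold MS
  infer_instance

instance (n : ℕ) : (MS n).FiniteIndex := by
  unfold MS
  infer_instance

theorem Yv_succ (n : ℕ) : Yv (n + 1) = Yv n + (3 * bnd (Yv n) ^ 2) ^ RR n (Yv n) := rfl

theorem Yv_pos (n : ℕ) : 0 < Yv n := by
  induction n with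
  | zero => exact Nat.two_pos
  | succ n ih =>
    rw [Yv_succ]
    lia

theorem natCard_quotient_MS (n : ℕ) : Nat.card (Fr ⧸ MS n) ≤ bnd (Yv n) :=
  natCard_quotient_MM (Yv_pos n) _

theorem mem_stage_succ {n : ℕ} {w : List (Bool × Bool)} : w ∈ (stage (n + 1)).2 ↔
    w ∈ candidates n (2 * bnd (Yv n) + 1) ∧ FreeGroup.mk w ∈ MS n := by
  rw [MS, Yv, ← memM_iff]
  simp only [stage, List.mem_filter, decide_eq_true_eq]

theorem map_eq_one_of_stage {n : ℕ} {K : Type*} [Group K] (f : Fr →* K)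
    (hf : ∀ v ∈ (stage (n + 1)).2, f (FreeGroup.mk v) = 1) {x : Fr} (hx : x ∈ MS n)
    (hxP : x ∈ PP (n + 1)) : f x = 1 := by
  refine map_eq_one_of_short (natCard_quotient_MS n) f ?_ hx hxP
  intro l hl hlen hM
  suffices key : ∃ l' : List ℕ, (∀ i ∈ l', i < n + 1) ∧ l'.map aI = l by
    obtain ⟨l', h1, rfl⟩ := key
    rw [← mk_pw] at hM ⊢
    exact hf _ (mem_stage_succ.2 ⟨mem_candidates.2 ⟨l', h1, by simpa using hlen, rfl⟩, hM⟩)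
  clear hlen hM
  induction l with
  | nil => exact ⟨[], by simp, rfl⟩
  | cons y l ih =>
    obtain ⟨l', h1, h2⟩ := ih fun x hx => hl x (List.mem_cons_of_mem _ hx)
    obtain ⟨i, hi, h3⟩ := hl y List.mem_cons_self
    refine ⟨i :: l', ?_, by rw [List.map_cons, h2, h3]⟩
    intro j hj
    rcases List.mem_cons.1 hj with rfl | hj
    · exact hi
    · exact h1 j hj

theorem map_eq_one_of_mem_MS_succ {n : ℕ} (f : Fr →* Perm (Fin (Yv (n + 1))))
    (hf : ∀ x ∈ MS n, x ∈ PP (n + 1) → f x = 1) {x : Fr} (hx : x ∈ MS (n + 1)) : f x = 1 := by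
  refine mem_MM.1 hx f ?_
  rintro _ ⟨v, hv, rfl⟩
  obtain ⟨h1, h2⟩ := mem_stage_succ.1 hv
  refine hf _ h2 ?_
  obtain ⟨l, hl, -, rfl⟩ := mem_candidates.1 h1
  rw [mk_pw]
  refine Subgroup.list_prod_mem _ fun y hy => ?_
  obtain ⟨i, hi, rfl⟩ := List.mem_map.1 hy
  exact aI_mem (hl i hi)

theorem mem_MS_succ {n : ℕ} {x : Fr} (hx : x ∈ MS n) (hxP : x ∈ PP (n + 1)) : x ∈ MS (n + 1) :=
  mem_MM.2 fun f hf => map_eq_one_of_stage f (fun v hv => hf _ ⟨v, hv, rfl⟩) hx hxP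

theorem MS_succ_le (n : ℕ) : MS (n + 1) ≤ MS n := by
  intro x hx
  refine mem_MM.2 fun f hf => ?_
  have hle : Yv n ≤ Yv (n + 1) := by
    rw [Yv_succ]
    lia
  have hinj := Perm.viaEmbeddingHom_injective (Fin.castLEEmb hle)
  have h := map_eq_one_of_mem_MS_succ
    ((Perm.viaEmbeddingHom (Fin.castLEEmb hle)).comp f) (fun y hy _ => by
      rw [MonoidHom.comp_apply, mem_MM.1 hy f hf, map_one]) hx
  rw [MonoidHom.comp_apply] at h
  exact hinj (h.trans (map_one _).symm)

theorem MS_antitone : Antitone MS := antitone_nat_of_succ_le MS_succ_le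

/-- The sequence of quotient maps. -/
noncomputable abbrev rhoS (n : ℕ) : Fr →* HH (MS n) n := rho (MS n) n

theorem ker_rhoS_le_succ (n : ℕ) : (rhoS n).ker ≤ (rhoS (n + 1)).ker := by
  obtain ⟨f, hf⟩ := exists_lift (MS n) (n := n) (rhoS (n + 1)) fun x hx hxP =>
    (rho_eq_one_iff _ (PP_mono (Nat.le_succ _) hxP)).2 (mem_MS_succ hx hxP)
  intro x hx
  rw [MonoidHom.mem_ker, ← hf, MonoidHom.comp_apply, hx, map_one]

theorem ker_rhoS_mono : Monotone fun n => (rhoS n).ker := monotone_nat_of_le_succ ker_rhoS_le_succ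

theorem four_le_RR (n Y : ℕ) : 4 ≤ RR n Y := by
  unfold RR
  lia

instance (n : ℕ) : Finite (VV (MS n) n) := inferInstance

theorem natCard_VV (n : ℕ) : Nat.card (VV (MS n) n) ≤ bnd (Yv n) :=
  (Subgroup.card_le_card_group _).trans (natCard_quotient_MS n)

theorem rhoS_eq_one_of_mem_MS_succ {n : ℕ} {x : Fr} (hx : x ∈ MS (n + 1))
    (hb : rhoS n x ∈ ball _ ^ RR n (Yv n)) : rhoS n x = 1 := by
  obtain ⟨f, hf⟩ := exists_hom_perm (φ := conjEquiv (gt : Fr ⧸ MS n) (AA_le (MS n) n)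
    (map_AA_le (MS n) n)) (R := RR n (Yv n)) (Y := Yv (n + 1))
    (by have := four_le_RR n (Yv n); lia) (by
      rw [Yv_succ]
      refine le_trans (Nat.pow_le_pow_left ?_ _) (Nat.le_add_left _ _)
      exact Nat.mul_le_mul_left _ (Nat.pow_le_pow_left (natCard_VV n) _))
  refine hf _ hb ?_
  refine map_eq_one_of_mem_MS_succ (f.comp (rhoS n)) (fun y hy hyP => ?_) hx
  rw [MonoidHom.comp_apply, (rho_eq_one_iff _ hyP).2 hy, map_one]

/-- The normal subgroup of relations of the limit group. -/
def NI : Subgroup Fr where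
  carrier := {x | ∃ n, rhoS n x = 1}
  one_mem' := ⟨0, map_one _⟩
  mul_mem' := by
    rintro x y ⟨n, hn⟩ ⟨k, hk⟩
    refine ⟨max n k, ?_⟩
    rw [map_mul, MonoidHom.mem_ker.1 (ker_rhoS_mono (le_max_left n k) hn),
      MonoidHom.mem_ker.1 (ker_rhoS_mono (le_max_right n k) hk), one_mul]
  inv_mem' := by
    rintro x ⟨n, hn⟩
    exact ⟨n, by rw [map_inv, hn, inv_one]⟩

instance : NI.Normal where
  conj_mem := by
    rintro x ⟨n, hn⟩ g
    exact ⟨n, by rw [map_mul, map_mul, map_inv, hn, mul_one, mul_inv_cancel]⟩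

theorem rhoS_eq_one {n : ℕ} {x : Fr} (hx : x ∈ NI) (hb : rhoS n x ∈ ball _ ^ RR n (Yv n)) :
    rhoS n x = 1 := by
  obtain ⟨k, hk⟩ := hx
  have h1 := ker_rho_le _ (ker_rhoS_mono (le_max_left k (n + 1)) hk)
  exact rhoS_eq_one_of_mem_MS_succ (MS_antitone (le_max_right k (n + 1)) h1) hb

theorem mem_NI_iff {n : ℕ} {x : Fr} (hx : x ∈ PP (n + 1)) : x ∈ NI ↔ x ∈ MS n := by
  rw [← rho_eq_one_iff (MS n) hx]
  refine ⟨fun h => rhoS_eq_one h ?_, fun h => ⟨n, h⟩⟩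
  rw [rhoS, rho_of_mem _ hx]
  have h := ball_pow_mono (φ := conjEquiv (gt : Fr ⧸ MS n) (AA_le (MS n) n)
    (map_AA_le (MS n) n)) (show 1 ≤ RR n (Yv n) by have := four_le_RR n (Yv n); lia)
  rw [pow_one] at h
  exact h (of_mem_ball _)

end SnakeGroup

/-! ### The limit group -/

namespace HNNExtension

variable {V : Type*} [Group V] {A B : Subgroup V} {φ : A ≃* B}

theorem mem_of_t_mul_of_mul_inv {v u : V} (h : (t * of v * t⁻¹ : HNNExtension V A B φ) = of u) :
    v ∈ A := by
  by_contra hv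
  let w : NormalWord.ReducedWord V A B :=
    { head := 1
      toList := [(1, v), (-1, 1)]
      chain := by simpa using hv }
  have := ReducedWord.toList_eq_nil_of_mem_of_range φ w
    ⟨u, by simp [← h, w, NormalWord.ReducedWord.prod, mul_assoc]⟩
  exact List.cons_ne_nil _ _ this

end HNNExtension

namespace SnakeGroup

open Equiv HNNExtension
open scoped Pointwise

/-- The limit group. -/
abbrev GG : Type := Fr ⧸ NI

/-- The height homomorphism on the free group. -/
def htF : Fr →* Multiplicative ℤ := FreeGroup.lift fun b => bif b then Multiplicative.ofAdd 1 else 1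

theorem htF_gt : htF gt = Multiplicative.ofAdd 1 := FreeGroup.lift_apply_of

theorem htF_ga : htF ga = 1 := FreeGroup.lift_apply_of

theorem htF_rho (n : ℕ) (x : Fr) : ht 1 (rhoS n x) = (htF x).toAdd := by
  have : (lift (1 : VV (MS n) n →* Multiplicative ℤ) (Multiplicative.ofAdd ((1 : ℤˣ) : ℤ))
      (by simp)).comp (rhoS n) = htF := by
    refine hom_ext ?_ ?_
    · rw [MonoidHom.comp_apply, rho_ga, lift_of, htF_ga, MonoidHom.one_apply]
    · rw [MonoidHom.comp_apply, rho_gt, lift_t, htF_gt]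
      rfl
  rw [← this]
  rfl

theorem htF_eq_one_of_mem_NI {x : Fr} (hx : x ∈ NI) : htF x = 1 := by
  obtain ⟨n, hn⟩ := hx
  have := htF_rho n x
  rw [hn, ht_one] at this
  exact this.symm

/-- The height homomorphism on the limit group. -/
def htG : GG →* Multiplicative ℤ := QuotientGroup.lift NI htF fun _ hx => htF_eq_one_of_mem_NI hx

/-- The map from the HNN extensions to the limit group. -/
theorem exists_piS (n : ℕ) : ∃ f : HH (MS n) n →* GG, f.comp (rhoS n) = QuotientGroup.mk' NI :=
  exists_lift (MS n) (QuotientGroup.mk' NI) fun _ hx hxP =>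
    (QuotientGroup.eq_one_iff _).2 ((mem_NI_iff hxP).2 hx)

/-- The map from the HNN extensions to the limit group. -/
noncomputable def piS (n : ℕ) : HH (MS n) n →* GG := (exists_piS n).choose

theorem piS_rho (n : ℕ) (x : Fr) : piS n (rhoS n x) = x :=
  DFunLike.congr_fun (exists_piS n).choose_spec x

theorem htG_piS (n : ℕ) (x : HH (MS n) n) : (htG (piS n x)).toAdd = ht 1 x := by
  obtain ⟨x, rfl⟩ := rho_surjective _ x
  rw [htF_rho, piS_rho]
  rfl

theorem piS_injOn {n : ℕ} {x : HH (MS n) n} (hx : x ∈ ball _ ^ RR n (Yv n)) (h : piS n x = 1) :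
    x = 1 := by
  obtain ⟨x, rfl⟩ := rho_surjective _ x
  rw [piS_rho, QuotientGroup.eq_one_iff] at h
  exact rhoS_eq_one h hx

/-! ### The limit group is not virtually free -/

/-- The images of the subgroups `PP n`. -/
def PG (n : ℕ) : Subgroup GG := (PP n).map (QuotientGroup.mk' NI)

theorem PG_mono {i n : ℕ} (h : i ≤ n) : PG i ≤ PG n := Subgroup.map_mono (PP_mono h)

theorem PG_succ_eq (n : ℕ) : PG (n + 1) = ((piS n).comp of).range := by
  ext x
  constructor
  · rintro ⟨x, hx, rfl⟩
    refine ⟨toV _ hx, ?_⟩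
    rw [MonoidHom.comp_apply, ← rho_of_mem, piS_rho]
    rfl
  · rintro ⟨⟨_, x, hx, rfl⟩, rfl⟩
    refine ⟨x, hx, ?_⟩
    rw [QuotientGroup.mk'_apply, ← piS_rho n, rhoS, rho_of_mem _ hx]
    rfl

instance (n : ℕ) : Finite (PG n) := by
  have : Finite (PG (n + 1)) := by
    rw [PG_succ_eq]
    exact Finite.of_surjective _ ((piS n).comp of).rangeRestrict_surjective
  exact Finite.of_injective _ (Subgroup.inclusion_injective (PG_mono (Nat.le_succ n)))

theorem mk_mem_PG {n : ℕ} {x : Fr} : (x : GG) ∈ PG n ↔ ∃ p ∈ PP n, p⁻¹ * x ∈ NI := by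
  constructor
  · rintro ⟨p, hp, h⟩
    exact ⟨p, hp, QuotientGroup.eq.1 h⟩
  · rintro ⟨p, hp, h⟩
    exact ⟨p, hp, QuotientGroup.eq.2 h⟩

theorem aI_notMem_PG (n : ℕ) : (aI n : GG) ∉ PG n := by
  induction n with
  | zero =>
    rw [mk_mem_PG]
    rintro ⟨p, hp, h⟩
    have hp' : p = 1 := by
      rw [PP_zero] at hp
      exact hp
    rw [hp', inv_one, one_mul, mem_NI_iff (n := 0) (aI_mem Nat.one_pos), aI_zero] at h
    let f : Fr →* Perm (Fin 2) := FreeGroup.lift fun b => bif b then 1 else swap 0 1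
    have h1 : f ga = swap 0 1 := FreeGroup.lift_apply_of
    have h2 : f gt = 1 := FreeGroup.lift_apply_of
    have := mem_MM.1 h f (by
      rintro _ ⟨v, hv, rfl⟩
      have hv' : v = [(true, true)] ∨ v = [(false, true), (false, true)] := by simpa [stage] using hv
      rcases hv' with rfl | rfl
      · exact h2
      · have : f (ga * ga) = 1 := by rw [map_mul, h1, swap_mul_self]
        exact this)
    exact absurd (DFunLike.congr_fun (h1.symm.trans this) (0 : Fin 2)) (by decide)
  | succ n ih =>
    contrapose! ih
    obtain ⟨p, hp, h⟩ := mk_mem_PG.1 ih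
    have h1 : rhoS n (aI (n + 1)) = t * of (toV (MS n) (aI_mem (Nat.lt_succ_self n))) * t⁻¹ := by
      rw [aI_succ, map_mul, map_mul, map_inv, rhoS, rho_gt, ← rho_aI _ (Nat.lt_succ_self n)]
    have h2 : rhoS n (p⁻¹ * aI (n + 1)) = 1 := by
      refine rhoS_eq_one h ?_
      rw [map_mul, map_inv, h1, rhoS, rho_of_mem _ hp, ← map_inv]
      refine ball_pow_mono (four_le_RR n (Yv n)) ?_
      have ht : (t : HH (MS n) n) ∈ ball _ ^ 1 := by
        have := zpow_mem_ball_pow (φ := conjEquiv (gt : Fr ⧸ MS n) (AA_le (MS n) n)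
          (map_AA_le (MS n) n)) 1
        rwa [zpow_one] at this
      have ho (v : VV (MS n) n) : (of v : HH (MS n) n) ∈ ball _ ^ 1 := by
        rw [pow_one]
        exact of_mem_ball v
      exact mul_mem_ball_pow (ho _)
        (mul_mem_ball_pow (mul_mem_ball_pow ht (ho _)) (inv_mem_ball_pow ht))
    rw [map_mul, map_inv, inv_mul_eq_one, h1, rhoS, rho_of_mem _ hp] at h2
    obtain ⟨q, hq, h3⟩ := mem_of_t_mul_of_mul_inv h2.symm
    refine mk_mem_PG.2 ⟨q, hq, ?_⟩
    rw [mem_NI_iff (Subgroup.mul_mem _ (Subgroup.inv_mem _ (PP_mono (Nat.le_succ n) hq))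
      (aI_mem (Nat.lt_succ_self n)))]
    exact QuotientGroup.eq.1 h3

theorem natCard_PG (n : ℕ) : n < Nat.card (PG n) := by
  induction n with
  | zero => exact Nat.card_pos
  | succ n ih =>
    refine (Nat.succ_le_of_lt ih).trans_lt ?_
    refine Set.ncard_lt_ncard (s := (PG n : Set GG)) (t := PG (n + 1)) ?_ 
      (Set.finite_coe_iff.1 (inferInstanceAs (Finite (PG (n + 1)))))
    refine ⟨PG_mono (Nat.le_succ n), fun h => aI_notMem_PG n (h ?_)⟩
    exact ⟨_, aI_mem (Nat.lt_succ_self n), rfl⟩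

theorem not_virtuallyFree : ¬ ∃ H : Subgroup GG, H.FiniteIndex ∧ IsFreeGroup H := by
  rintro ⟨H, hH, hfree⟩
  have htf : ∀ x ∈ H, IsOfFinOrder x → x = 1 := by
    intro x hx hfin
    have h1 : IsOfFinOrder (⟨x, hx⟩ : H) := by
      rwa [← Submonoid.isOfFinOrder_coe]
    have h2 := (IsFreeGroup.toFreeGroup H).toMonoidHom.isOfFinOrder h1
    have h3 := h2.eq_one'
    have h4 := (IsFreeGroup.toFreeGroup H).injective (h3.trans (map_one _).symm)
    exact congrArg Subtype.val h4
  have hcard := natCard_PG (Nat.card (GG ⧸ H))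
  have hfq : Finite (GG ⧸ H) := inferInstance
  refine absurd (Nat.card_le_card_of_injective
    (fun x : PG (Nat.card (GG ⧸ H)) => ((x : GG) : GG ⧸ H)) ?_) (not_le.2 hcard)
  intro x y hxy
  have h1 := QuotientGroup.eq.1 hxy
  have h2 := htf _ h1 (by
    have : IsOfFinOrder (x⁻¹ * y) := isOfFinOrder_of_finite _
    exact (Submonoid.isOfFinOrder_coe (x := x⁻¹ * y)).2 this)
  exact Subtype.ext (inv_mul_eq_one.1 h2)

end SnakeGroup

/-! ### Words in the limit group -/

namespace SnakeGroup

open HNNExtension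
open scoped Pointwise

/-- The height of an element of the free group. -/
def hF (x : Fr) : ℤ := (htF x).toAdd

theorem hF_mul (x y : Fr) : hF (x * y) = hF x + hF y := by
  rw [hF, map_mul]
  rfl

theorem hF_inv (x : Fr) : hF x⁻¹ = -hF x := by
  rw [hF, map_inv]
  rfl

theorem hF_gt : hF gt = 1 := by
  rw [hF, htF_gt]
  rfl

theorem hF_ga : hF ga = 0 := by
  rw [hF, htF_ga]
  rfl

theorem mk_cons (l : Bool × Bool) (w : List (Bool × Bool)) :
    (FreeGroup.mk (l :: w) : Fr) = FreeGroup.mk [l] * FreeGroup.mk w := mk_append [l] w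

theorem exists_mem_PP_letter (l : Bool × Bool) (i : ℕ) :
    ∃ p ∈ PP (i + 1), gt ^ i * FreeGroup.mk [l] = p * gt ^ ((i : ℤ) + hF (FreeGroup.mk [l])) := by
  have h1 : FreeGroup.mk [(true, true)] = gt := rfl
  have h2 : FreeGroup.mk [(false, true)] = ga := rfl
  have h3 : FreeGroup.mk [(true, false)] = gt⁻¹ := mk_not true true
  have h4 : FreeGroup.mk [(false, false)] = ga⁻¹ := mk_not false true
  rcases l with ⟨_ | _, _ | _⟩
  · refine ⟨(aI i)⁻¹, Subgroup.inv_mem _ (aI_mem (Nat.lt_succ_self i)), ?_⟩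
    rw [h4, hF_inv, hF_ga, aI, neg_zero, add_zero, zpow_natCast]
    group
  · refine ⟨aI i, aI_mem (Nat.lt_succ_self i), ?_⟩
    rw [h2, hF_ga, aI, add_zero, zpow_natCast]
    group
  · refine ⟨1, one_mem _, ?_⟩
    rw [h3, hF_inv, hF_gt, zpow_add, zpow_natCast, one_mul, zpow_neg, zpow_one]
  · refine ⟨1, one_mem _, ?_⟩
    rw [h1, hF_gt, zpow_add, zpow_natCast, one_mul, zpow_one]

theorem hF_letter (l : Bool × Bool) : |hF (FreeGroup.mk [l])| ≤ 1 := by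
  have h1 : FreeGroup.mk [(true, true)] = gt := rfl
  have h2 : FreeGroup.mk [(false, true)] = ga := rfl
  have h3 : FreeGroup.mk [(true, false)] = gt⁻¹ := mk_not true true
  have h4 : FreeGroup.mk [(false, false)] = ga⁻¹ := mk_not false true
  rcases l with ⟨_ | _, _ | _⟩
  · rw [h4, hF_inv, hF_ga]; simp
  · rw [h2, hF_ga]; simp
  · rw [h3, hF_inv, hF_gt]; simp
  · rw [h1, hF_gt]; simp

theorem abs_hF_mk_le (w : List (Bool × Bool)) : |hF (FreeGroup.mk w)| ≤ w.length := by
  induction w with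
  | nil => exact (abs_zero (α := ℤ)).le
  | cons l w ih =>
    rw [mk_cons, hF_mul, List.length_cons]
    have := hF_letter l
    have := abs_add_le (hF (FreeGroup.mk [l])) (hF (FreeGroup.mk w))
    push_cast
    lia

theorem exists_mem_PP (w : List (Bool × Bool)) {i : ℕ} (hi : w.length ≤ i) :
    ∃ p ∈ PP (i + w.length + 1),
      gt ^ i * FreeGroup.mk w = p * gt ^ ((i : ℤ) + hF (FreeGroup.mk w)) := by
  induction w generalizing i with
  | nil =>
    refine ⟨1, one_mem _, ?_⟩
    have h : hF (FreeGroup.mk []) = 0 := rfl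
    have h' : (FreeGroup.mk [] : Fr) = 1 := rfl
    rw [h, h', add_zero, zpow_natCast, mul_one, one_mul]
  | cons l w ih =>
    rw [List.length_cons] at hi
    obtain ⟨p, hp, h1⟩ := exists_mem_PP_letter l i
    obtain ⟨h2, h2'⟩ := abs_le.1 (hF_letter l)
    obtain ⟨j, hj⟩ : ∃ j : ℕ, (j : ℤ) = i + hF (FreeGroup.mk [l]) :=
      ⟨((i : ℤ) + hF (FreeGroup.mk [l])).toNat, by lia⟩
    obtain ⟨q, hq, h3⟩ := ih (i := j) (by lia)
    refine ⟨p * q, mul_mem (PP_mono ?_ hp) (PP_mono ?_ hq), ?_⟩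
    · rw [List.length_cons]
      lia
    · rw [List.length_cons]
      lia
    · rw [mk_cons, ← mul_assoc, h1, ← hj, zpow_natCast, mul_assoc, h3, hF_mul, ← add_assoc, ← hj,
        mul_assoc]

/-! ### The word problem -/

/-- The number of occurrences of a letter. -/
def cnt (l : Bool × Bool) (w : List (Bool × Bool)) : ℕ := (w.filter fun x => x = l).length

theorem hF_mk (w : List (Bool × Bool)) :
    hF (FreeGroup.mk w) = (cnt (true, true) w : ℤ) - cnt (true, false) w := by
  induction w with
  | nil => rfl
  | cons l w ih =>
    have h1 : FreeGroup.mk [(true, true)] = gt := rfl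
    have h2 : FreeGroup.mk [(false, true)] = ga := rfl
    have h3 : FreeGroup.mk [(true, false)] = gt⁻¹ := mk_not true true
    have h4 : FreeGroup.mk [(false, false)] = ga⁻¹ := mk_not false true
    rw [mk_cons, hF_mul, ih]
    rcases l with ⟨_ | _, _ | _⟩
    · rw [h4, hF_inv, hF_ga]; simp [cnt]
    · rw [h2, hF_ga]; simp [cnt]
    · rw [h3, hF_inv, hF_gt]; simp [cnt]; ring
    · rw [h1, hF_gt]; simp [cnt]; ring

/-- The combinatorial form of triviality in the limit group. -/
def Triv (w : List (Bool × Bool)) : Prop :=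
  cnt (true, true) w = cnt (true, false) w ∧
    MemM (stage (2 * w.length)).1 (stage (2 * w.length)).2
      (List.replicate w.length (true, true) ++ (w ++ List.replicate w.length (true, false)))

theorem triv_iff (w : List (Bool × Bool)) : Triv w ↔ (FreeGroup.mk w : GG) = 1 := by
  rw [QuotientGroup.eq_one_iff, Triv, memM_iff]
  change _ ∧ _ ∈ MS (2 * w.length) ↔ _
  rw [mk_append, mk_append, mk_replicate, mk_replicate, mk_true_false, inv_pow, ← mul_assoc]
  have h0 : cnt (true, true) w = cnt (true, false) w ↔ hF (FreeGroup.mk w) = 0 := by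
    rw [hF_mk]
    lia
  have h1 : (FreeGroup.mk w : Fr) ∈ NI → hF (FreeGroup.mk w) = 0 := by
    intro h
    rw [hF, htF_eq_one_of_mem_NI h]
    rfl
  have h2 : hF (FreeGroup.mk w) = 0 → (gt ^ w.length * FreeGroup.mk w * (gt ^ w.length)⁻¹ ∈
      MS (2 * w.length) ↔ FreeGroup.mk w ∈ NI) := by
    intro h
    obtain ⟨p, hp, h3⟩ := exists_mem_PP w le_rfl
    rw [h, add_zero, zpow_natCast] at h3
    rw [← mem_NI_iff]
    · exact ⟨fun h => by
        have := Subgroup.Normal.conj_mem (inferInstanceAs NI.Normal) _ h (gt ^ w.length)⁻¹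
        have e : (gt ^ w.length)⁻¹ * (gt ^ w.length * FreeGroup.mk w * (gt ^ w.length)⁻¹) *
            (gt ^ w.length)⁻¹⁻¹ = FreeGroup.mk w := by group
        rwa [e] at this, fun h =>
        Subgroup.Normal.conj_mem (inferInstanceAs NI.Normal) _ h (gt ^ w.length)⟩
    · rw [h3, mul_inv_cancel_right]
      rwa [two_mul]
  show _ ∧ gt ^ w.length * FreeGroup.mk w * (gt ^ w.length)⁻¹ ∈ _ ↔ _
  rw [h0]
  exact ⟨fun h => (h2 h.1).1 h.2, fun h => ⟨h1 h, (h2 (h1 h)).2 h⟩⟩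

/-! ### Pumping in the limit group -/

/-- The height of an element of the limit group. -/
def hG (x : GG) : ℤ := (htG x).toAdd

theorem hG_mk (x : Fr) : hG x = hF x := rfl

theorem hG_mul (x y : GG) : hG (x * y) = hG x + hG y := by
  rw [hG, map_mul]
  rfl

theorem hG_inv (x : GG) : hG x⁻¹ = -hG x := by
  rw [hG, map_inv]
  rfl

theorem natCard_lab_le {V : Type} [Finite V] {n k m c Y : ℕ} (hY : Nat.card V ≤ bnd Y)
    (hk : k ≤ n) (hm : m ≤ n) (hc : c ≤ n) :
    Nat.card (Lab V (Fin k × Fin m) m c × ℤˣ) ≤ KK n Y := by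
  have h1 : Nat.card (Win c) = 2 * c + 1 := by
    rw [Nat.card_eq_fintype_card]
    simp
    lia
  rw [Nat.card_prod, Nat.card_fun, Nat.card_prod, h1, mul_comm, KK]
  have h2 : Nat.card ℤˣ = 2 := by simp
  have h3 : Nat.card (Option ((Fin k × Fin m) × Fin m)) ≤ n ^ 3 + 1 := by
    rw [Finite.card_option, Nat.card_prod, Nat.card_prod, Nat.card_fin, Nat.card_fin]
    have : k * m * m ≤ n * n * n := Nat.mul_le_mul (Nat.mul_le_mul hk hm) hm
    lia
  rw [h2]
  refine Nat.mul_le_mul_left _ ((Nat.pow_le_pow_left h3 _).trans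
    (Nat.pow_le_pow_right (Nat.succ_pos _) ?_))
  exact Nat.mul_le_mul (by lia) hY

theorem snakeWord_pump_GG {m c k : ℕ} {W : ℕ → List (Bool × Bool)} (hW : ∀ s, (W s).length ≤ c)
    {D : List ((ℕ × ℕ) × ℕ × ℕ × ℕ)} {w : ℕ → ℕ × ℕ} {N : ℕ}
    (hw : SnakeWord (fun s => (FreeGroup.mk (W s) : GG)) m (k, D) w (N + 1))
    (hbig : KK (k + m + 2 * c) (Yv (k + m + 2 * c)) + 2 * c + 2 <
      |hG (pprod (fun s => (FreeGroup.mk (W s) : GG)) w N)|) (N' : ℕ) :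
    ∃ w', SnakeWord (fun s => (FreeGroup.mk (W s) : GG)) m (k, D) w' N' := by
  set n := k + m + 2 * c with hn
  set E : ℕ → GG := fun s => (FreeGroup.mk (W s) : GG) with hE
  have h1 : ∀ s, ∃ p ∈ PP (n + 1), gt ^ c * FreeGroup.mk (W s) * (gt ^ c)⁻¹ =
      p * gt ^ hF (FreeGroup.mk (W s)) := by
    intro s
    obtain ⟨p, hp, h⟩ := exists_mem_PP (W s) (hW s)
    refine ⟨p, PP_mono (by have := hW s; lia) hp, ?_⟩
    rw [h, add_comm, zpow_add, zpow_natCast]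
    group
  have h2 : ∀ s, ∃ p ∈ PP (n + 1), (gt ^ c * FreeGroup.mk (W s) * (gt ^ c)⁻¹)⁻¹ =
      p * gt ^ (-hF (FreeGroup.mk (W s))) := by
    intro s
    obtain ⟨p, hp, h⟩ := exists_mem_PP (FreeGroup.invRev (W s)) (i := c) (by
      rw [FreeGroup.invRev_length]
      exact hW s)
    rw [FreeGroup.invRev_length, ← FreeGroup.inv_mk, hF_inv] at *
    refine ⟨p, PP_mono (by have := hW s; lia) hp, ?_⟩
    have h' : (gt ^ c * FreeGroup.mk (W s) * (gt ^ c)⁻¹)⁻¹ =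
      gt ^ c * (FreeGroup.mk (W s))⁻¹ * (gt ^ c)⁻¹ := by group
    rw [h', h, add_comm, zpow_add, zpow_natCast]
    group
  choose p hp h1 using h1
  choose q hq h2 using h2
  let ρ : Rule (VV (MS n) n) (Fin k × Fin m) m c :=
    { dir := Prod.snd
      Dm := fun x s y => (((x.1 : ℕ), (x.2 : ℕ)), (s : ℕ), (y.1 : ℕ), (y.2 : ℕ)) ∈ D
      κ := fun s => -hF (FreeGroup.mk (W s))
      α := fun s => toV (MS n) (inv_mem (hp s))
      hκ := fun s => by
        have := abs_le.1 (abs_hF_mk_le (W s))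
        have := hW s
        rw [Finset.mem_Icc]
        lia }
  have h3 : ∀ s : Fin m, ρ.step (conjEquiv (gt : Fr ⧸ MS n) (AA_le (MS n) n) (map_AA_le (MS n) n)) s
      = rhoS n (gt ^ c * FreeGroup.mk (W s) * (gt ^ c)⁻¹)⁻¹ := by
    intro s
    rw [h1, mul_inv_rev, map_mul, ← zpow_neg, map_zpow, rhoS, rho_gt,
      rho_of_mem _ (inv_mem (hp s))]
    rfl
  have h4 : ∀ s : Fin m, ρ.step (conjEquiv (gt : Fr ⧸ MS n) (AA_le (MS n) n) (map_AA_le (MS n) n)) s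
      = of (toV (MS n) (hq s)) * t ^ ρ.κ s := by
    intro s
    rw [h3, h2, map_mul, map_zpow, rhoS, rho_gt, rho_of_mem _ (hq s)]
  rw [← snakeWord_conj ((gt ^ c : Fr) : GG)] at hw
  obtain ⟨w', hw'⟩ := snakeWord_pump ρ (piS n) (fun s => ((gt ^ c : Fr) : GG) * E s *
    ((gt ^ c : Fr) : GG)⁻¹) D rfl (fun _ _ _ => Iff.rfl) (fun s => by
      rw [h3, piS_rho]
      rfl) h4 hG (fun x => htG_piS n x) (K := KK n (Yv n)) (R := RR n (Yv n))
      (natCard_lab_le (natCard_VV n) (by lia) (by lia) (by lia)) (by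
        unfold RR
        have : KK n (Yv n) * (c + 3 * KK n (Yv n)) ≤ KK n (Yv n) * (n + 3 * KK n (Yv n)) :=
          Nat.mul_le_mul_left _ (by lia)
        lia) (fun h hb => piS_injOn hb) hw (by
        rw [pprod_conj, hG_inv, hG_mul, hG_mul, hG_inv, abs_neg]
        convert hbig using 2
        ring) N'
  exact ⟨w', (snakeWord_conj _).1 hw'⟩

end SnakeGroup

/-! ### Snakes and snake words -/

section Snakes

variable {Q : Type} [Group Q] {m : ℕ} {e : Fin m → Q} {E : ℕ → Q}
  {T : ℕ × List ((ℕ × ℕ) × ℕ × ℕ × ℕ)}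

theorem pprod_eq_of_step {n : ℕ} {ω : ZMod n → Q} {x : ZMod n → ℕ × ℕ}
    (h : ∀ i, ω (i + 1) = ω i * E (x i).2) (i : ℕ) :
    pprod E (fun i => x (i : ZMod n)) i = (ω 0)⁻¹ * ω (i : ZMod n) := by
  induction i with
  | zero => simp [pprod]
  | succ i ih =>
    rw [pprod, ih, Nat.cast_succ, h, mul_assoc]

theorem snakeWord_of_strongDirSnake (hE : ∀ s (h : s < m), E s = e ⟨s, h⟩) {n N : ℕ} {ω : ZMod n → Q}
    {x : ZMod n → ℕ × ℕ} (h1 : Function.Injective ω) (h2 : ∀ i, (x i).1 < T.1 ∧ (x i).2 < m)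
    (h3 : ∀ i, ω (i + 1) = ω i * E (x i).2)
    (h4 : ∀ i j : ZMod n, ∀ s : Fin m, ω j = ω i * e s → (x i, ((s : ℕ), x j)) ∈ T.2)
    (hN : ∀ i < N, ∀ j < N, (i : ZMod n) = j → i = j) :
    SnakeWord E m T (fun i => x (i : ZMod n)) N := by
  refine ⟨fun i _ => h2 i, fun i hi j hj => ⟨fun h => ?_, fun s hs h => ?_⟩⟩
  · rw [pprod_eq_of_step h3, pprod_eq_of_step h3, mul_right_inj] at h
    exact hN i hi j hj (h1 h)
  · rw [pprod_eq_of_step h3, pprod_eq_of_step h3, mul_assoc, mul_right_inj, hE s hs] at h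
    exact h4 i j ⟨s, hs⟩ h

theorem strongDirSnake_iff_of_pos (hE : ∀ s (h : s < m), E s = e ⟨s, h⟩) {n : ℕ} (hn : 0 < n) :
    StrongDirSnake e T n ↔ ∃ w, SnakeWord E m T w n ∧ pprod E w n = 1 := by
  have : NeZero n := ⟨hn.ne'⟩
  constructor
  · rintro ⟨ω, x, h1, h2, h3, h4⟩
    have h3' : ∀ i, ω (i + 1) = ω i * E (x i).2 := fun i => by
      obtain ⟨h, h'⟩ := h3 i
      rw [h', hE _ h]
    refine ⟨_, snakeWord_of_strongDirSnake hE h1 h2 h3' h4 fun i hi j hj h => ?_, ?_⟩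
    · rw [ZMod.natCast_eq_natCast_iff', Nat.mod_eq_of_lt hi, Nat.mod_eq_of_lt hj] at h
      exact h
    · rw [pprod_eq_of_step h3', ZMod.natCast_self, inv_mul_cancel]
  · rintro ⟨w, ⟨h1, h2⟩, h3⟩
    refine ⟨fun i => pprod E w i.val, fun i => w i.val, ?_, ?_, ?_, ?_⟩
    · intro i j h
      exact ZMod.val_injective n ((h2 _ i.val_lt _ j.val_lt).1 h)
    · exact fun i => h1 _ i.val_lt
    · intro i
      refine ⟨(h1 _ i.val_lt).2, ?_⟩
      rw [← hE]
      have h5 : (i + 1).val = (i.val + 1) % n := by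
        rw [← ZMod.val_natCast]
        simp
      change pprod E w (i + 1).val = pprod E w (i.val + 1)
      rw [h5]
      rcases Nat.lt_or_ge (i.val + 1) n with h | h
      · rw [Nat.mod_eq_of_lt h]
      · have h6 : i.val + 1 = n := by
          have := i.val_lt
          lia
        rw [h6, Nat.mod_self, h3]
        rfl
    · intro i j s h
      have h' : pprod E w j.val = pprod E w i.val * e s := h
      exact (h2 _ i.val_lt _ j.val_lt).2 s s.2 (by rw [h', hE s s.2])

theorem exists_int_walk (E : ℕ → Q) (X : ℤ → ℕ × ℕ) :
    ∃ ω : ℤ → Q, ∀ i, ω (i + 1) = ω i * E (X i).2 := by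
  let B : ℕ → Q := fun n => n.rec 1 fun n b => b * (E (X (-(n + 1 : ℕ))).2)⁻¹
  refine ⟨fun i => if 0 ≤ i then pprod E (fun j => X j) i.toNat else B (-i).toNat, fun i => ?_⟩
  rcases lt_trichotomy i (-1) with h | h | h
  · obtain ⟨n, rfl⟩ : ∃ n : ℕ, i = -(n + 1 : ℕ) := ⟨(-i - 1).toNat, by lia⟩
    have hn : n ≠ 0 := by lia
    beta_reduce
    rw [if_neg (by lia), if_neg (by lia)]
    have e1 : (-(-(n + 1 : ℕ) + 1) : ℤ).toNat = n := by lia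
    have e2 : (-(-(n + 1 : ℕ)) : ℤ).toNat = n + 1 := by lia
    rw [e1, e2]
    exact (inv_mul_cancel_right _ _).symm
  · subst h
    exact (inv_mul_cancel_right 1 (E (X (-1)).2)).symm.trans rfl
  · obtain ⟨n, rfl⟩ := Int.eq_ofNat_of_zero_le (show 0 ≤ i by lia)
    beta_reduce
    rw [if_pos (by lia), if_pos (by lia)]
    rfl

theorem strongDirSnake_zero_iff (hE : ∀ s (h : s < m), E s = e ⟨s, h⟩) :
    StrongDirSnake e T 0 ↔ ∀ N, ∃ w, SnakeWord E m T w N := by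
  constructor
  · rintro ⟨ω, x, h1, h2, h3, h4⟩ N
    have h3' : ∀ i, ω (i + 1) = ω i * E (x i).2 := fun i => by
      obtain ⟨h, h'⟩ := h3 i
      rw [h', hE _ h]
    refine ⟨_, snakeWord_of_strongDirSnake hE h1 h2 h3' h4 fun i _ j _ h => ?_⟩
    exact Int.ofNat_inj.1 h
  · intro h
    choose w hw using fun N => h (2 * N + 1)
    let U := Filter.hyperfilter ℕ
    have hlim : ∀ i : ℤ, ∃ c, ∀ᶠ N in U, w N (i + N).toNat = c := by
      intro i
      have hfin : (Set.Iio T.1 ×ˢ Set.Iio m : Set (ℕ × ℕ)).Finite :=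
        (Set.finite_Iio _).prod (Set.finite_Iio _)
      have hev : ∀ᶠ N in U, w N (i + N).toNat ∈ (Set.Iio T.1 ×ˢ Set.Iio m : Set (ℕ × ℕ)) := by
        refine Filter.Eventually.filter_mono Nat.hyperfilter_le_atTop ?_
        filter_upwards [Filter.eventually_ge_atTop i.natAbs] with N hN
        exact (hw N).1 _ (by lia)
      obtain ⟨c, -, hc⟩ := (Ultrafilter.eventually_exists_mem_iff
        (P := fun c N => w N (i + N).toNat = c) hfin).1 (hev.mono fun N hN => ⟨_, hN, rfl⟩)
      exact ⟨c, hc⟩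
    choose X hX using hlim
    obtain ⟨ω, hω⟩ := exists_int_walk E X
    have hagree : ∀ M : ℕ, ∃ N, M ≤ N ∧ ∀ i ∈ Finset.Icc (-M : ℤ) M, w N (i + N).toNat = X i := by
      intro M
      have h1 : ∀ᶠ N in U, ∀ i ∈ Finset.Icc (-M : ℤ) M, w N (i + N).toNat = X i :=
        (Filter.eventually_all_finset _).2 fun i _ => hX i
      have h2 : ∀ᶠ N in U, M ≤ N :=
        Filter.Eventually.filter_mono Nat.hyperfilter_le_atTop (Filter.eventually_ge_atTop M)
      exact (h2.and h1).exists
    have hpair : ∀ i j : ℤ, ∃ (N a b : ℕ) (q : Q), a < 2 * N + 1 ∧ b < 2 * N + 1 ∧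
        (a : ℤ) = i + N ∧ (b : ℤ) = j + N ∧ w N a = X i ∧ w N b = X j ∧
        ω i = q * pprod E (w N) a ∧ ω j = q * pprod E (w N) b := by
      intro i j
      obtain ⟨N, hN, hag⟩ := hagree (max i.natAbs j.natAbs)
      set M := max i.natAbs j.natAbs with hM
      have key : ∀ n : ℕ, n ≤ 2 * M → ω (-M + n) = ω (-M) * (pprod E (w N) (N - M))⁻¹ *
          pprod E (w N) (N - M + n) := by
        intro n
        induction n with
        | zero => intro; simp
        | succ n ih =>
          intro hn
          have e1 : (-M + (n + 1 : ℕ) : ℤ) = (-M + n) + 1 := by push_cast; ring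
          have e2 := hag (-M + n) (by rw [Finset.mem_Icc]; lia)
          have e3 : (-(M : ℤ) + n + N).toNat = N - M + n := by lia
          rw [e1, hω, ih (by lia), ← add_assoc, pprod, ← e2, e3, mul_assoc _ (pprod E (w N) _)]
      have key2 : ∀ i : ℤ, i.natAbs ≤ M → ω i = ω (-M) * (pprod E (w N) (N - M))⁻¹ *
          pprod E (w N) (i + N).toNat := by
        intro i hi
        have := key (i + M).toNat (by lia)
        have e1 : (-(M : ℤ) + (i + M).toNat) = i := by lia
        have e2 : N - M + (i + M).toNat = (i + N).toNat := by lia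
        rwa [e1, e2] at this
      refine ⟨N, (i + N).toNat, (j + N).toNat, _, by lia, by lia, by lia, by lia, ?_, ?_,
        key2 i (by lia), key2 j (by lia)⟩
      · exact hag i (by rw [Finset.mem_Icc]; lia)
      · exact hag j (by rw [Finset.mem_Icc]; lia)
    refine ⟨ω, X, ?_, ?_, ?_, ?_⟩
    · intro i j hij
      obtain ⟨N, a, b, q, ha, hb, ha', hb', -, -, h1, h2⟩ := hpair i j
      rw [h1, h2, mul_right_inj] at hij
      have := ((hw N).2 a ha b hb).1 hij
      lia
    · intro i
      obtain ⟨N, a, b, q, ha, hb, ha', hb', h1, -, -, -⟩ := hpair i i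
      rw [← h1]
      exact (hw N).1 a ha
    · intro i
      obtain ⟨N, a, b, q, ha, hb, ha', hb', h1, -, -, -⟩ := hpair i i
      have h2 : (X i).2 < m := by
        rw [← h1]
        exact ((hw N).1 a ha).2
      refine ⟨h2, ?_⟩
      rw [← hE]
      exact hω i
    · intro i j s hs
      obtain ⟨N, a, b, q, ha, hb, ha', hb', h1, h2, h3, h4⟩ := hpair i j
      rw [← h1, ← h2]
      refine ((hw N).2 a ha b hb).2 s s.2 ?_
      rwa [h3, h4, mul_assoc, mul_right_inj, ← hE] at hs

end Snakes

/-! ### Infinite snakes leave every bounded height range -/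

namespace SnakeGroup

open scoped Pointwise

section

variable {m c : ℕ} {W : ℕ → List (Bool × Bool)} {T : ℕ × List ((ℕ × ℕ) × ℕ × ℕ × ℕ)}

theorem hG_one : hG 1 = 0 := by
  have := hG_mul 1 1
  rw [mul_one] at this
  lia

theorem exists_mem_PG_of_abs_hG_le (hW : ∀ s, (W s).length ≤ c) {w : ℕ → ℕ × ℕ} {N B : ℕ}
    (hB : ∀ i < N, |hG (pprod (fun s => (FreeGroup.mk (W s) : GG)) w i)| ≤ B) :
    ∀ i < N, ∃ p ∈ PG (2 * B + 2 * c + 1),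
      ((gt : Fr) : GG) ^ (B + c) * pprod (fun s => (FreeGroup.mk (W s) : GG)) w i =
        p * ((gt : Fr) : GG) ^
          (((B + c : ℕ) : ℤ) + hG (pprod (fun s => (FreeGroup.mk (W s) : GG)) w i)) := by
  intro i
  induction i with
  | zero =>
    intro _
    refine ⟨1, one_mem _, ?_⟩
    rw [pprod, hG_one, add_zero, zpow_natCast, mul_one, one_mul]
  | succ i ih =>
    intro hi
    obtain ⟨p, hp, h⟩ := ih (by lia)
    have hb := abs_le.1 (hB i (by lia))
    have hc := hW (w i).2
    set E : ℕ → GG := fun s => (FreeGroup.mk (W s) : GG) with hE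
    set u := W (w i).2 with hu
    obtain ⟨n, hn⟩ := Int.eq_ofNat_of_zero_le
      (show 0 ≤ ((B + c : ℕ) : ℤ) + hG (pprod E w i) by push_cast; lia)
    obtain ⟨q, hq, h'⟩ := exists_mem_PP u (i := n) (by lia)
    have hq' : (q : GG) ∈ PG (2 * B + 2 * c + 1) :=
      Subgroup.mem_map_of_mem _ (PP_mono (by lia) hq)
    refine ⟨p * q, mul_mem hp hq', ?_⟩
    have h'' := congrArg (fun x : Fr => (x : GG)) h'
    simp only [QuotientGroup.mk_mul, QuotientGroup.mk_pow, QuotientGroup.mk_zpow] at h''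
    rw [pprod, hG_mul, ← mul_assoc, h, ← add_assoc, hn, zpow_natCast, mul_assoc, mul_assoc]
    exact congrArg (p * ·) h''

theorem exists_height_gt (hW : ∀ s, (W s).length ≤ c)
    (h : ∀ N, ∃ w, SnakeWord (fun s => (FreeGroup.mk (W s) : GG)) m T w N) (B : ℕ) :
    ∃ N w, SnakeWord (fun s => (FreeGroup.mk (W s) : GG)) m T w (N + 1) ∧
      (B : ℤ) < |hG (pprod (fun s => (FreeGroup.mk (W s) : GG)) w N)| := by
  by_contra! hc
  let P := PG (2 * B + 2 * c + 1)
  let M := Nat.card (P × Fin (2 * B + 1))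
  obtain ⟨w, hw⟩ := h (M + 1)
  have hB : ∀ i < M + 1, |hG (pprod (fun s => (FreeGroup.mk (W s) : GG)) w i)| ≤ B :=
    fun i hi => hc i w (hw.mono hi)
  choose! p hp hpe using exists_mem_PG_of_abs_hG_le hW hB
  have hcard := Nat.card_le_card_of_injective
    (fun i : Fin (M + 1) => ((⟨p i, hp i i.2⟩,
      ⟨(hG (pprod (fun s => (FreeGroup.mk (W s) : GG)) w i) + B).toNat, by
        have := abs_le.1 (hB i i.2)
        lia⟩) : P × Fin (2 * B + 1))) (by
    intro i j hij
    have h1 := congrArg (fun x => (x.1 : GG)) hij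
    have h2 := congrArg (fun x => x.2.val) hij
    dsimp only at h1 h2
    have hi := abs_le.1 (hB i i.2)
    have hj := abs_le.1 (hB j j.2)
    have h3 : hG (pprod (fun s => (FreeGroup.mk (W s) : GG)) w i) =
      hG (pprod (fun s => (FreeGroup.mk (W s) : GG)) w j) := by lia
    have h4 := hpe i i.2
    rw [h1, h3, ← hpe j j.2, mul_right_inj] at h4
    exact Fin.ext ((hw.2 i i.2 j j.2).1 h4))
  rw [Nat.card_eq_fintype_card, Fintype.card_fin] at hcard
  exact absurd hcard (by lia)

/-- The height a snake has to reach in order to be pumped to an infinite snake. -/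
def pumpHeight (m c k : ℕ) : ℕ := KK (k + m + 2 * c) (Yv (k + m + 2 * c)) + 2 * c + 2

theorem forall_snakeWord_iff (hW : ∀ s, (W s).length ≤ c) :
    (∀ N, ∃ w, SnakeWord (fun s => (FreeGroup.mk (W s) : GG)) m T w N) ↔
      ∃ N w, SnakeWord (fun s => (FreeGroup.mk (W s) : GG)) m T w (N + 1) ∧
        (pumpHeight m c T.1 : ℤ) < |hG (pprod (fun s => (FreeGroup.mk (W s) : GG)) w N)| := by
  refine ⟨fun h => exists_height_gt hW h _, ?_⟩
  rintro ⟨N, w, hw, h⟩ N'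
  refine snakeWord_pump_GG hW hw ?_ N'
  rw [pumpHeight] at h
  exact_mod_cast h

end

end SnakeGroup

/-! ### Primitive recursive predicates -/

section Primrec

variable {α β γ : Type*} [Primcodable α] [Primcodable β] [Primcodable γ]

theorem primrec_pow {f g : α → ℕ} (hf : Primrec f) (hg : Primrec g) :
    Primrec fun a => f a ^ g a :=
  (Primrec₂.unpaired'.1 Nat.Primrec.pow).comp hf hg

theorem primrecPred_forall_mem {f : α → List β} {p : α → β → Prop} (hf : Primrec f)
    (hp : PrimrecPred fun x : α × β => p x.1 x.2) : PrimrecPred fun a => ∀ b ∈ f a, p a b :=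
  (PrimrecRel.forall_mem_list (R := fun b a => p a b) (hp.comp (Primrec.snd.pair Primrec.fst))).comp
    hf Primrec.id

theorem primrecPred_exists_mem {f : α → List β} {p : α → β → Prop} (hf : Primrec f)
    (hp : PrimrecPred fun x : α × β => p x.1 x.2) : PrimrecPred fun a => ∃ b ∈ f a, p a b :=
  (PrimrecRel.exists_mem_list (R := fun b a => p a b) (hp.comp (Primrec.snd.pair Primrec.fst))).comp
    hf Primrec.id

theorem primrecPred_forall_lt {f : α → ℕ} {p : α → ℕ → Prop} (hf : Primrec f)
    (hp : PrimrecPred fun x : α × ℕ => p x.1 x.2) : PrimrecPred fun a => ∀ i < f a, p a i :=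
  (primrecPred_forall_mem (Primrec.list_range.comp hf) hp).of_eq fun a => by simp

theorem primrecPred_exists_lt {f : α → ℕ} {p : α → ℕ → Prop} (hf : Primrec f)
    (hp : PrimrecPred fun x : α × ℕ => p x.1 x.2) : PrimrecPred fun a => ∃ i < f a, p a i :=
  (primrecPred_exists_mem (Primrec.list_range.comp hf) hp).of_eq fun a => by simp

theorem primrecPred_forall_fintype [Fintype β] {p : α → β → Prop}
    (hp : PrimrecPred fun x : α × β => p x.1 x.2) : PrimrecPred fun a => ∀ b, p a b :=
  (primrecPred_forall_mem (Primrec.const (Finset.univ (α := β)).toList) hp).of_eq fun a => by simp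

theorem primrecPred_imp {p q : α → Prop} (hp : PrimrecPred p) (hq : PrimrecPred q) :
    PrimrecPred fun a => p a → q a := by
  classical
  exact (hp.not.or hq).of_eq fun a => imp_iff_not_or.symm

theorem primrec_filter {f : α → List β} {p : α → β → Prop} [∀ a, DecidablePred (p a)]
    (hf : Primrec f) (hp : PrimrecPred fun x : α × β => p x.1 x.2) :
    Primrec fun a => (f a).filter fun b => p a b := by
  have h := Primrec.ite (hp.comp (Primrec.id (α := α × β))) (Primrec.list_cons.comp Primrec.snd (Primrec.const []))
    (Primrec.const ([] : List β))
  refine (Primrec.list_flatMap hf (g := fun a b => if p a b then [b] else []) h).of_eq fun a => ?_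
  induction f a with
  | nil => rfl
  | cons b l ih =>
    rw [List.flatMap_cons, ih, List.filter_cons]
    by_cases h : p a b <;> simp [h]

theorem primrec_replicate {f : α → ℕ} {g : α → β} (hf : Primrec f) (hg : Primrec g) :
    Primrec fun a => List.replicate (f a) (g a) := by
  refine (Primrec.list_map (Primrec.list_range.comp hf) (g := fun a _ => g a)
    (hg.comp Primrec.fst)).of_eq fun a => ?_
  simp

theorem rePred_exists {p : α → ℕ → Prop} (hp : PrimrecPred fun x : α × ℕ => p x.1 x.2) :
    REPred fun a => ∃ n, p a n := by
  classical
  have h1 := (Partrec.rfind (p := fun a => (fun n => decide (p a n) : ℕ → Bool))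
    hp.decide.to_comp.partrec).dom_re
  refine h1.of_eq fun a => ?_
  constructor
  · intro h
    obtain ⟨n, hn, -⟩ := Nat.rfind_dom.1 h
    exact ⟨n, by simpa using hn⟩
  · rintro ⟨n, hn⟩
    exact Nat.rfind_dom.2 ⟨n, by simpa using hn, fun _ => trivial⟩

end Primrec

/-! ### Decidability of the word problem -/

namespace SnakeGroup

section Primrec

variable {α : Type*} [Primcodable α]

theorem primrec_act {Y q x : α → ℕ} {l : α → Bool × Bool} (hY : Primrec Y) (hq : Primrec q)
    (hl : Primrec l) (hx : Primrec x) : Primrec fun a => act (Y a) (q a) (l a) (x a) := by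
  have h1 : Primrec fun a => 2 * (l a).1.toNat + (l a).2.toNat :=
    (Primrec.dom_finite fun l : Bool × Bool => 2 * l.1.toNat + l.2.toNat).comp hl
  have h2 := Primrec.nat_add.comp (Primrec.nat_mul.comp h1 hY) hx
  exact Primrec.nat_mod.comp (Primrec.nat_div.comp hq (primrec_pow hY h2)) hY

theorem primrec_run {Y q x : α → ℕ} {w : α → List (Bool × Bool)} (hY : Primrec Y) (hq : Primrec q)
    (hw : Primrec w) (hx : Primrec x) : Primrec fun a => run (Y a) (q a) (w a) (x a) :=
  Primrec.list_foldr (h := fun a s => act (Y a) (q a) s.1 s.2) hw hx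
    (primrec_act (hY.comp Primrec.fst) (hq.comp Primrec.fst) (Primrec.fst.comp Primrec.snd)
      (Primrec.snd.comp Primrec.snd))

theorem primrecPred_valid {Y q : α → ℕ} (hY : Primrec Y) (hq : Primrec q) :
    PrimrecPred fun a => Valid (Y a) (q a) := by
  refine primrecPred_forall_fintype (primrecPred_forall_lt (hY.comp Primrec.fst) ?_)
  have hY' := (hY.comp Primrec.fst).comp (Primrec.fst (α := α × (Bool × Bool)) (β := ℕ))
  have hq' := (hq.comp Primrec.fst).comp (Primrec.fst (α := α × (Bool × Bool)) (β := ℕ))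
  have hl' := Primrec.snd.comp (Primrec.fst (α := α × (Bool × Bool)) (β := ℕ))
  have hx' := Primrec.snd (α := α × (Bool × Bool)) (β := ℕ)
  exact Primrec.eq.comp (primrec_act hY' hq'
    ((Primrec.dom_finite fun l : Bool × Bool => (l.1, !l.2)).comp hl')
    (primrec_act hY' hq' hl' hx')) hx'

theorem primrecPred_kills {Y q : α → ℕ} {w : α → List (Bool × Bool)} (hY : Primrec Y)
    (hq : Primrec q) (hw : Primrec w) : PrimrecPred fun a => Kills (Y a) (q a) (w a) :=
  primrecPred_forall_lt hY (Primrec.eq.comp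
    (primrec_run (hY.comp Primrec.fst) (hq.comp Primrec.fst) (hw.comp Primrec.fst) Primrec.snd)
    Primrec.snd)

theorem primrecPred_memM {Y : α → ℕ} {r : α → List (List (Bool × Bool))}
    {w : α → List (Bool × Bool)} (hY : Primrec Y) (hr : Primrec r) (hw : Primrec w) :
    PrimrecPred fun a => MemM (Y a) (r a) (w a) := by
  refine primrecPred_forall_lt (primrec_pow hY (Primrec.nat_mul.comp (Primrec.const 4) hY)) ?_
  refine primrecPred_imp (primrecPred_valid (hY.comp Primrec.fst) Primrec.snd)
    (primrecPred_imp (primrecPred_forall_mem (hr.comp Primrec.fst) ?_)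
      (primrecPred_kills (hY.comp Primrec.fst) Primrec.snd (hw.comp Primrec.fst)))
  exact primrecPred_kills ((hY.comp Primrec.fst).comp Primrec.fst)
    (Primrec.snd.comp Primrec.fst) Primrec.snd

theorem primrec_aW {i : α → ℕ} (hi : Primrec i) : Primrec fun a => aW (i a) :=
  Primrec.list_append.comp (primrec_replicate hi (Primrec.const _))
    (Primrec.list_cons.comp (Primrec.const _) (primrec_replicate hi (Primrec.const _)))

theorem primrec_digs {n ℓ q : α → ℕ} (hn : Primrec n) (hl : Primrec ℓ) (hq : Primrec q) :
    Primrec fun a => digs (n a) (ℓ a) (q a) := by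
  have hn' := Primrec.succ.comp (hn.comp (Primrec.fst (α := α) (β := ℕ)))
  exact Primrec.list_map (g := fun a j => q a / (n a + 1) ^ j % (n a + 1))
    (Primrec.list_range.comp hl)
    (Primrec.nat_mod.comp (Primrec.nat_div.comp (hq.comp Primrec.fst)
      (primrec_pow hn' Primrec.snd)) hn')

theorem primrec_candidates {n L : α → ℕ} (hn : Primrec n) (hL : Primrec L) :
    Primrec fun a => candidates (n a) (L a) := by
  have hn1 := hn.comp (Primrec.fst (α := α) (β := ℕ))
  have hn2 := hn1.comp (Primrec.fst (α := α × ℕ) (β := ℕ))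
  have h1 : Primrec fun x : (α × ℕ) × ℕ => pw (digs (n x.1.1) x.1.2 x.2) :=
    Primrec.list_flatMap (g := fun _ i => aW i)
      (primrec_digs hn2 (Primrec.snd.comp Primrec.fst) Primrec.snd) (primrec_aW Primrec.snd)
  have h2 : Primrec fun x : α × ℕ =>
      (List.range ((n x.1 + 1) ^ x.2)).map fun q => pw (digs (n x.1) x.2 q) :=
    Primrec.list_map (g := fun (x : α × ℕ) q => pw (digs (n x.1) x.2 q))
      (Primrec.list_range.comp (primrec_pow (Primrec.succ.comp hn1) Primrec.snd)) h1
  exact Primrec.list_flatMap (g := fun a ℓ =>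
    (List.range ((n a + 1) ^ ℓ)).map fun q => pw (digs (n a) ℓ q))
    (Primrec.list_range.comp (Primrec.succ.comp hL)) h2

theorem primrec_bnd {Y : α → ℕ} (hY : Primrec Y) : Primrec fun a => bnd (Y a) :=
  primrec_pow (primrec_pow hY hY) (primrec_pow (primrec_pow hY hY) (Primrec.const 2))

theorem primrec_KK {n Y : α → ℕ} (hn : Primrec n) (hY : Primrec Y) :
    Primrec fun a => KK (n a) (Y a) :=
  Primrec.nat_mul.comp (Primrec.const 2) (primrec_pow
    (Primrec.succ.comp (primrec_pow hn (Primrec.const 3)))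
    (Primrec.nat_mul.comp (Primrec.succ.comp (Primrec.nat_mul.comp (Primrec.const 2) hn))
      (primrec_bnd hY)))

theorem primrec_RR {n Y : α → ℕ} (hn : Primrec n) (hY : Primrec Y) :
    Primrec fun a => RR (n a) (Y a) := by
  have hK := primrec_KK hn hY
  have h1 := Primrec.nat_mul.comp hK
    (Primrec.nat_add.comp hn (Primrec.nat_mul.comp (Primrec.const 3) hK))
  have h2 := Primrec.nat_mul.comp (Primrec.const 2) hK
  exact Primrec.nat_add.comp (Primrec.nat_add.comp (Primrec.nat_add.comp h1 h2) hn)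
    (Primrec.const 4)

theorem primrec_stage : Primrec stage := by
  have hn := Primrec.fst (α := ℕ) (β := ℕ × List (List (Bool × Bool)))
  have hY := Primrec.fst.comp (Primrec.snd (α := ℕ) (β := ℕ × List (List (Bool × Bool))))
  have hr := Primrec.snd.comp (Primrec.snd (α := ℕ) (β := ℕ × List (List (Bool × Bool))))
  have hb := primrec_bnd hY
  have h1 := Primrec.nat_add.comp hY (primrec_pow (Primrec.nat_mul.comp (Primrec.const 3)
    (primrec_pow hb (Primrec.const 2))) (primrec_RR hn hY))
  have h2 := primrec_candidates hn (Primrec.succ.comp (Primrec.nat_mul.comp (Primrec.const 2) hb))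
  have h3 := primrec_filter h2 (p := fun x w => MemM x.2.1 x.2.2 w)
    (primrecPred_memM (hY.comp Primrec.fst) (hr.comp Primrec.fst) Primrec.snd)
  refine (Primrec.nat_rec₁ ((2, [[(true, true)], [(false, true), (false, true)]]) :
    ℕ × List (List (Bool × Bool))) (f := fun n x => (x.1 + (3 * bnd x.1 ^ 2) ^ RR n x.1,
      (candidates n (2 * bnd x.1 + 1)).filter fun w => MemM x.1 x.2 w)) (h1.pair h3)).of_eq
    fun n => ?_
  induction n with
  | zero => rfl
  | succ n ih =>
    simp only at ih ⊢
    rw [ih]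
    rfl

theorem primrec_cnt {l : Bool × Bool} {w : α → List (Bool × Bool)} (hw : Primrec w) :
    Primrec fun a => cnt l (w a) :=
  Primrec.list_length.comp (primrec_filter (p := fun _ x => x = l) hw
    (Primrec.eq.comp Primrec.snd (Primrec.const l)))

theorem primrecPred_triv {w : α → List (Bool × Bool)} (hw : Primrec w) :
    PrimrecPred fun a => Triv (w a) := by
  have hl := Primrec.list_length.comp hw
  have hs := primrec_stage.comp (Primrec.nat_mul.comp (Primrec.const 2) hl)
  refine PrimrecPred.and (Primrec.eq.comp (primrec_cnt hw) (primrec_cnt hw)) ?_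
  exact primrecPred_memM (Primrec.fst.comp hs) (Primrec.snd.comp hs)
    (Primrec.list_append.comp (primrec_replicate hl (Primrec.const _))
      (Primrec.list_append.comp hw (primrec_replicate hl (Primrec.const _))))

theorem primrec_pumpHeight {m c : ℕ} {k : α → ℕ} (hk : Primrec k) :
    Primrec fun a => pumpHeight m c (k a) := by
  have h1 := Primrec.nat_add.comp (Primrec.nat_add.comp hk (Primrec.const m))
    (Primrec.const (2 * c))
  exact Primrec.nat_add.comp (Primrec.nat_add.comp
    (primrec_KK h1 (Primrec.fst.comp (primrec_stage.comp h1))) (Primrec.const (2 * c)))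
    (Primrec.const 2)

end Primrec

end SnakeGroup

/-! ### Decidability of the snake problems -/

namespace SnakeGroup

/-- The sequence of colours encoded by a number. -/
def colours (m k q i : ℕ) : ℕ × ℕ := (q / (k * m) ^ i % (k * m) / m, q / (k * m) ^ i % (k * m) % m)

theorem exists_colours {m k N : ℕ} {w : ℕ → ℕ × ℕ} (hw : ∀ i < N, (w i).1 < k ∧ (w i).2 < m) :
    ∃ q < (k * m) ^ N, ∀ i < N, w i = colours m k q i := by
  have hlt : ∀ i < N, (w i).1 * m + (w i).2 < k * m := fun i hi => by
    obtain ⟨h1, h2⟩ := hw i hi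
    nlinarith
  let F : Fin N → Fin (k * m) := fun i => ⟨(w i).1 * m + (w i).2, hlt i i.2⟩
  refine ⟨finFunctionFinEquiv F, (finFunctionFinEquiv F).2, fun i hi => ?_⟩
  have h4 := congrFun (finFunctionFinEquiv.symm_apply_apply F) ⟨i, hi⟩
  have h5 : (finFunctionFinEquiv F : ℕ) / (k * m) ^ i % (k * m) = (w i).1 * m + (w i).2 :=
    congrArg Fin.val h4
  obtain ⟨h1, h2⟩ := hw i hi
  have hm : 0 < m := by lia
  rw [colours, h5, Nat.mul_comm, Nat.mul_add_div hm, Nat.mul_add_mod, Nat.div_eq_of_lt h2,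
    Nat.mod_eq_of_lt h2, add_zero]

/-- The word read along the first `i` steps of a snake. -/
def pword (W : ℕ → List (Bool × Bool)) (w : ℕ → ℕ × ℕ) (i : ℕ) : List (Bool × Bool) :=
  (List.range i).flatMap fun j => W (w j).2

theorem mk_pword (W : ℕ → List (Bool × Bool)) (w : ℕ → ℕ × ℕ) (i : ℕ) :
    (FreeGroup.mk (pword W w i) : GG) = pprod (fun s => (FreeGroup.mk (W s) : GG)) w i := by
  induction i with
  | zero => rfl
  | succ i ih =>
    rw [pprod, ← ih, pword, List.range_succ, List.flatMap_append, mk_append,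
      QuotientGroup.mk_mul, List.flatMap_singleton]
    rfl

theorem triv_invRev_append (u v : List (Bool × Bool)) :
    Triv (FreeGroup.invRev u ++ v) ↔ (FreeGroup.mk u : GG) = FreeGroup.mk v := by
  rw [triv_iff, mk_append, QuotientGroup.mk_mul, ← FreeGroup.inv_mk, QuotientGroup.mk_inv,
    inv_mul_eq_one]

section

variable {m c : ℕ} {W : ℕ → List (Bool × Bool)} {T : ℕ × List ((ℕ × ℕ) × ℕ × ℕ × ℕ)}

theorem snakeWord_iff {w : ℕ → ℕ × ℕ} {N : ℕ} :
    SnakeWord (fun s => (FreeGroup.mk (W s) : GG)) m T w N ↔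
      (∀ i < N, (w i).1 < T.1 ∧ (w i).2 < m) ∧ ∀ i < N, ∀ j < N,
        (Triv (FreeGroup.invRev (pword W w i) ++ pword W w j) → i = j) ∧
        ∀ s < m, Triv (FreeGroup.invRev (pword W w j) ++ (pword W w i ++ W s)) →
          (w i, s, w j) ∈ T.2 := by
  simp only [triv_invRev_append, mk_append, QuotientGroup.mk_mul, mk_pword]
  rfl

section Primrec

variable {α : Type*} [Primcodable α]

theorem primrec_colours {k q i : α → ℕ} (hk : Primrec k) (hq : Primrec q) (hi : Primrec i) :
    Primrec fun a => colours m (k a) (q a) (i a) := by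
  have h1 := Primrec.nat_mul.comp hk (Primrec.const m)
  have h2 := Primrec.nat_mod.comp (Primrec.nat_div.comp hq (primrec_pow h1 hi)) h1
  exact (Primrec.nat_div.comp h2 (Primrec.const m)).pair (Primrec.nat_mod.comp h2 (Primrec.const m))

theorem primrec_pword (hW : Primrec W) {k q i : α → ℕ} (hk : Primrec k) (hq : Primrec q)
    (hi : Primrec i) : Primrec fun a => pword W (colours m (k a) (q a)) (i a) :=
  Primrec.list_flatMap (g := fun a j => W (colours m (k a) (q a) j).2)
    (Primrec.list_range.comp hi) (hW.comp (Primrec.snd.comp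
      (primrec_colours (hk.comp Primrec.fst) (hq.comp Primrec.fst) Primrec.snd)))

theorem primrec_invRev {w : α → List (Bool × Bool)} (hw : Primrec w) :
    Primrec fun a => FreeGroup.invRev (w a) :=
  Primrec.list_reverse.comp (Primrec.list_map (g := fun _ (x : Bool × Bool) => (x.1, !x.2)) hw
    ((Primrec.dom_finite fun l : Bool × Bool => (l.1, !l.2)).comp Primrec.snd))

theorem primrecPred_snakeWord (hW : Primrec W) {T : α → ℕ × List ((ℕ × ℕ) × ℕ × ℕ × ℕ)}
    {N q : α → ℕ} (hT : Primrec T) (hN : Primrec N) (hq : Primrec q) :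
    PrimrecPred fun a => SnakeWord (fun s => (FreeGroup.mk (W s) : GG)) m (T a)
      (colours m (T a).1 (q a)) (N a) := by
  have hk := Primrec.fst.comp hT
  have f1 := Primrec.fst (α := α) (β := ℕ)
  have s1 := Primrec.snd (α := α) (β := ℕ)
  have f2 := Primrec.fst (α := α × ℕ) (β := ℕ)
  have s2 := Primrec.snd (α := α × ℕ) (β := ℕ)
  have f3 := Primrec.fst (α := (α × ℕ) × ℕ) (β := ℕ)
  have s3 := Primrec.snd (α := (α × ℕ) × ℕ) (β := ℕ)
  have fj := (f1.comp f2).pair s2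
  have c1 : Primrec fun x : α × ℕ => colours m (T x.1).1 (q x.1) x.2 :=
    primrec_colours (hk.comp f1) (hq.comp f1) s1
  have p1 : Primrec fun x : α × ℕ => pword W (colours m (T x.1).1 (q x.1)) x.2 :=
    primrec_pword hW (hk.comp f1) (hq.comp f1) s1
  have d1 : PrimrecPred fun x : α × ℕ => (colours m (T x.1).1 (q x.1) x.2).1 < (T x.1).1 ∧
      (colours m (T x.1).1 (q x.1) x.2).2 < m :=
    (Primrec.nat_lt.comp (Primrec.fst.comp c1) (hk.comp f1)).and
      (Primrec.nat_lt.comp (Primrec.snd.comp c1) (Primrec.const m))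
  have d2 : PrimrecPred fun x : (α × ℕ) × ℕ =>
      Triv (FreeGroup.invRev (pword W (colours m (T x.1.1).1 (q x.1.1)) x.1.2) ++
        pword W (colours m (T x.1.1).1 (q x.1.1)) x.2) → x.1.2 = x.2 :=
    primrecPred_imp (primrecPred_triv (Primrec.list_append.comp (primrec_invRev (p1.comp f2))
      (p1.comp fj))) (Primrec.eq.comp (s1.comp f2) s2)
  have d3 : PrimrecPred fun x : ((α × ℕ) × ℕ) × ℕ =>
      Triv (FreeGroup.invRev (pword W (colours m (T x.1.1.1).1 (q x.1.1.1)) x.1.2) ++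
        (pword W (colours m (T x.1.1.1).1 (q x.1.1.1)) x.1.1.2 ++ W x.2)) :=
    primrecPred_triv (Primrec.list_append.comp (primrec_invRev (p1.comp (fj.comp f3)))
      (Primrec.list_append.comp (p1.comp (f2.comp f3)) (hW.comp s3)))
  have d4 : Primrec fun x : ((α × ℕ) × ℕ) × ℕ => (colours m (T x.1.1.1).1 (q x.1.1.1) x.1.1.2, x.2,
      colours m (T x.1.1.1).1 (q x.1.1.1) x.1.2) :=
    (c1.comp (f2.comp f3)).pair (s3.pair (c1.comp (fj.comp f3)))
  have d5 : PrimrecPred fun x : ((α × ℕ) × ℕ) × ℕ =>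
      (colours m (T x.1.1.1).1 (q x.1.1.1) x.1.1.2, x.2,
        colours m (T x.1.1.1).1 (q x.1.1.1) x.1.2) ∈ (T x.1.1.1).2 :=
    (primrecPred_exists_mem (p := fun (x : ((α × ℕ) × ℕ) × ℕ) y =>
      y = (colours m (T x.1.1.1).1 (q x.1.1.1) x.1.1.2, x.2,
        colours m (T x.1.1.1).1 (q x.1.1.1) x.1.2))
      ((Primrec.snd.comp hT).comp (f1.comp (f2.comp f3)))
      (Primrec.eq.comp Primrec.snd (d4.comp Primrec.fst))).of_eq fun x =>
        ⟨fun ⟨_, h, h'⟩ => h' ▸ h, fun h => ⟨_, h, rfl⟩⟩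
  have d6 := d2.and (primrecPred_forall_lt (f := fun _ => m) (Primrec.const m)
    (p := fun (x : (α × ℕ) × ℕ) s =>
      Triv (FreeGroup.invRev (pword W (colours m (T x.1.1).1 (q x.1.1)) x.2) ++
        (pword W (colours m (T x.1.1).1 (q x.1.1)) x.1.2 ++ W s)) →
      (colours m (T x.1.1).1 (q x.1.1) x.1.2, s,
        colours m (T x.1.1).1 (q x.1.1) x.2) ∈ (T x.1.1).2) (primrecPred_imp d3 d5))
  exact ((primrecPred_forall_lt hN d1).and (primrecPred_forall_lt hN
    (primrecPred_forall_lt (hN.comp f1) d6))).of_eq fun a => snakeWord_iff.symm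

end Primrec

/-- There is a snake word of length `N`. -/
def HasSnake (W : ℕ → List (Bool × Bool)) (m : ℕ) (T : ℕ × List ((ℕ × ℕ) × ℕ × ℕ × ℕ)) (N : ℕ) :
    Prop :=
  ∃ w, SnakeWord (fun s => (FreeGroup.mk (W s) : GG)) m T w N

/-- There is a closed snake word of length `N`. -/
def HasOuroboros (W : ℕ → List (Bool × Bool)) (m : ℕ) (T : ℕ × List ((ℕ × ℕ) × ℕ × ℕ × ℕ))
    (N : ℕ) : Prop :=
  ∃ w, SnakeWord (fun s => (FreeGroup.mk (W s) : GG)) m T w N ∧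
    pprod (fun s => (FreeGroup.mk (W s) : GG)) w N = 1

/-- There is a snake word of length `N + 1` ending at a large height. -/
def HasTallSnake (W : ℕ → List (Bool × Bool)) (m c : ℕ) (T : ℕ × List ((ℕ × ℕ) × ℕ × ℕ × ℕ))
    (N : ℕ) : Prop :=
  ∃ w, SnakeWord (fun s => (FreeGroup.mk (W s) : GG)) m T w (N + 1) ∧
    (pumpHeight m c T.1 : ℤ) < |hG (pprod (fun s => (FreeGroup.mk (W s) : GG)) w N)|

theorem exists_snakeWord_iff {N i : ℕ} (hi : i ≤ N) {P : GG → Prop} :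
    (∃ w, SnakeWord (fun s => (FreeGroup.mk (W s) : GG)) m T w N ∧
      P (pprod (fun s => (FreeGroup.mk (W s) : GG)) w i)) ↔
    ∃ q < (T.1 * m) ^ N, SnakeWord (fun s => (FreeGroup.mk (W s) : GG)) m T (colours m T.1 q) N ∧
      P (FreeGroup.mk (pword W (colours m T.1 q) i)) := by
  simp only [mk_pword]
  constructor
  · rintro ⟨w, hw, hP⟩
    obtain ⟨q, hq, h⟩ := exists_colours hw.1
    refine ⟨q, hq, hw.congr h, ?_⟩
    rwa [← pprod_congr _ fun j hj => h j (hj.trans_le hi)]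
  · rintro ⟨q, -, h⟩
    exact ⟨_, h⟩

section Primrec

variable {α : Type*} [Primcodable α] {N : α → ℕ} {T : α → ℕ × List ((ℕ × ℕ) × ℕ × ℕ × ℕ)}

theorem primrecPred_hasSnake (hW : Primrec W) (hT : Primrec T) (hN : Primrec N) :
    PrimrecPred fun a => HasSnake W m (T a) (N a) := by
  refine (primrecPred_exists_lt (p := fun a q => SnakeWord (fun s => (FreeGroup.mk (W s) : GG)) m
    (T a) (colours m (T a).1 q) (N a)) (primrec_pow (Primrec.nat_mul.comp (Primrec.fst.comp hT)
    (Primrec.const m)) hN) (primrecPred_snakeWord hW (hT.comp Primrec.fst) (hN.comp Primrec.fst)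
    Primrec.snd)).of_eq fun a => ?_
  have h := exists_snakeWord_iff (m := m) (W := W) (T := T a) (Nat.zero_le (N a))
    (P := fun _ => True)
  simp only [and_true] at h
  exact h.symm

theorem primrecPred_hasOuroboros (hW : Primrec W) (hT : Primrec T) (hN : Primrec N) :
    PrimrecPred fun a => HasOuroboros W m (T a) (N a) := by
  refine (primrecPred_exists_lt (p := fun a q => SnakeWord (fun s => (FreeGroup.mk (W s) : GG)) m
    (T a) (colours m (T a).1 q) (N a) ∧ Triv (pword W (colours m (T a).1 q) (N a)))
    (primrec_pow (Primrec.nat_mul.comp (Primrec.fst.comp hT) (Primrec.const m)) hN)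
    (PrimrecPred.and (primrecPred_snakeWord hW (hT.comp Primrec.fst) (hN.comp Primrec.fst)
      Primrec.snd) (primrecPred_triv (primrec_pword hW ((Primrec.fst.comp hT).comp Primrec.fst)
      Primrec.snd (hN.comp Primrec.fst))))).of_eq fun a => ?_
  simp only [triv_iff]
  exact (exists_snakeWord_iff le_rfl (P := fun x => x = 1)).symm

theorem lt_abs_hG_mk {B : ℕ} {w : List (Bool × Bool)} : (B : ℤ) < |hG (FreeGroup.mk w : GG)| ↔
    cnt (true, false) w + B < cnt (true, true) w ∨ cnt (true, true) w + B < cnt (true, false) w := by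
  rw [hG_mk, hF_mk, lt_abs]
  lia

theorem primrecPred_hasTallSnake (hW : Primrec W) (hT : Primrec T) (hN : Primrec N) :
    PrimrecPred fun a => HasTallSnake W m c (T a) (N a) := by
  have hw := primrec_pword (m := m) hW ((Primrec.fst.comp hT).comp (Primrec.fst (β := ℕ)))
    Primrec.snd (hN.comp Primrec.fst)
  have hB := (primrec_pumpHeight (m := m) (c := c) (Primrec.fst.comp hT)).comp
    (Primrec.fst (β := ℕ))
  have h1 := primrec_cnt (l := (true, true)) hw
  have h2 := primrec_cnt (l := (true, false)) hw
  refine (primrecPred_exists_lt (p := fun a q => SnakeWord (fun s => (FreeGroup.mk (W s) : GG)) m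
    (T a) (colours m (T a).1 q) (N a + 1) ∧
      (cnt (true, false) (pword W (colours m (T a).1 q) (N a)) + pumpHeight m c (T a).1 <
        cnt (true, true) (pword W (colours m (T a).1 q) (N a)) ∨
      cnt (true, true) (pword W (colours m (T a).1 q) (N a)) + pumpHeight m c (T a).1 <
        cnt (true, false) (pword W (colours m (T a).1 q) (N a))))
    (primrec_pow (Primrec.nat_mul.comp (Primrec.fst.comp hT) (Primrec.const m))
      (Primrec.succ.comp hN))
    (PrimrecPred.and (primrecPred_snakeWord hW (hT.comp Primrec.fst)
      (Primrec.succ.comp (hN.comp Primrec.fst)) Primrec.snd)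
      (PrimrecPred.or (Primrec.nat_lt.comp (Primrec.nat_add.comp h2 hB) h1)
        (Primrec.nat_lt.comp (Primrec.nat_add.comp h1 hB) h2)))).of_eq fun a => ?_
  simp only [← lt_abs_hG_mk]
  exact (exists_snakeWord_iff (Nat.le_succ _)
    (P := fun x => (pumpHeight m c (T a).1 : ℤ) < |hG x|)).symm

end Primrec

theorem computablePred_of_rePred {α : Type*} [Primcodable α] {p q r : α → Prop} (hq : REPred q)
    (hr : REPred r) (h1 : ∀ a, p a ↔ q a) (h2 : ∀ a, ¬ p a ↔ r a) : ComputablePred p :=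
  ComputablePred.computable_iff_re_compl_re'.2
    ⟨hq.of_eq fun a => (h1 a).symm, hr.of_eq fun a => (h2 a).symm⟩

variable {e : Fin m → GG}

theorem computablePred_infinite_snake (hW : Primrec W) (hc : ∀ s, (W s).length ≤ c)
    (hE : ∀ s (h : s < m), (FreeGroup.mk (W s) : GG) = e ⟨s, h⟩) :
    ComputablePred fun T : EncDirTileset => StrongDirSnake e T 0 := by
  have h0 : ∀ T : EncDirTileset, StrongDirSnake e T 0 ↔ ∀ N, HasSnake W m T N := fun T =>
    strongDirSnake_zero_iff (E := fun s => (FreeGroup.mk (W s) : GG)) hE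
  refine computablePred_of_rePred (q := fun T => ∃ N, HasTallSnake W m c T N)
    (r := fun T => ∃ N, ¬ HasSnake W m T N)
    (rePred_exists (primrecPred_hasTallSnake hW Primrec.fst Primrec.snd))
    (rePred_exists (primrecPred_hasSnake hW Primrec.fst Primrec.snd).not)
    (fun T => (h0 T).trans (forall_snakeWord_iff hc)) fun T => ?_
  rw [h0, not_forall]

theorem computablePred_snake (hW : Primrec W) (hc : ∀ s, (W s).length ≤ c)
    (hE : ∀ s (h : s < m), (FreeGroup.mk (W s) : GG) = e ⟨s, h⟩) :
    ComputablePred fun T : EncDirTileset => ∃ n, StrongDirSnake e T n := by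
  have h0 : ∀ T : EncDirTileset, StrongDirSnake e T 0 ↔ ∀ N, HasSnake W m T N := fun T =>
    strongDirSnake_zero_iff (E := fun s => (FreeGroup.mk (W s) : GG)) hE
  have h0' : ∀ T : EncDirTileset, StrongDirSnake e T 0 ↔ ∃ N, HasTallSnake W m c T N :=
    fun T => (h0 T).trans (forall_snakeWord_iff hc)
  have h1 : ∀ (T : EncDirTileset) n, StrongDirSnake e T (n + 1) ↔ HasOuroboros W m T (n + 1) :=
    fun T n => strongDirSnake_iff_of_pos (E := fun s => (FreeGroup.mk (W s) : GG)) hE n.succ_pos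
  refine computablePred_of_rePred
    (q := fun T => ∃ N, HasTallSnake W m c T N ∨ HasOuroboros W m T (N + 1))
    (r := fun T => ∃ N, ¬ HasSnake W m T N ∧ ∀ n < N, ¬ HasOuroboros W m T (n + 1))
    (rePred_exists ((primrecPred_hasTallSnake hW Primrec.fst Primrec.snd).or
      (primrecPred_hasOuroboros hW Primrec.fst (Primrec.succ.comp Primrec.snd))))
    (rePred_exists ((primrecPred_hasSnake hW Primrec.fst Primrec.snd).not.and
      (primrecPred_forall_lt Primrec.snd (primrecPred_hasOuroboros hW
        (Primrec.fst.comp Primrec.fst) (Primrec.succ.comp Primrec.snd)).not)))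
    (fun T => ?_) fun T => ?_
  · rw [exists_or, ← h0']
    simp only [← h1]
    constructor
    · rintro ⟨_ | n, h⟩
      · exact Or.inl h
      · exact Or.inr ⟨n, h⟩
    · rintro (h | ⟨n, h⟩)
      · exact ⟨0, h⟩
      · exact ⟨n + 1, h⟩
  · constructor
    · intro h
      have h2 : ¬ ∀ N, HasSnake W m T N := fun h3 => h ⟨0, (h0 T).2 h3⟩
      obtain ⟨N, hN⟩ := not_forall.1 h2
      exact ⟨N, hN, fun n _ h3 => h ⟨n + 1, (h1 T n).2 h3⟩⟩
    · rintro ⟨N, hN, h2⟩ ⟨_ | n, h⟩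
      · exact hN ((h0 T).1 h N)
      · rw [h1] at h
        rcases Nat.lt_or_ge n N with h3 | h3
        · exact h2 n h3 h
        · obtain ⟨w, hw, -⟩ := h
          exact hN ⟨w, hw.mono (by lia)⟩

theorem computablePred_snakes (e : Fin m → GG) :
    ComputablePred (fun T : EncDirTileset => ∃ n, StrongDirSnake e T n) ∧
      ComputablePred fun T : EncDirTileset => StrongDirSnake e T 0 := by
  have hex : ∀ s, ∃ u : List (Bool × Bool), (FreeGroup.mk u : GG) = e s := fun s => by
    obtain ⟨x, hx⟩ := QuotientGroup.mk_surjective (e s)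
    exact ⟨x.toWord, by rw [FreeGroup.mk_toWord, hx]⟩
  choose u hu using hex
  let L := List.ofFn u
  have hW : Primrec fun s => L.getD s [] := (Primrec.list_getD []).comp (Primrec.const L) Primrec.id
  have hE : ∀ s (h : s < m), (FreeGroup.mk (L.getD s []) : GG) = e ⟨s, h⟩ := fun s h => by
    have h' : L.getD s [] = u ⟨s, h⟩ := by simp [L, h]
    rw [h', hu]
  have hc : ∀ s, (L.getD s []).length ≤ (L.map List.length).sum := fun s => by
    rcases Nat.lt_or_ge s L.length with h | h
    · rw [List.getD_eq_getElem _ _ h]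
      exact List.le_sum_of_mem (List.mem_map_of_mem (List.getElem_mem h))
    · rw [List.getD_eq_default _ _ h]
      exact Nat.zero_le _
  exact ⟨computablePred_snake hW hc hE, computablePred_infinite_snake hW hc hE⟩

end

theorem closure_generators : Subgroup.closure ({((gt : Fr) : GG), ((ga : Fr) : GG)} : Set GG) = ⊤ := by
  have h1 := FreeGroup.closure_range_of Bool
  have h2 : Set.range (FreeGroup.of (α := Bool)) = {gt, ga} := by
    ext x
    simp [gt, ga, or_comm]
  have h3 := congrArg (Subgroup.map (QuotientGroup.mk' NI)) (h2 ▸ h1)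
  rw [MonoidHom.map_closure, Set.image_pair, Subgroup.map_top_of_surjective _
    (QuotientGroup.mk'_surjective NI)] at h3
  exact h3

end SnakeGroup

theorem exists_not_virtuallyFree_decidable_strong_directed_snake_problems :
    ∃ (G : Type) (instG : Group G) (S₀ : Finset G),
      Subgroup.closure (S₀ : Set G) = ⊤ ∧
      (¬ ∃ H : Subgroup G, H.FiniteIndex ∧ IsFreeGroup H) ∧
      (∀ S : Finset G, Subgroup.closure (S : Set G) = ⊤ →
        ∀ (m : ℕ) (e : Fin m → G), Function.Injective e → Set.range e = (S : Set G) →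
          -- the strong directed snake problem is decidable
          ComputablePred (fun T : EncDirTileset => ∃ n : ℕ, @StrongDirSnake G instG m e T n) ∧
          -- the strong directed infinite snake problem is decidable
          ComputablePred (fun T : EncDirTileset => @StrongDirSnake G instG m e T 0)) := by
  classical
  refine ⟨SnakeGroup.GG, inferInstance,
    {((SnakeGroup.gt : SnakeGroup.Fr) : SnakeGroup.GG), ((SnakeGroup.ga : SnakeGroup.Fr) : SnakeGroup.GG)},
    ?_, SnakeGroup.not_virtuallyFree, fun S _ m e _ _ => SnakeGroup.computablePred_snakes e⟩
  rw [Finset.coe_insert, Finset.coe_singleton]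
  exact SnakeGroup.closure_generators
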